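/- There exist a real number α > 11/40 and a natural number n_α such that for every integer n ≥ n_α, every finite set M of items, and every family v_1, …, v_n of XOS valuations on M, there exists a partition of M into n pairwise disjoint (possibly empty) parts P_1, …, P_n with union M such that v_i(P_i) ≥ α · MMS(M, v_i, 1/n) for every agent i ∈ {1, …, n}. -/

import Mathlib

open Finset

/-- `v` is an XOS valuation on the finite set `M`: there is a nonempty finite family of
nonnegative additive functions whose pointwise maximum gives `v` on all subsets of `M`. -/
def IsXOS {ι : Type} (M : Finset ι) (v : Finset ι → ℝ) : Prop :=
  ∃ (t : ℕ) (a : Fin (t + 1) → ι → ℝ),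
    (∀ j, ∀ e ∈ M, 0 ≤ a j e) ∧
    ∀ S ⊆ M, v S = Finset.univ.sup' Finset.univ_nonempty (fun j => ∑ e ∈ S, a j e)

/-- Maximin share of valuation `v` over the finite set `M` with entitlement `1/n`:
the maximum over all partitions of `M` into `n` pairwise disjoint (possibly empty) parts
of the minimum value of a part. -/
noncomputable def MMS {ι : Type} [DecidableEq ι] (M : Finset ι) (v : Finset ι → ℝ)
    (n : ℕ) : ℝ :=
  sSup { x | ∃ P : Fin n → Finset ι,
    (∀ i j, i ≠ j → Disjoint (P i) (P j)) ∧
    Finset.univ.biUnion P = M ∧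
    x = ⨅ i, v (P i) }

namespace Cert

/-- Subset selection sum of a list of naturals by bit mask. -/
def selN : List ℕ → ℕ → ℕ
  | [], _ => 0
  | x :: xs, m => (m % 2) * x + selN xs (m / 2)

def sumN : List ℕ → ℕ
  | [] => 0
  | x :: xs => x + sumN xs

def addL : List ℕ → List ℕ → List ℕ
  | [], b => b
  | a, [] => a
  | x :: xs, y :: ys => (x + y) :: addL xs ys

abbrev Vtx := List ℕ × List ℕ

def sig (P : Vtx) : ℕ := sumN P.1 + sumN P.2

inductive Tr where
  | N (i j : ℕ) (g h : List ℕ) (l r : Tr) : Tr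
  | L (ks : List (ℕ × ℕ × ℕ)) (ug uh : List ℕ) (cg ch : ℕ) (zg zh : List (ℕ × ℕ)) : Tr

/-- Upper bound for the value of a bundle at a vertex (scaled by 10^8). -/
def kup (P : Vtx) (g h : ℕ) : ℕ :=
  27501000 * (sig P * sig P) / ((sig P - selN P.1 g) * (sig P - selN P.2 h)) + 1

/-- All terms usable at the vertex. -/
def usable (P : Vtx) : List (ℕ × ℕ × ℕ) → Bool
  | [] => true
  | k :: ks => Nat.ble (selN P.1 k.1 + 1) (sig P) && (Nat.ble (selN P.2 k.2.1 + 1) (sig P) &&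
      (Nat.ble (kup P k.1 k.2.1 + 1) 63000000 && usable P ks))

def costK (P : Vtx) : List (ℕ × ℕ × ℕ) → ℕ
  | [] => 0
  | k :: ks => k.2.2 * kup P k.1 k.2.1 + costK P ks

def bitSum : List (ℕ × ℕ) → ℕ
  | [] => 0
  | k :: ks => k.2 * (k.1 % 2) + bitSum ks

def wSum : List (ℕ × ℕ) → ℕ
  | [] => 0
  | k :: ks => k.2 + wSum ks

def halve : List (ℕ × ℕ) → List (ℕ × ℕ)
  | [] => []
  | k :: ks => (k.1 / 2, k.2) :: halve ks

/-- Coverage check for every item of a group. -/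
def cov (c : ℕ) : List ℕ → List (ℕ × ℕ) → List (ℕ × ℕ) → Bool
  | [], _, _ => true
  | u :: us, ks, zs => Nat.ble (100000 + bitSum zs) (u + c + bitSum ks) &&
      cov c us (halve ks) (halve zs)

def pairOk (n : ℕ) : List (ℕ × ℕ) → Bool
  | [] => true
  | z :: zs => ([3, 5, 6, 9, 10, 12].contains z.1 && Nat.ble (z.1 + 1) (2 ^ n)) && pairOk n zs

def projG : List (ℕ × ℕ × ℕ) → List (ℕ × ℕ)
  | [] => []
  | k :: ks => (k.1, k.2.2) :: projG ks

def projH : List (ℕ × ℕ × ℕ) → List (ℕ × ℕ)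
  | [] => []
  | k :: ks => (k.2.1, k.2.2) :: projH ks

def vertsOk (ks : List (ℕ × ℕ × ℕ)) (lo hi : ℕ) : List Vtx → Bool
  | [] => true
  | P :: Ps => (usable P ks && Nat.ble (costK P ks + lo + 1) hi) && vertsOk ks lo hi Ps

def leafOk (p q : ℕ) (Ps : List Vtx) (ks : List (ℕ × ℕ × ℕ)) (ug uh : List ℕ) (cg ch : ℕ)
    (zg zh : List (ℕ × ℕ)) : Bool :=
  (Nat.beq ug.length p && Nat.beq uh.length q) &&
  ((cov cg ug (projG ks) zg && cov ch uh (projH ks) zh) &&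
  ((pairOk p zg && pairOk q zh) &&
  vertsOk ks (27501000 * (sumN ug + sumN uh) + 63000000 * (cg + ch))
    (10000000000000 + 27501000 * (wSum zg + wSum zh)) Ps))

def eqL : List ℕ → List ℕ → Bool
  | [], [] => true
  | x :: xs, y :: ys => Nat.beq x y && eqL xs ys
  | _, _ => false

def getP : List Vtx → ℕ → Vtx
  | [], _ => ([], [])
  | x :: _, 0 => x
  | _ :: xs, n + 1 => getP xs n

def setP : List Vtx → ℕ → Vtx → List Vtx
  | [], _, _ => []
  | _ :: xs, 0, y => y :: xs
  | x :: xs, n + 1, y => x :: setP xs n y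

def check (p q : ℕ) : Tr → List Vtx → Bool
  | .N i j g h l r, Ps =>
      ((Nat.ble (j + 1) i && Nat.ble (i + 1) Ps.length) &&
      (eqL g (addL (getP Ps i).1 (getP Ps j).1) && eqL h (addL (getP Ps i).2 (getP Ps j).2))) &&
      (check p q l (setP Ps j (g, h)) && check p q r (setP Ps i (g, h)))
  | .L ks ug uh cg ch zg zh, Ps => leafOk p q Ps ks ug uh cg ch zg zh

end Cert

namespace Cert

/-- Real subset selection. -/
noncomputable def sel : List ℝ → ℕ → ℝ
  | [], _ => 0
  | x :: xs, m => ((m % 2 : ℕ) : ℝ) * x + sel xs (m / 2)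

lemma selN_addL (a b : List ℕ) (m : ℕ) : selN (addL a b) m = selN a m + selN b m := by
  induction a generalizing b m with
  | nil => simp [addL, selN]
  | cons x xs ih =>
    cases b with
    | nil => simp [addL, selN]
    | cons y ys => simp only [addL, selN, ih]; ring

lemma sumN_addL (a b : List ℕ) : sumN (addL a b) = sumN a + sumN b := by
  induction a generalizing b with
  | nil => simp [addL, sumN]
  | cons x xs ih =>
    cases b with
    | nil => simp [addL, sumN]
    | cons y ys => simp only [addL, sumN, ih]; ring

lemma eqL_eq (a b : List ℕ) (h : eqL a b = true) : a = b := by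
  induction a generalizing b with
  | nil => cases b <;> simp_all [eqL]
  | cons x xs ih =>
    cases b with
    | nil => simp [eqL] at h
    | cons y ys =>
      simp only [eqL, Bool.and_eq_true] at h
      rw [Nat.eq_of_beq_eq_true h.1, ih _ h.2]

/-- Weighted evaluation of a functional over vertices. -/
noncomputable def ev (w : ℕ → ℝ) (f : Vtx → ℝ) : List Vtx → ℝ
  | [] => 0
  | P :: Ps => w 0 * f P + ev (fun n => w (n + 1)) f Ps

lemma ev_add (w : ℕ → ℝ) (f g : Vtx → ℝ) (Ps : List Vtx) :
    ev w (fun P => f P + g P) Ps = ev w f Ps + ev w g Ps := by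
  induction Ps generalizing w with
  | nil => simp [ev]
  | cons P Ps ih => simp only [ev, ih]; ring

lemma ev_smul (w : ℕ → ℝ) (c : ℝ) (f : Vtx → ℝ) (Ps : List Vtx) :
    ev w (fun P => c * f P) Ps = c * ev w f Ps := by
  induction Ps generalizing w with
  | nil => simp [ev]
  | cons P Ps ih => simp only [ev, ih]; ring

lemma ev_mono (w : ℕ → ℝ) (hw : ∀ n, 0 ≤ w n) (f g : Vtx → ℝ) (Ps : List Vtx)
    (h : ∀ P ∈ Ps, f P ≤ g P) : ev w f Ps ≤ ev w g Ps := by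
  induction Ps generalizing w with
  | nil => simp [ev]
  | cons P Ps ih =>
    simp only [ev]
    have h1 := mul_le_mul_of_nonneg_left (h P (by simp)) (hw 0)
    have h2 := ih (fun n => w (n + 1)) (fun n => hw _) (fun Q hQ => h Q (by simp [hQ]))
    linarith

lemma ev_w (w w' : ℕ → ℝ) (f : Vtx → ℝ) (Ps : List Vtx) (h : ∀ n < Ps.length, w n = w' n) :
    ev w f Ps = ev w' f Ps := by
  induction Ps generalizing w w' with
  | nil => simp [ev]
  | cons P Ps ih =>
    simp only [ev]
    rw [h 0 (by simp), ih (fun n => w (n + 1)) (fun n => w' (n + 1))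
      (fun n hn => h (n + 1) (by simpa using hn))]

lemma ev_upd (w : ℕ → ℝ) (f : Vtx → ℝ) (Ps : List Vtx) (i : ℕ) (hi : i < Ps.length) (x : ℝ) :
    ev (Function.update w i x) f Ps = ev w f Ps + (x - w i) * f (getP Ps i) := by
  induction Ps generalizing w i with
  | nil => simp at hi
  | cons P Ps ih =>
    cases i with
    | zero =>
      simp only [ev, getP, Function.update_self]
      rw [ev_w _ (fun n => w (n + 1)) f Ps (fun n _ => by simp [Function.update])]
      ring
    | succ i =>
      simp only [ev, getP]
      rw [ev_w _ (Function.update (fun n => w (n + 1)) i x) f Ps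
        (fun n _ => by simp [Function.update]), ih _ _ (by simpa using hi)]
      simp [Function.update]
      ring

lemma ev_setP (w : ℕ → ℝ) (f : Vtx → ℝ) (Ps : List Vtx) (i : ℕ) (hi : i < Ps.length) (Q : Vtx) :
    ev w f (setP Ps i Q) = ev w f Ps + w i * (f Q - f (getP Ps i)) := by
  induction Ps generalizing w i with
  | nil => simp at hi
  | cons P Ps ih =>
    cases i with
    | zero => simp only [ev, getP, setP]; ring
    | succ i =>
      simp only [ev, getP, setP]
      rw [ih _ _ (by simpa using hi)]
      ring

lemma setP_length (Ps : List Vtx) (i : ℕ) (Q : Vtx) : (setP Ps i Q).length = Ps.length := by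
  induction Ps generalizing i with
  | nil => simp [setP]
  | cons P Ps ih => cases i <;> simp [setP, ih]

lemma getP_setP_ne (Ps : List Vtx) (i j : ℕ) (h : i ≠ j) (Q : Vtx) :
    getP (setP Ps j Q) i = getP Ps i := by
  induction Ps generalizing i j with
  | nil => simp [setP]
  | cons P Ps ih =>
    cases i <;> cases j <;> simp_all [setP, getP]

/-- Data of a block configuration violating the desired conclusion. -/
structure Bad (p q : ℕ) (aG aH tG tH : List ℝ) : Prop where
  lg : aG.length = p
  lh : aH.length = q
  tot : 1 ≤ aG.sum + aH.sum
  cg : aG.sum ≤ 63 / 100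
  ch : aH.sum ≤ 63 / 100
  ng : ∀ x ∈ aG, 0 ≤ x ∧ x ≤ 27501 / 100000
  nh : ∀ x ∈ aH, 0 ≤ x ∧ x ≤ 27501 / 100000
  pg : ∀ m ∈ [3, 5, 6, 9, 10, 12], m < 2 ^ p → 27501 / 100000 ≤ sel aG m
  ph : ∀ m ∈ [3, 5, 6, 9, 10, 12], m < 2 ^ q → 27501 / 100000 ≤ sel aH m
  bad : ∀ g h : ℕ, min (sel aG g + sel aH h) (63 / 100) * (1 - sel tG g) * (1 - sel tH h)
    ≤ 27501 / 100000

structure Rep (tG tH : List ℝ) (w : ℕ → ℝ) (Ps : List Vtx) : Prop where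
  nn : ∀ n, 0 ≤ w n
  one : ev w (fun P => (sig P : ℝ)) Ps = 1
  eg : ∀ m, sel tG m ≤ ev w (fun P => (selN P.1 m : ℝ)) Ps
  eh : ∀ m, sel tH m ≤ ev w (fun P => (selN P.2 m : ℝ)) Ps

lemma ev_split (w : ℕ → ℝ) (f : Vtx → ℝ) (Ps : List Vtx) (i j : ℕ) (hi : i < Ps.length)
    (hj : j < Ps.length) (hij : i ≠ j) (Q : Vtx) (hQ : f Q = f (getP Ps i) + f (getP Ps j)) :
    ev (Function.update w i (w i - w j)) f (setP Ps j Q) = ev w f Ps := by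
  rw [ev_upd _ _ _ _ (by rwa [setP_length]), ev_setP _ _ _ _ hj, getP_setP_ne _ _ _ hij, hQ]
  ring

lemma Rep.split {tG tH : List ℝ} {w : ℕ → ℝ} {Ps : List Vtx} (h : Rep tG tH w Ps) (i j : ℕ)
    (hi : i < Ps.length) (hj : j < Ps.length) (hij : i ≠ j) (Q : Vtx)
    (h1 : ∀ m, selN Q.1 m = selN (getP Ps i).1 m + selN (getP Ps j).1 m)
    (h2 : ∀ m, selN Q.2 m = selN (getP Ps i).2 m + selN (getP Ps j).2 m)
    (h3 : sig Q = sig (getP Ps i) + sig (getP Ps j))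
    (hw : w j ≤ w i) : Rep tG tH (Function.update w i (w i - w j)) (setP Ps j Q) := by
  refine ⟨?_, ?_, ?_, ?_⟩
  · intro n
    by_cases hn : n = i
    · subst hn; simp [hw]
    · simp [hn, h.nn]
  · rw [ev_split _ _ _ _ _ hi hj hij _ (by rw [h3]; push_cast; ring), h.one]
  · intro m
    rw [ev_split _ _ _ _ _ hi hj hij _ (by rw [h1]; push_cast; ring)]
    exact h.eg m
  · intro m
    rw [ev_split _ _ _ _ _ hi hj hij _ (by rw [h2]; push_cast; ring)]
    exact h.eh m

lemma amgm (X Y : ℝ) (hX : 0 < X) (hY : 0 < Y) : 3 - X - Y ≤ 1 / (X * Y) := by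
  rw [le_div_iff₀ (by positivity)]
  -- (3 - X - Y) X Y ≤ 1
  nlinarith [mul_nonneg hX.le (sq_nonneg (X - 1)), mul_nonneg hY.le (sq_nonneg (Y - 1)),
    mul_nonneg hX.le (sq_nonneg (Y - 1)), mul_nonneg hY.le (sq_nonneg (X - 1)),
    sq_nonneg (X - Y), sq_nonneg (X * Y - 1), sq_nonneg (X + Y - 2),
    mul_nonneg hX.le (sq_nonneg (X - Y)), mul_nonneg hY.le (sq_nonneg (X - Y)),
    mul_nonneg (add_pos hX hY).le (sq_nonneg (X + Y - 2)), mul_pos hX hY]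

lemma kup_spec (P : Vtx) (g h : ℕ) (hg : selN P.1 g < sig P) (hh : selN P.2 h < sig P) :
    (27501 / 100000 : ℝ) * (sig P * sig P) ≤
      (kup P g h / 100000000 : ℝ) * ((sig P - selN P.1 g) * (sig P - selN P.2 h)) := by
  have hpos : 0 < (sig P - selN P.1 g) * (sig P - selN P.2 h) :=
    Nat.mul_pos (by omega) (by omega)
  have h1 : 27501000 * (sig P * sig P) ≤ kup P g h * ((sig P - selN P.1 g) * (sig P - selN P.2 h)) := by
    unfold kup
    have := Nat.div_add_mod (27501000 * (sig P * sig P))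
      ((sig P - selN P.1 g) * (sig P - selN P.2 h))
    have h2 := Nat.mod_lt (27501000 * (sig P * sig P)) hpos
    rw [add_mul, mul_comm (_ / _)]
    omega
  have h3 : ((27501000 * (sig P * sig P) : ℕ) : ℝ) ≤
    ((kup P g h * ((sig P - selN P.1 g) * (sig P - selN P.2 h)) : ℕ) : ℝ) := by exact_mod_cast h1
  push_cast [Nat.cast_sub hg.le, Nat.cast_sub hh.le] at h3
  linarith

/-- Bound for the value of one bundle over a cell. -/
lemma term_bound {p q : ℕ} {aG aH tG tH : List ℝ} (hb : Bad p q aG aH tG tH) {w : ℕ → ℝ}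
    {Ps : List Vtx} (hr : Rep tG tH w Ps) (g h : ℕ)
    (hu : ∀ P ∈ Ps, selN P.1 g < sig P ∧ selN P.2 h < sig P ∧ kup P g h < 63000000) :
    sel aG g + sel aH h ≤ ev w (fun P => (sig P : ℝ) * (kup P g h / 100000000)) Ps := by
  set K := ev w (fun P => (sig P : ℝ) * (kup P g h / 100000000)) Ps with hK
  by_contra hlt
  push Not at hlt
  have hlin : ∀ (c : ℝ) (f : Vtx → ℝ), ev w (fun P => c * f P) Ps = c * ev w f Ps :=
    fun c f => ev_smul w c f Ps
  -- u and v
  obtain ⟨u, hru⟩ : ∃ u, u = ev w (fun P => (sig P : ℝ) + (-1) * (selN P.1 g : ℝ)) Ps := ⟨_, rfl⟩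
  obtain ⟨v, hrv⟩ : ∃ v, v = ev w (fun P => (sig P : ℝ) + (-1) * (selN P.2 h : ℝ)) Ps := ⟨_, rfl⟩
  have hule : u ≤ 1 - sel tG g := by
    rw [hru, ev_add, ev_smul, hr.one]; linarith [hr.eg g]
  have hvle : v ≤ 1 - sel tH h := by
    rw [hrv, ev_add, ev_smul, hr.one]; linarith [hr.eh h]
  have hKle : K ≤ 62999999 / 100000000 := by
    have : K ≤ ev w (fun P => (62999999 / 100000000 : ℝ) * (sig P : ℝ)) Ps := by
      apply ev_mono w hr.nn
      intro P hP
      have h1 : (kup P g h : ℝ) ≤ 62999999 := by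
        have := (hu P hP).2.2
        exact_mod_cast (by omega : kup P g h ≤ 62999999)
      have h2 : (0 : ℝ) ≤ sig P := by positivity
      nlinarith
    rw [ev_smul, hr.one] at this
    linarith
  have hK0 : 27501 / 100000 ≤ K := by
    have : ev w (fun P => (27501 / 100000 : ℝ) * (sig P : ℝ)) Ps ≤ K := by
      apply ev_mono w hr.nn
      intro P hP
      obtain ⟨h1, h2, h3⟩ := hu P hP
      have hs := kup_spec P g h h1 h2
      have h1' : (selN P.1 g : ℝ) + 1 ≤ sig P := by exact_mod_cast h1
      have h2' : (selN P.2 h : ℝ) + 1 ≤ sig P := by exact_mod_cast h2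
      have hx : (0 : ℝ) ≤ selN P.1 g := by positivity
      have hy : (0 : ℝ) ≤ selN P.2 h := by positivity
      have hk : (0 : ℝ) ≤ (kup P g h : ℝ) / 100000000 := by positivity
      have hsig : (0 : ℝ) < sig P := by linarith
      have h4 : ((sig P : ℝ) - selN P.1 g) * (sig P - selN P.2 h) ≤ sig P * sig P := by
        apply mul_le_mul <;> linarith
      have h5 := mul_le_mul_of_nonneg_left h4 hk
      have h6 : (27501 / 100000 : ℝ) ≤ kup P g h / 100000000 := by
        have : (0 : ℝ) < sig P * sig P := by positivity
        by_contra hc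
        push Not at hc
        nlinarith
      nlinarith
    rw [ev_smul, hr.one] at this
    linarith
  -- positivity of u v
  have hpos : ∀ f : Vtx → ℝ, (∀ P ∈ Ps, (sig P : ℝ) * (1 / 100000000) ≤ f P) →
      1 / 100000000 ≤ ev w f Ps := by
    intro f hf
    have := ev_mono w hr.nn (fun P => (1 / 100000000 : ℝ) * (sig P : ℝ)) f Ps
      (fun P hP => by have := hf P hP; linarith)
    rw [ev_smul, hr.one] at this
    linarith
  have hpos2 : ∀ f : Vtx → ℝ, (∀ P ∈ Ps, (0 : ℝ) < f P) → 0 < ev w f Ps := by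
    intro f hf
    by_contra hc
    push Not at hc
    have h0 : ∀ (Qs : List Vtx) (w' : ℕ → ℝ), (∀ n, 0 ≤ w' n) → (∀ P ∈ Qs, (0 : ℝ) < f P) →
        ev w' f Qs ≤ 0 → ∀ f', ev w' f' Qs = 0 := by
      intro Qs
      induction Qs with
      | nil => intros; simp [ev]
      | cons Q Qs ih =>
        intro w' hw' hf' hle f'
        simp only [ev] at hle ⊢
        have h1 : 0 ≤ ev (fun n => w' (n + 1)) f Qs := by
          have := ev_mono (fun n => w' (n + 1)) (fun n => hw' _) (fun P => (0 : ℝ) * f P) f Qs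
            (fun P hP => by have := hf' P (by simp [hP]); linarith)
          rw [ev_smul] at this
          linarith
        have hq := hf' Q (by simp)
        have h2 : 0 ≤ w' 0 * f Q := mul_nonneg (hw' 0) hq.le
        have h3 : w' 0 = 0 := by
          by_contra h3
          have : 0 < w' 0 := lt_of_le_of_ne (hw' 0) (Ne.symm h3)
          have := mul_pos this hq
          linarith
        rw [ih (fun n => w' (n + 1)) (fun n => hw' _) (fun P hP => hf' P (by simp [hP]))
          (by linarith) f', h3]
        ring
    have := h0 Ps w hr.nn hf hc (fun P => (sig P : ℝ))
    rw [hr.one] at this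
    norm_num at this
  have hu0 : 0 < u := by
    rw [hru]
    apply hpos2
    intro P hP
    have h1' : (selN P.1 g : ℝ) + 1 ≤ sig P := by exact_mod_cast (hu P hP).1
    linarith
  have hv0 : 0 < v := by
    rw [hrv]
    apply hpos2
    intro P hP
    have h1' : (selN P.2 h : ℝ) + 1 ≤ sig P := by exact_mod_cast (hu P hP).2.1
    linarith
  have hbad := hb.bad g h
  have hmin : K < min (sel aG g + sel aH h) (63 / 100) := by
    apply lt_min hlt
    linarith
  have hlt2 : K * u * v < 27501 / 100000 := by
    have h1 := mul_lt_mul_of_pos_right (mul_lt_mul_of_pos_right hmin hu0) hv0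
    have hm0 : 0 ≤ min (sel aG g + sel aH h) (63 / 100) := by linarith
    have h2 : min (sel aG g + sel aH h) (63 / 100) * u * v ≤
        min (sel aG g + sel aH h) (63 / 100) * (1 - sel tG g) * (1 - sel tH h) := by
      apply mul_le_mul _ hvle hv0.le
      · exact mul_nonneg hm0 (by linarith)
      · exact mul_le_mul_of_nonneg_left hule hm0
    linarith
  -- tangent
  have htan : ev w (fun P => (27501 / 100000 : ℝ) / (u * v) * ((3 : ℝ) * (sig P : ℝ) +
      ((-1 / u) * ((sig P : ℝ) + (-1) * (selN P.1 g : ℝ)) +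
       (-1 / v) * ((sig P : ℝ) + (-1) * (selN P.2 h : ℝ))))) Ps ≤ K := by
    apply ev_mono w hr.nn
    intro P hP
    obtain ⟨h1, h2, h3⟩ := hu P hP
    have hs := kup_spec P g h h1 h2
    have h1' : (selN P.1 g : ℝ) + 1 ≤ sig P := by exact_mod_cast h1
    have h2' : (selN P.2 h : ℝ) + 1 ≤ sig P := by exact_mod_cast h2
    have hx : (0 : ℝ) ≤ selN P.1 g := by positivity
    have hy : (0 : ℝ) ≤ selN P.2 h := by positivity
    have hsig : (0 : ℝ) < sig P := by linarith
    set s : ℝ := (sig P : ℝ)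
    set r1 := s - (selN P.1 g : ℝ) with hr1
    set r2 := s - (selN P.2 h : ℝ) with hr2
    have p1 : 0 < r1 := by linarith
    have p2 : 0 < r2 := by linarith
    set k : ℝ := (kup P g h : ℝ) / 100000000
    have ham := amgm (r1 / (s * u)) (r2 / (s * v)) (by positivity) (by positivity)
    have hk : (27501 / 100000 : ℝ) * (s * s) / (r1 * r2) ≤ k := by
      rw [div_le_iff₀ (by positivity)]; exact hs
    have e1 : (27501 / 100000 : ℝ) / (u * v) * (3 * s + (-1 / u * (s + -1 * (selN P.1 g : ℝ)) +
        -1 / v * (s + -1 * (selN P.2 h : ℝ)))) =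
        (27501 / 100000 : ℝ) / (u * v) * s * (3 - r1 / (s * u) - r2 / (s * v)) := by
      rw [hr1, hr2]; field_simp; ring
    have e2 : (27501 / 100000 : ℝ) / (u * v) * s * (1 / (r1 / (s * u) * (r2 / (s * v)))) =
        s * ((27501 / 100000 : ℝ) * (s * s) / (r1 * r2)) := by
      field_simp
    rw [e1]
    calc _ ≤ (27501 / 100000 : ℝ) / (u * v) * s * (1 / (r1 / (s * u) * (r2 / (s * v)))) :=
          mul_le_mul_of_nonneg_left ham (by positivity)
      _ = _ := e2
      _ ≤ s * k := mul_le_mul_of_nonneg_left hk hsig.le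
  rw [ev_smul, ev_add, ev_add, ev_smul, ev_smul, ev_smul, ← hru, ← hrv, hr.one] at htan
  have e3 : (27501 / 100000 : ℝ) / (u * v) * (3 * 1 + (-1 / u * u + -1 / v * v)) =
      (27501 / 100000 : ℝ) / (u * v) := by
    field_simp; ring
  rw [e3, div_le_iff₀ (by positivity)] at htan
  linarith

noncomputable def dot : List ℕ → List ℝ → ℝ
  | u :: us, a :: as => (u : ℝ) * a + dot us as
  | _, _ => 0

noncomputable def wsel (a : List ℝ) : List (ℕ × ℕ) → ℝ
  | [] => 0
  | k :: ks => (k.2 : ℝ) * sel a k.1 + wsel a ks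

lemma wsel_cons (x : ℝ) (xs : List ℝ) (ks : List (ℕ × ℕ)) :
    wsel (x :: xs) ks = (bitSum ks : ℝ) * x + wsel xs (halve ks) := by
  induction ks with
  | nil => simp [wsel, bitSum, halve]
  | cons k ks ih => simp only [wsel, bitSum, halve, ih, sel]; push_cast; ring

lemma wsel_nil (ks : List (ℕ × ℕ)) : wsel [] ks = 0 := by
  induction ks with
  | nil => simp [wsel]
  | cons k ks ih => simp [wsel, ih, sel]

lemma cov_spec (c : ℕ) (us : List ℕ) (ks zs : List (ℕ × ℕ)) (a : List ℝ)
    (hl : us.length = a.length) (ha : ∀ x ∈ a, 0 ≤ x) (h : cov c us ks zs = true) :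
    100000 * a.sum + wsel a zs ≤ dot us a + c * a.sum + wsel a ks := by
  induction us generalizing ks zs a with
  | nil =>
    cases a with
    | nil => simp [wsel_nil, dot]
    | cons => simp at hl
  | cons u us ih =>
    cases a with
    | nil => simp at hl
    | cons x xs =>
      simp only [cov, Bool.and_eq_true, Nat.ble_eq] at h
      have h2 := ih (halve ks) (halve zs) xs (by simpa using hl)
        (fun y hy => ha y (by simp [hy])) h.2
      have h1 : ((100000 + bitSum zs : ℕ) : ℝ) ≤ ((u + c + bitSum ks : ℕ) : ℝ) := by
        exact_mod_cast h.1
      push_cast at h1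
      have h3 := mul_le_mul_of_nonneg_right h1 (ha x (by simp))
      rw [wsel_cons, wsel_cons, List.sum_cons]
      simp only [dot]
      nlinarith

lemma dot_le (us : List ℕ) (a : List ℝ) (c : ℝ) (hc : 0 ≤ c) (ha : ∀ x ∈ a, x ≤ c) :
    dot us a ≤ c * sumN us := by
  induction us generalizing a with
  | nil => simp [dot, sumN]
  | cons u us ih =>
    cases a with
    | nil => simp only [dot]; positivity
    | cons x xs =>
      simp only [dot, sumN]
      have h1 := ih xs (fun y hy => ha y (by simp [hy]))
      have h2 := mul_le_mul_of_nonneg_left (ha x (by simp)) (Nat.cast_nonneg (α := ℝ) u)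
      push_cast
      linarith

lemma pair_le (n : ℕ) (zs : List (ℕ × ℕ)) (a : List ℝ) (h : pairOk n zs = true)
    (ha : ∀ m ∈ [3, 5, 6, 9, 10, 12], m < 2 ^ n → 27501 / 100000 ≤ sel a m) :
    27501 / 100000 * (wSum zs : ℝ) ≤ wsel a zs := by
  induction zs with
  | nil => simp [wSum, wsel]
  | cons z zs ih =>
    simp only [pairOk, Bool.and_eq_true, Nat.ble_eq, List.contains_iff_mem] at h
    have h1 := ih h.2
    have h2 := mul_le_mul_of_nonneg_left (ha z.1 h.1.1 h.1.2) (Nat.cast_nonneg (α := ℝ) z.2)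
    simp only [wSum, wsel]
    push_cast
    linarith

lemma usable_spec (P : Vtx) (ks : List (ℕ × ℕ × ℕ)) (h : usable P ks = true) :
    ∀ k ∈ ks, selN P.1 k.1 < sig P ∧ selN P.2 k.2.1 < sig P ∧ kup P k.1 k.2.1 < 63000000 := by
  induction ks with
  | nil => simp
  | cons k ks ih =>
    simp only [usable, Bool.and_eq_true, Nat.ble_eq] at h
    intro k' hk'
    rcases List.mem_cons.1 hk' with rfl | hk'
    · exact ⟨h.1, h.2.1, h.2.2.1⟩
    · exact ih h.2.2.2 k' hk'

lemma vertsOk_spec (ks : List (ℕ × ℕ × ℕ)) (lo hi : ℕ) (Ps : List Vtx)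
    (h : vertsOk ks lo hi Ps = true) :
    ∀ P ∈ Ps, usable P ks = true ∧ costK P ks + lo + 1 ≤ hi := by
  induction Ps with
  | nil => simp
  | cons P Ps ih =>
    simp only [vertsOk, Bool.and_eq_true, Nat.ble_eq] at h
    intro Q hQ
    rcases List.mem_cons.1 hQ with rfl | hQ
    · exact h.1
    · exact ih h.2 Q hQ

lemma terms_bound {p q : ℕ} {aG aH tG tH : List ℝ} (hb : Bad p q aG aH tG tH) {w : ℕ → ℝ}
    {Ps : List Vtx} (hr : Rep tG tH w Ps) (ks : List (ℕ × ℕ × ℕ))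
    (hu : ∀ k ∈ ks, ∀ P ∈ Ps,
      selN P.1 k.1 < sig P ∧ selN P.2 k.2.1 < sig P ∧ kup P k.1 k.2.1 < 63000000) :
    wsel aG (projG ks) + wsel aH (projH ks) ≤
      ev w (fun P => (sig P : ℝ) * (costK P ks / 100000000)) Ps := by
  induction ks with
  | nil =>
    simp only [projG, projH, wsel, costK]
    have := ev_mono w hr.nn (fun P => (0 : ℝ) * (sig P : ℝ))
      (fun P => (sig P : ℝ) * (((0 : ℕ) : ℝ) / 100000000)) Ps (fun P _ => by simp)
    rw [ev_smul] at this
    linarith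
  | cons k ks ih =>
    have h1 := ih (fun k' hk' => hu k' (by simp [hk']))
    have h2 := term_bound hb hr k.1 k.2.1 (hu k (by simp))
    have h3 := mul_le_mul_of_nonneg_left h2 (Nat.cast_nonneg (α := ℝ) k.2.2)
    have h4 : ev w (fun P => (sig P : ℝ) * (costK P (k :: ks) / 100000000)) Ps =
        (k.2.2 : ℝ) * ev w (fun P => (sig P : ℝ) * (kup P k.1 k.2.1 / 100000000)) Ps +
        ev w (fun P => (sig P : ℝ) * (costK P ks / 100000000)) Ps := by
      rw [← ev_smul, ← ev_add]
      congr 1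
      funext P
      simp only [costK]
      push_cast
      ring
    rw [h4]
    simp only [projG, projH, wsel]
    linarith

lemma leaf_sound {p q : ℕ} {aG aH tG tH : List ℝ} (hb : Bad p q aG aH tG tH) {w : ℕ → ℝ}
    {Ps : List Vtx} (hr : Rep tG tH w Ps) (ks : List (ℕ × ℕ × ℕ)) (ug uh : List ℕ) (cg ch : ℕ)
    (zg zh : List (ℕ × ℕ)) (h : leafOk p q Ps ks ug uh cg ch zg zh = true) : False := by
  simp only [leafOk, Bool.and_eq_true] at h
  obtain ⟨⟨lg, lh⟩, ⟨kg, kh⟩, ⟨pg, ph⟩, hv⟩ := h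
  have lg := Nat.eq_of_beq_eq_true lg
  have lh := Nat.eq_of_beq_eq_true lh
  have hv' := vertsOk_spec _ _ _ _ hv
  have c1 := cov_spec _ _ _ _ aG (by rw [lg, hb.lg]) (fun x hx => (hb.ng x hx).1) kg
  have c2 := cov_spec _ _ _ _ aH (by rw [lh, hb.lh]) (fun x hx => (hb.nh x hx).1) kh
  have d1 := dot_le ug aG (27501 / 100000) (by norm_num) (fun x hx => (hb.ng x hx).2)
  have d2 := dot_le uh aH (27501 / 100000) (by norm_num) (fun x hx => (hb.nh x hx).2)
  have z1 := pair_le _ _ _ pg hb.pg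
  have z2 := pair_le _ _ _ ph hb.ph
  have t := terms_bound hb hr ks
    (fun k hk P hP => usable_spec P ks (hv' P hP).1 k hk)
  have g1 := mul_le_mul_of_nonneg_left hb.cg (Nat.cast_nonneg (α := ℝ) cg)
  have g2 := mul_le_mul_of_nonneg_left hb.ch (Nat.cast_nonneg (α := ℝ) ch)
  have fin : ev w (fun P => (sig P : ℝ) * (costK P ks / 100000000)) Ps ≤
      100000 + 27501 / 100000 * ((wSum zg : ℝ) + wSum zh) -
      27501 / 100000 * ((sumN ug : ℝ) + sumN uh) - 63 / 100 * ((cg : ℝ) + ch) - 1 / 100000000 := by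
    set C := 100000 + 27501 / 100000 * ((wSum zg : ℝ) + wSum zh) -
      27501 / 100000 * ((sumN ug : ℝ) + sumN uh) - 63 / 100 * ((cg : ℝ) + ch) - 1 / 100000000
      with hC
    have := ev_mono w hr.nn (fun P => (sig P : ℝ) * (costK P ks / 100000000))
      (fun P => C * (sig P : ℝ)) Ps (by
        intro P hP
        have h1 := (hv' P hP).2
        have h2 : ((costK P ks + (27501000 * (sumN ug + sumN uh) + 63000000 * (cg + ch)) + 1 : ℕ) : ℝ)
          ≤ ((10000000000000 + 27501000 * (wSum zg + wSum zh) : ℕ) : ℝ) := by exact_mod_cast h1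
        push_cast at h2
        have h3 : (costK P ks : ℝ) / 100000000 ≤ C := by rw [hC]; linarith
        have h4 := mul_le_mul_of_nonneg_left h3 (Nat.cast_nonneg (α := ℝ) (sig P))
        linarith)
    rw [ev_smul, hr.one] at this
    linarith
  have := hb.tot
  linarith

theorem check_sound {p q : ℕ} {aG aH tG tH : List ℝ} (hb : Bad p q aG aH tG tH) (T : Tr) :
    ∀ (Ps : List Vtx) (w : ℕ → ℝ), Rep tG tH w Ps → check p q T Ps = true → False := by
  induction T with
  | L ks ug uh cg ch zg zh =>
    intro Ps w hr h
    exact leaf_sound hb hr ks ug uh cg ch zg zh h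
  | N i j g h l r ihl ihr =>
    intro Ps w hr hc
    simp only [check, Bool.and_eq_true, Nat.ble_eq] at hc
    obtain ⟨⟨⟨hji, hi⟩, eg, eh⟩, cl, cr⟩ := hc
    have eg := eqL_eq _ _ eg
    have eh := eqL_eq _ _ eh
    have s1 : ∀ m, selN g m = selN (getP Ps i).1 m + selN (getP Ps j).1 m := by
      intro m; rw [eg, selN_addL]
    have s2 : ∀ m, selN h m = selN (getP Ps i).2 m + selN (getP Ps j).2 m := by
      intro m; rw [eh, selN_addL]
    have s3 : sig (g, h) = sig (getP Ps i) + sig (getP Ps j) := by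
      simp only [sig, eg, eh, sumN_addL]; ring
    rcases le_total (w j) (w i) with hw | hw
    · exact ihl _ _ (hr.split i j (by omega) (by omega) (by omega) (g, h) s1 s2 s3 hw) cl
    · exact ihr _ _ (hr.split j i (by omega) (by omega) (by omega) (g, h)
        (fun m => by rw [s1]; ring) (fun m => by rw [s2]; ring) (by rw [s3]; ring) hw) cr

end Cert

namespace Cert

def tr22 : Tr :=
  .N 2 0 [1,0] [1,0]
  (.N 3 1 [1,1] [1,1]
  (.N 2 1 [1,1] [2,1]
  (.L [(3,2,100000)] [0,0] [100000,0] 0 0 [] [])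
  (.N 3 1 [1,1] [2,2]
  (.L [(3,2,100000)] [0,0] [100000,0] 0 0 [] [])
  (.N 1 0 [2,1] [2,1]
  (.L [(3,0,8815),(2,1,80071),(1,2,88885),(2,2,11116)] [2302,0] [19930,0] 0 0 [] [])
  (.L [(3,0,41861),(1,2,41861),(2,2,58140)] [16280,0] [100000,0] 0 0 [] []))))
  (.N 2 1 [1,1] [1,0]
  (.N 3 2 [1,1] [2,1]
  (.N 3 1 [2,2] [2,1]
  (.N 3 0 [2,1] [2,1]
  (.L [(2,1,70455),(1,2,89479),(2,2,10522)] [10522,19024] [29546,0] 0 0 [] [])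
  (.L [(2,1,57433),(1,2,57433),(2,2,42568)] [42568,0] [42568,0] 0 0 [] []))
  (.L [(2,1,45978),(1,2,45978),(2,2,54023)] [54023,0] [54023,0] 0 0 [] []))
  (.L [(1,2,56250),(2,2,43750)] [43750,56250] [100000,0] 0 0 [] []))
  (.N 3 1 [2,2] [1,1]
  (.N 3 2 [2,2] [2,1]
  (.N 3 0 [2,1] [2,1]
  (.L [(2,1,95239),(1,2,91810),(2,2,4762),(0,3,3429)] [8191,0] [1334,0] 0 0 [] [])
  (.L [(2,1,62685),(1,2,46756),(2,2,37316),(0,3,15930)] [53245,0] [21387,0] 0 0 [] []))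
  (.L [(2,1,53764),(1,2,44087),(2,2,36560),(0,3,19355)] [55914,9678] [26882,0] 0 0 [] []))
  (.L [(2,3,100000)] [100000,0] [0,0] 0 0 [] []))))
  (.N 3 1 [1,1] [1,1]
  (.N 3 0 [1,0] [1,1]
  (.N 3 1 [1,1] [2,2]
  (.L [(3,2,100000)] [0,0] [100000,0] 0 0 [] [])
  (.N 1 0 [2,1] [2,2]
  (.N 2 1 [2,1] [2,1]
  (.L [(3,0,15930),(2,1,46756),(1,2,62685),(2,2,37316)] [21387,0] [53245,0] 0 0 [] [])
  (.L [(3,0,3429),(2,1,91810),(1,2,95239),(2,2,4762)] [1334,0] [8191,0] 0 0 [] []))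
  (.L [(3,0,19355),(2,1,44087),(1,2,53764),(2,2,36560)] [26882,0] [55914,9678] 0 0 [] [])))
  (.N 1 0 [2,1] [1,1]
  (.N 3 1 [2,1] [2,2]
  (.L [(2,1,45978),(1,2,45978),(2,2,54023)] [54023,0] [54023,0] 0 0 [] [])
  (.N 2 1 [2,1] [2,1]
  (.L [(2,1,57433),(1,2,57433),(2,2,42568)] [42568,0] [42568,0] 0 0 [] [])
  (.L [(2,1,89479),(1,2,70455),(2,2,10522)] [29546,0] [10522,19024] 0 0 [] [])))
  (.L [(2,2,100000)] [100000,0] [100000,0] 0 0 [] [])))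
  (.N 3 0 [2,1] [1,1]
  (.N 3 1 [2,2] [1,1]
  (.N 3 2 [2,1] [2,1]
  (.L [(2,1,88885),(1,2,80071),(2,2,11116),(0,3,8815)] [19930,0] [2302,0] 0 0 [] [])
  (.L [(2,1,41861),(2,2,58140),(0,3,41861)] [100000,0] [16280,0] 0 0 [] []))
  (.L [(2,3,100000)] [100000,0] [0,0] 0 0 [] []))
  (.L [(2,3,100000)] [100000,0] [0,0] 0 0 [] [])))

def ini22 : List Vtx := [([1, 0], [0, 0]), ([1, 1], [0, 0]), ([0, 0], [1, 0]), ([0, 0], [1, 1])]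

theorem ok22 : check 2 2 tr22 ini22 = true := by decide +kernel

def tr23 : Tr :=
  .N 4 0 [1,0] [1,1,1]
  (.N 4 1 [1,1] [1,1,1]
  (.N 2 1 [1,1] [2,1,1]
  (.L [(3,2,50000),(3,4,50000)] [0,0] [50000,0,0] 0 50000 [] [])
  (.L [(3,1,33334),(3,2,33334),(3,4,33334)] [0,0] [0,0,0] 0 66667 [] []))
  (.N 3 1 [1,1] [1,1,0]
  (.N 2 1 [1,1] [2,1,0]
  (.N 4 2 [1,1] [2,1,1]
  (.N 4 2 [2,2] [3,2,2]
  (.L [(1,1,22223),(3,2,50000),(3,4,27778),(2,5,22223)] [0,0] [5556,0,0] 0 50000 [] [])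
  (.L [(3,2,50000),(3,4,50000)] [0,0] [50000,0,0] 0 50000 [] []))
  (.L [(1,2,10145),(3,2,39856),(3,4,50000),(2,6,10145)] [0,0] [60145,0,0] 0 39856 [] []))
  (.N 3 1 [1,1] [2,2,0]
  (.L [(1,1,22223),(3,2,50000),(3,4,27778),(2,5,22223)] [0,0] [5556,0,0] 0 50000 [] [])
  (.N 1 0 [2,1] [2,2,1]
  (.N 4 2 [2,2] [3,2,1]
  (.N 4 3 [2,2] [3,3,1]
  (.N 4 1 [2,2] [2,2,1]
  (.N 4 1 [3,3] [3,3,2]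
  (.L [(3,2,55111),(0,3,16354),(1,5,26574),(2,5,44890),(1,6,18316)] [0,0] [1963,0,0] 0 10221 [] [])
  (.L [(1,1,100000),(2,6,100000)] [0,0] [0,0,0] 0 0 [] []))
  (.L [(1,1,100000),(2,6,100000)] [0,0] [0,0,0] 0 0 [] []))
  (.L [(1,1,100000),(2,6,100000)] [0,0] [0,0,0] 0 0 [] []))
  (.L [(1,1,89066),(1,2,5468),(3,4,5468),(2,6,94533)] [0,0] [10935,0,0] 0 0 [] []))
  (.L [(1,1,22223),(3,2,50000),(3,4,27778),(2,5,22223)] [0,0] [5556,0,0] 0 50000 [] []))))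
  (.N 4 2 [1,1] [2,1,1]
  (.N 2 1 [2,2] [2,1,1]
  (.N 3 0 [2,1] [2,2,1]
  (.N 4 3 [2,2] [2,2,1]
  (.N 4 2 [2,2] [3,2,2]
  (.N 4 3 [3,3] [3,3,2]
  (.L [(3,2,33334),(2,3,33334),(1,5,66667),(2,6,33334)] [0,0] [0,0,0] 0 0 [] [])
  (.L [(1,1,100000),(2,6,100000)] [0,0] [0,0,0] 0 0 [] []))
  (.L [(1,1,100000),(2,6,100000)] [0,0] [0,0,0] 0 0 [] []))
  (.L [(1,1,100000),(2,6,100000)] [0,0] [0,0,0] 0 0 [] []))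
  (.N 1 0 [3,2] [3,2,2]
  (.N 4 2 [2,2] [3,2,2]
  (.L [(3,2,33334),(2,3,33334),(1,5,66667),(2,6,33334)] [0,0] [0,0,0] 0 0 [] [])
  (.L [(1,1,100000),(2,6,100000)] [0,0] [0,0,0] 0 0 [] []))
  (.L [(1,1,42353),(3,1,19216),(3,2,19216),(3,4,19216),(2,6,42353)] [0,0] [0,0,0] 0 38432 [] [])))
  (.N 1 0 [2,1] [1,1,1]
  (.N 3 1 [2,2] [1,1,0]
  (.N 4 1 [3,3] [2,2,1]
  (.N 3 0 [3,2] [2,2,1]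
  (.N 4 3 [2,2] [2,2,1]
  (.N 4 3 [3,3] [3,3,2]
  (.L [(3,0,25000),(2,3,50000),(1,5,25000),(2,5,25000),(1,6,50000)] [0,0] [0,0,0] 0 0 [] [])
  (.L [(1,1,100000),(2,6,100000)] [0,0] [0,0,0] 0 0 [] []))
  (.L [(1,1,100000),(2,6,100000)] [0,0] [0,0,0] 0 0 [] []))
  (.L [(3,0,25000),(2,3,50000),(1,5,50000),(1,6,25000),(2,6,25000)] [0,0] [0,0,0] 0 0 [] []))
  (.L [(1,1,80103),(1,2,3572),(0,3,8164),(2,5,11735),(2,6,88266)] [16327,0] [0,0,0] 0 0 [] []))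
  (.L [(1,3,50000),(2,5,50000),(2,6,50000)] [50000,0] [0,0,0] 0 0 [] []))
  (.N 1 0 [3,1] [2,2,2]
  (.N 4 3 [2,2] [2,2,1]
  (.N 4 1 [3,2] [2,2,2]
  (.N 4 3 [3,3] [3,3,2]
  (.N 4 0 [4,2] [3,3,3]
  (.L [(1,3,66667),(3,4,33334),(2,5,33334),(2,6,33334)] [0,0] [0,0,0] 0 0 [] [])
  (.L [(1,1,76896),(3,2,12245),(3,4,1386),(2,5,10860),(2,6,75511)] [9474,0] [0,0,0] 0 12245 [] []))
  (.N 3 0 [5,3] [4,4,3]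
  (.L [(1,1,100000),(2,6,100000)] [0,0] [0,0,0] 0 0 [] [])
  (.L [(1,1,76896),(3,2,12245),(3,4,1386),(2,5,10860),(2,6,75511)] [9474,0] [0,0,0] 0 12245 [] [])))
  (.N 3 0 [5,3] [4,4,3]
  (.L [(1,1,100000),(2,6,100000)] [0,0] [0,0,0] 0 0 [] [])
  (.L [(1,1,69016),(2,3,10329),(2,5,10329),(2,6,79344)] [30985,0] [0,0,0] 0 10329 [] [])))
  (.N 3 0 [4,2] [3,3,2]
  (.L [(1,1,97649),(0,3,1176),(2,5,1176),(2,6,98825)] [2352,0] [0,0,0] 0 0 [] [])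
  (.N 4 0 [5,3] [4,4,3]
  (.L [(1,1,99618),(0,3,192),(2,5,192),(2,6,99809)] [383,0] [0,0,0] 0 0 [] [])
  (.L [(1,1,69016),(2,3,10329),(2,5,10329),(2,6,79344)] [30985,0] [0,0,0] 0 10329 [] []))))
  (.N 3 0 [2,1] [2,2,1]
  (.N 4 3 [2,2] [2,2,1]
  (.N 4 3 [3,3] [3,3,2]
  (.N 2 1 [5,3] [4,3,3]
  (.L [(3,2,33334),(2,3,33334),(1,5,66667),(2,6,33334)] [0,0] [0,0,0] 0 0 [] [])
  (.L [(1,1,66665),(3,2,22224),(3,4,11112),(2,5,11112),(2,6,55553)] [0,0] [0,0,0] 0 22224 [] []))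
  (.N 3 1 [5,3] [4,4,3]
  (.L [(1,1,100000),(2,6,100000)] [0,0] [0,0,0] 0 0 [] [])
  (.L [(1,1,76225),(3,2,12942),(3,4,2108),(2,5,10834),(2,6,74118)] [8727,0] [0,0,0] 0 12942 [] [])))
  (.N 3 1 [4,2] [3,3,2]
  (.L [(1,1,100000),(2,6,100000)] [0,0] [0,0,0] 0 0 [] [])
  (.N 4 1 [5,3] [4,4,3]
  (.L [(1,1,100000),(2,6,100000)] [0,0] [0,0,0] 0 0 [] [])
  (.L [(1,1,70846),(3,2,6706),(2,3,5248),(2,5,11954),(2,6,76094)] [22449,0] [0,0,0] 0 11954 [] []))))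
  (.N 2 0 [3,2] [3,2,2]
  (.N 2 1 [5,3] [4,3,3]
  (.L [(3,2,33334),(2,3,33334),(1,5,66667),(2,6,33334)] [0,0] [0,0,0] 0 0 [] [])
  (.L [(1,1,66665),(3,2,22224),(3,4,11112),(2,5,11112),(2,6,55553)] [0,0] [0,0,0] 0 22224 [] []))
  (.L [(1,1,42353),(3,1,19216),(3,2,19216),(3,4,19216),(2,6,42353)] [0,0] [0,0,0] 0 38432 [] []))))))
  (.N 4 1 [2,2] [2,1,1]
  (.N 2 0 [1,0] [2,1,1]
  (.L [(1,2,16416),(3,4,16416),(1,6,67170),(2,6,83585)] [0,0] [100000,0,0] 0 0 [] [(6,67169)])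
  (.N 3 0 [2,1] [2,2,1]
  (.N 3 2 [2,1] [3,2,1]
  (.L [(1,1,95439),(1,2,2281),(3,4,2281),(2,6,97720)] [0,0] [4562,0,0] 0 0 [] [])
  (.L [(1,1,71908),(3,2,10595),(3,4,10595),(1,6,6904),(2,6,78811)] [0,0] [24402,0,0] 0 3692 [] []))
  (.N 1 0 [3,2] [3,2,2]
  (.L [(1,1,71908),(3,2,10595),(3,4,10595),(1,6,6904),(2,6,78811)] [0,0] [24402,0,0] 0 3692 [] [])
  (.L [(1,1,64000),(3,1,12000),(3,2,12000),(3,4,12000),(2,6,64000)] [0,0] [0,0,0] 0 24000 [] []))))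
  (.N 2 1 [1,1] [1,0,0]
  (.N 1 0 [2,1] [2,1,1]
  (.L [(1,6,100000),(2,6,100000)] [0,0] [100000,0,0] 0 0 [] [(6,100000)])
  (.N 2 0 [1,0] [2,1,1]
  (.L [(1,2,16416),(3,4,16416),(1,6,67170),(2,6,83585)] [0,0] [100000,0,0] 0 0 [] [(6,67169)])
  (.N 3 0 [2,1] [2,2,1]
  (.N 3 2 [2,1] [3,2,1]
  (.L [(1,1,95439),(1,2,2281),(3,4,2281),(2,6,97720)] [0,0] [4562,0,0] 0 0 [] [])
  (.L [(1,1,71908),(3,2,10595),(3,4,10595),(1,6,6904),(2,6,78811)] [0,0] [24402,0,0] 0 3692 [] []))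
  (.N 4 0 [3,2] [3,2,2]
  (.L [(1,1,71908),(3,2,10595),(3,4,10595),(1,6,6904),(2,6,78811)] [0,0] [24402,0,0] 0 3692 [] [])
  (.L [(1,1,58860),(3,2,20571),(3,4,20571),(2,6,58860)] [0,0] [20571,0,0] 0 20571 [] [])))))
  (.N 1 0 [2,1] [1,1,1]
  (.N 3 1 [2,2] [1,1,0]
  (.L [(1,1,56522),(0,3,21740),(1,5,15653),(2,5,6087),(2,6,93914)] [27827,0] [0,0,0] 0 0 [] [(6,15652)])
  (.L [(1,3,48551),(1,5,19856),(2,5,28696),(2,6,71305),(0,7,2899)] [31595,0] [0,0,0] 0 0 [] [(6,22753)]))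
  (.N 2 0 [2,1] [2,1,1]
  (.L [(1,1,67368),(0,3,16317),(2,5,16317),(1,6,16737),(2,6,83684)] [15896,0] [0,0,0] 0 0 [] [(6,16736)])
  (.N 1 0 [3,1] [2,2,2]
  (.N 3 0 [4,2] [3,3,2]
  (.L [(1,1,97649),(0,3,1176),(2,5,1176),(2,6,98825)] [2352,0] [0,0,0] 0 0 [] [])
  (.L [(1,1,66523),(2,3,11160),(2,5,11160),(2,6,77682)] [33478,0] [0,0,0] 0 11160 [] []))
  (.N 3 0 [2,1] [2,2,1]
  (.N 3 1 [4,2] [3,3,2]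
  (.L [(1,1,100000),(2,6,100000)] [0,0] [0,0,0] 0 0 [] [])
  (.L [(1,1,70846),(3,2,6706),(2,3,5248),(2,5,11954),(2,6,76094)] [22449,0] [0,0,0] 0 11954 [] []))
  (.N 4 0 [3,2] [3,2,2]
  (.L [(1,1,70846),(3,2,6706),(2,3,5248),(2,5,11954),(2,6,76094)] [22449,0] [0,0,0] 0 11954 [] [])
  (.L [(1,1,67925),(3,2,10285),(2,3,10896),(3,4,21181),(2,6,57640)] [611,0] [0,0,0] 0 21181 [] [])))))))))))
  (.N 2 0 [1,0] [1,0,0]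
  (.N 3 1 [1,1] [1,1,0]
  (.N 2 1 [1,1] [2,1,0]
  (.L [(3,2,40910),(3,4,40910),(2,6,18182)] [18182,0] [59091,0,0] 0 40910 [] [])
  (.N 4 1 [2,1] [2,2,1]
  (.L [(3,2,48877),(3,4,48877),(2,6,2248)] [2248,0] [51124,0,0] 0 48877 [] [])
  (.N 3 1 [1,1] [2,2,0]
  (.L [(3,2,50000),(2,5,50000),(1,6,50000)] [0,0] [50000,0,0] 0 0 [] [])
  (.N 4 0 [3,1] [3,2,1]
  (.L [(1,1,88286),(1,2,3320),(3,4,3320),(2,6,96681)] [5076,0] [11715,0,0] 0 0 [] [])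
  (.L [(2,1,54411),(1,2,7599),(3,4,7599),(1,6,70962),(2,6,37992)] [13842,0] [45590,0,0] 0 0 [] [(6,16551)])))))
  (.N 2 1 [1,1] [1,0,0]
  (.N 4 1 [2,1] [2,1,1]
  (.N 4 2 [1,0] [2,1,1]
  (.N 4 0 [2,0] [2,1,1]
  (.N 4 3 [2,1] [2,2,1]
  (.L [(1,1,58860),(3,2,20571),(3,4,20571),(2,6,58860)] [0,0] [20571,0,0] 0 20571 [] [])
  (.N 3 0 [3,1] [3,2,1]
  (.N 3 2 [2,1] [3,2,1]
  (.L [(1,1,91725),(2,6,100000)] [8276,0] [8276,0,0] 0 0 [] [])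
  (.L [(1,1,73034),(3,2,11565),(3,4,11565),(1,6,3838),(2,6,76872)] [0,0] [19240,0,0] 0 7727 [] []))
  (.L [(1,1,56175),(3,2,19666),(3,4,19666),(1,6,4496),(2,6,60670)] [0,0] [28656,0,0] 0 15171 [] [])))
  (.N 4 3 [3,1] [3,2,1]
  (.L [(3,2,33334),(3,4,33334),(1,6,33334),(2,6,33334)] [0,0] [100000,0,0] 0 0 [] [])
  (.L [(2,1,46185),(1,2,16868),(3,4,16868),(1,6,66266),(2,6,36948)] [0,0] [53816,0,0] 0 0 [] [(6,20080)])))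
  (.L [(1,2,16868),(3,4,16868),(1,6,66266),(2,6,83133)] [0,0] [100000,0,0] 0 0 [] [(6,66265)]))
  (.L [(1,6,100000),(2,6,100000)] [0,0] [100000,0,0] 0 0 [] [(6,100000)]))
  (.N 4 1 [2,1] [1,1,1]
  (.N 4 2 [2,1] [2,1,1]
  (.N 4 3 [2,1] [2,2,1]
  (.N 4 0 [2,0] [2,1,1]
  (.N 4 1 [3,1] [2,2,2]
  (.N 1 0 [5,1] [4,3,3]
  (.L [(1,1,67925),(3,2,10285),(2,3,10896),(3,4,21181),(2,6,57640)] [611,0] [0,0,0] 0 21181 [] [])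
  (.L [(1,1,60305),(3,2,19055),(2,3,1587),(3,4,20641),(2,6,58719)] [0,0] [17469,0,0] 0 20641 [] []))
  (.N 1 0 [4,1] [3,2,2]
  (.L [(1,1,80529),(2,3,6491),(2,5,6491),(2,6,87019)] [19472,0] [0,0,0] 0 6491 [] [])
  (.N 4 0 [5,1] [4,3,3]
  (.L [(1,1,60582),(3,2,13815),(2,3,3930),(2,5,17745),(2,6,64512)] [25604,0] [0,0,0] 0 17745 [] [])
  (.L [(1,1,50590),(3,2,20132),(3,4,5011),(2,5,15121),(2,6,59738)] [24269,0] [14159,0,0] 0 20132 [] []))))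
  (.L [(2,3,49820),(2,5,49820),(1,6,49820),(2,6,362)] [50181,0] [362,0,0] 0 0 [] []))
  (.N 4 0 [3,1] [3,2,1]
  (.L [(1,1,91725),(2,6,100000)] [8276,0] [8276,0,0] 0 0 [] [])
  (.N 1 0 [3,1] [2,1,1]
  (.L [(1,1,79472),(0,3,2789),(2,5,2789),(2,6,97212)] [20529,0] [14952,0,0] 0 0 [] [])
  (.L [(2,1,61086),(0,3,774),(2,5,774),(1,6,71636),(2,6,38142)] [28365,0] [37368,0,0] 0 0 [] [(6,10550)]))))
  (.N 1 0 [3,1] [2,1,1]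
  (.L [(1,1,67368),(0,3,16317),(2,5,16317),(1,6,16737),(2,6,83684)] [15896,0] [0,0,0] 0 0 [] [(6,16736)])
  (.L [(2,1,54598),(0,3,6897),(2,5,6897),(1,6,73276),(2,6,38506)] [26725,0] [31610,0,0] 0 0 [] [(6,18678)])))
  (.N 4 3 [3,2] [2,2,1]
  (.L [(2,3,47288),(2,5,47288),(1,6,47288),(2,6,5425),(0,7,5425)] [52713,0] [0,0,0] 0 0 [] [(6,5424)])
  (.L [(1,2,25000),(0,3,37500),(2,5,62500),(1,6,43750),(2,6,37500)] [31250,0] [0,0,0] 0 0 [] [(6,43750)])))))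
  (.N 3 1 [1,1] [1,1,0]
  (.N 3 0 [1,0] [1,1,0]
  (.N 4 1 [2,1] [2,2,1]
  (.L [(3,2,48877),(3,4,48877),(2,6,2248)] [2248,0] [51124,0,0] 0 48877 [] [])
  (.N 3 1 [1,1] [2,2,0]
  (.L [(3,2,50000),(2,5,50000),(1,6,50000)] [0,0] [50000,0,0] 0 0 [] [])
  (.N 4 1 [3,2] [3,3,1]
  (.L [(3,2,50000),(2,5,50000),(1,6,50000)] [0,0] [50000,0,0] 0 0 [] [])
  (.N 4 0 [4,2] [4,4,1]
  (.N 4 2 [4,2] [4,3,1]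
  (.L [(1,1,93744),(1,2,3129),(3,4,3129),(2,6,96872)] [0,0] [6257,0,0] 0 0 [] [])
  (.N 2 0 [5,2] [5,4,1]
  (.L [(1,2,60714),(2,5,60714),(1,6,35717),(2,6,39287)] [3570,0] [39287,0,0] 0 0 [] [(6,35716)])
  (.L [(1,2,100000),(2,5,100000)] [0,0] [0,0,0] 0 0 [] [])))
  (.N 3 0 [2,1] [3,3,0]
  (.N 4 2 [5,2] [5,4,1]
  (.L [(1,2,93040),(3,4,6961),(2,5,86079),(2,6,6961)] [0,0] [13922,0,0] 0 0 [] [])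
  (.L [(1,2,60991),(3,4,5314),(2,5,55677),(1,6,33696),(2,6,39010)] [0,0] [44324,0,0] 0 0 [] [(6,33695)]))
  (.N 4 0 [5,2] [5,5,1]
  (.N 4 2 [5,2] [5,4,1]
  (.L [(1,1,46739),(1,2,48586),(3,4,4677),(2,5,43909),(2,6,51415)] [0,0] [9353,0,0] 0 0 [] [])
  (.N 3 2 [3,1] [4,3,0]
  (.L [(1,1,7008),(1,2,88317),(3,4,4677),(2,5,83641),(2,6,11684)] [0,0] [9353,0,0] 0 0 [] [])
  (.L [(1,2,63532),(2,5,63532),(1,6,578),(2,6,36469)] [35892,0] [36469,0,0] 0 0 [] [(6,577)])))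
  (.N 1 0 [2,1] [2,2,0]
  (.N 3 2 [3,1] [4,3,0]
  (.L [(1,1,7008),(1,2,88317),(3,4,4677),(2,5,83641),(2,6,11684)] [0,0] [9353,0,0] 0 0 [] [])
  (.L [(1,2,63532),(2,5,63532),(1,6,578),(2,6,36469)] [35892,0] [36469,0,0] 0 0 [] [(6,577)]))
  (.N 4 0 [6,2] [6,6,1]
  (.N 3 2 [3,1] [4,3,0]
  (.L [(1,2,99620),(3,4,381),(2,5,99239),(2,6,381)] [0,0] [762,0,0] 0 0 [] [])
  (.L [(1,2,63491),(2,5,63491),(2,6,36510)] [36510,0] [36510,0,0] 0 0 [] []))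
  (.N 4 0 [7,2] [7,7,1]
  (.L [(1,2,63417),(3,4,4286),(2,5,59132),(2,6,36584)] [32299,0] [40869,0,0] 0 0 [] [])
  (.L [(1,2,54030),(3,4,7378),(2,5,46652),(2,6,45971)] [38593,0] [53349,0,0] 0 0 [] []))))))))))
  (.N 4 0 [2,0] [1,1,1]
  (.N 4 1 [2,1] [2,2,1]
  (.L [(3,2,48877),(3,4,25731),(2,5,23147),(2,6,2248)] [25394,0] [27978,0,0] 0 48877 [] [])
  (.N 4 1 [3,2] [3,3,1]
  (.N 1 0 [5,2] [4,4,2]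
  (.L [(3,2,50000),(2,5,50000),(1,6,50000)] [0,0] [50000,0,0] 0 0 [] [])
  (.L [(3,2,49169),(2,5,49169),(2,6,1663)] [50832,0] [1663,0,0] 0 49169 [] []))
  (.N 1 0 [3,1] [2,2,1]
  (.N 4 3 [4,2] [4,4,1]
  (.N 4 2 [4,2] [4,3,1]
  (.L [(1,1,89273),(0,3,5364),(2,5,5364),(2,6,94637)] [10728,0] [0,0,0] 0 0 [] [])
  (.N 3 2 [5,2] [5,4,1]
  (.L [(1,2,92756),(0,3,3623),(2,5,96378),(2,6,3623)] [7245,0] [0,0,0] 0 0 [] [])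
  (.N 2 1 [2,1] [2,1,0]
  (.L [(1,2,53744),(0,3,9307),(2,5,63050),(2,6,36951)] [46257,0] [27644,0,0] 0 0 [] [])
  (.L [(1,2,92756),(0,3,3623),(2,5,96378),(2,6,3623)] [7245,0] [0,0,0] 0 0 [] []))))
  (.N 4 3 [5,2] [5,5,1]
  (.N 4 2 [5,2] [5,4,1]
  (.L [(1,1,47527),(1,2,47647),(0,3,2414),(2,5,50060),(2,6,49941)] [4828,0] [0,0,0] 0 0 [] [])
  (.N 2 0 [4,1] [3,2,1]
  (.L [(1,2,63532),(2,5,63532),(1,6,578),(2,6,36469)] [35892,0] [36469,0,0] 0 0 [] [(6,577)])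
  (.L [(1,2,81601),(0,3,2070),(2,5,83670),(2,6,16331)] [18400,0] [14261,0,0] 0 0 [] [])))
  (.N 3 0 [4,1] [3,3,1]
  (.N 3 1 [2,1] [2,2,0]
  (.N 4 3 [6,2] [6,6,1]
  (.N 2 0 [5,1] [4,3,1]
  (.L [(1,2,63491),(2,5,63491),(2,6,36510)] [36510,0] [36510,0,0] 0 0 [] [])
  (.N 1 0 [6,2] [5,5,1]
  (.L [(1,2,80186),(2,5,80186),(2,6,19815)] [19815,0] [19815,0,0] 0 0 [] [])
  (.N 3 0 [10,3] [9,9,2]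
  (.L [(1,2,81555),(2,5,81555),(2,6,18446)] [18446,0] [18446,0,0] 0 0 [] [])
  (.N 4 0 [9,3] [8,8,2]
  (.L [(1,2,81555),(2,5,81555),(2,6,18446)] [18446,0] [18446,0,0] 0 0 [] [])
  (.N 2 0 [9,2] [7,6,2]
  (.L [(1,2,79274),(2,5,79274),(2,6,20727)] [20727,0] [20727,0,0] 0 0 [] [])
  (.N 2 1 [15,4] [12,11,3]
  (.L [(3,2,50000),(2,5,50000),(1,6,50000)] [0,0] [50000,0,0] 0 0 [] [])
  (.N 3 0 [14,4] [12,12,3]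
  (.L [(1,2,90121),(2,5,90121),(2,6,9880)] [9880,0] [9880,0,0] 0 0 [] [])
  (.N 4 0 [13,4] [11,11,3]
  (.L [(1,2,90121),(2,5,90121),(2,6,9880)] [9880,0] [9880,0,0] 0 0 [] [])
  (.N 1 0 [10,3] [8,8,2]
  (.L [(1,2,90121),(2,5,90121),(2,6,9880)] [9880,0] [9880,0,0] 0 0 [] [])
  (.N 3 0 [18,5] [15,15,4]
  (.L [(1,2,92916),(2,5,92916),(2,6,7085)] [7085,0] [7085,0,0] 0 0 [] [])
  (.N 4 0 [17,5] [14,14,4]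
  (.L [(1,2,92916),(2,5,92916),(2,6,7085)] [7085,0] [7085,0,0] 0 0 [] [])
  (.N 3 0 [22,6] [18,18,5]
  (.L [(1,2,95121),(2,5,95121),(2,6,4880)] [4880,0] [4880,0,0] 0 0 [] [])
  (.L [(2,3,50000),(2,5,50000),(1,6,50000)] [50000,0] [0,0,0] 0 0 [] [])))))))))))))
  (.N 2 0 [5,1] [4,3,1]
  (.N 4 3 [7,2] [7,7,1]
  (.L [(1,2,63260),(2,5,63260),(2,6,36741)] [36741,0] [36741,0,0] 0 0 [] [])
  (.L [(1,2,53077),(2,5,53077),(2,6,46924)] [46924,0] [46924,0,0] 0 0 [] []))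
  (.N 3 0 [5,1] [4,4,1]
  (.N 4 3 [7,2] [7,7,1]
  (.L [(1,1,59391),(2,6,100000)] [40610,0] [40610,0,0] 0 0 [] [])
  (.L [(1,1,53077),(2,6,100000)] [46924,0] [46924,0,0] 0 0 [] []))
  (.N 1 0 [6,2] [5,5,1]
  (.L [(1,1,59391),(2,6,100000)] [40610,0] [40610,0,0] 0 0 [] [])
  (.N 4 0 [10,3] [9,9,2]
  (.L [(1,1,59391),(2,6,100000)] [40610,0] [40610,0,0] 0 0 [] [])
  (.N 2 0 [9,2] [7,6,2]
  (.L [(1,1,59009),(2,6,100000)] [40992,0] [40992,0,0] 0 0 [] [])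
  (.N 2 1 [15,4] [12,11,3]
  (.L [(3,2,50000),(2,5,50000),(1,6,50000)] [0,0] [50000,0,0] 0 0 [] [])
  (.N 4 0 [14,4] [12,12,3]
  (.L [(1,1,59408),(2,6,100000)] [40593,0] [40593,0,0] 0 0 [] [])
  (.N 1 0 [10,3] [8,8,2]
  (.L [(1,1,59408),(2,6,100000)] [40593,0] [40593,0,0] 0 0 [] [])
  (.N 4 0 [18,5] [15,15,4]
  (.L [(1,1,59880),(2,6,100000)] [40121,0] [40121,0,0] 0 0 [] [])
  (.N 3 0 [9,2] [7,7,2]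
  (.L [(1,1,58411),(2,6,100000)] [41590,0] [41590,0,0] 0 0 [] [])
  (.N 4 0 [22,6] [18,18,5]
  (.L [(1,1,58960),(2,6,100000)] [41041,0] [41041,0,0] 0 0 [] [])
  (.L [(2,3,50000),(2,5,50000),(1,6,50000)] [50000,0] [0,0,0] 0 0 [] [])))))))))))))
  (.N 2 0 [5,1] [4,3,1]
  (.L [(1,2,63532),(2,5,63532),(1,6,578),(2,6,36469)] [35892,0] [36469,0,0] 0 0 [] [(6,577)])
  (.N 1 0 [5,2] [4,4,1]
  (.L [(1,2,78124),(2,5,78124),(2,6,21877)] [21877,0] [21877,0,0] 0 0 [] [])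
  (.N 3 0 [6,2] [5,5,1]
  (.L [(1,2,78124),(2,5,78124),(2,6,21877)] [21877,0] [21877,0,0] 0 0 [] [])
  (.N 4 0 [9,3] [8,8,2]
  (.L [(1,2,79780),(2,5,79780),(2,6,20221)] [20221,0] [20221,0,0] 0 0 [] [])
  (.N 2 0 [9,2] [7,6,2]
  (.L [(1,2,77026),(2,5,77026),(2,6,22975)] [22975,0] [22975,0,0] 0 0 [] [])
  (.N 1 0 [9,3] [7,7,2]
  (.L [(1,2,77026),(2,5,77026),(2,6,22975)] [22975,0] [22975,0,0] 0 0 [] [])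
  (.N 4 0 [13,4] [11,11,3]
  (.L [(1,2,78813),(2,5,78813),(2,6,21188)] [21188,0] [21188,0,0] 0 0 [] [])
  (.N 3 0 [10,3] [8,8,2]
  (.L [(1,2,78813),(2,5,78813),(2,6,21188)] [21188,0] [21188,0,0] 0 0 [] [])
  (.N 4 0 [17,5] [14,14,4]
  (.L [(1,2,80215),(2,5,80215),(2,6,19786)] [19786,0] [19786,0,0] 0 0 [] [])
  (.L [(2,3,50000),(2,5,50000),(1,6,50000)] [50000,0] [0,0,0] 0 0 [] [])))))))))))
  (.N 2 0 [4,1] [3,2,1]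
  (.N 3 2 [5,1] [4,3,1]
  (.N 3 1 [5,2] [4,4,1]
  (.N 3 0 [8,2] [6,5,2]
  (.N 4 0 [13,4] [11,10,3]
  (.N 4 3 [9,3] [8,8,2]
  (.L [(1,2,79780),(2,5,79780),(2,6,20221)] [20221,0] [20221,0,0] 0 0 [] [])
  (.N 3 2 [9,2] [7,6,2]
  (.N 4 2 [18,5] [15,14,4]
  (.N 3 1 [9,3] [7,7,2]
  (.N 4 3 [13,4] [11,11,3]
  (.L [(1,2,85507),(2,5,85507),(2,6,14494)] [14494,0] [14494,0,0] 0 0 [] [])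
  (.N 4 3 [17,5] [14,14,4]
  (.L [(1,2,90938),(2,5,90938),(2,6,9063)] [9063,0] [9063,0,0] 0 0 [] [])
  (.L [(2,3,50000),(2,5,50000),(1,6,50000)] [50000,0] [0,0,0] 0 0 [] [])))
  (.L [(1,2,80047),(2,5,80047),(2,6,19954)] [19954,0] [19954,0,0] 0 0 [] []))
  (.L [(2,3,50000),(2,5,50000),(1,6,50000)] [50000,0] [0,0,0] 0 0 [] []))
  (.L [(1,2,77026),(2,5,77026),(2,6,22975)] [22975,0] [22975,0,0] 0 0 [] [])))
  (.L [(2,3,50000),(2,5,50000),(1,6,50000)] [50000,0] [0,0,0] 0 0 [] []))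
  (.L [(1,2,76905),(2,5,76905),(2,6,23096)] [23096,0] [23096,0,0] 0 0 [] []))
  (.L [(1,2,78124),(2,5,78124),(2,6,21877)] [21877,0] [21877,0,0] 0 0 [] []))
  (.L [(1,2,63532),(2,5,63532),(1,6,578),(2,6,36469)] [35892,0] [36469,0,0] 0 0 [] [(6,577)]))
  (.N 3 1 [5,2] [4,4,1]
  (.N 3 2 [8,2] [6,5,2]
  (.N 4 2 [13,4] [11,10,3]
  (.N 4 3 [9,3] [8,8,2]
  (.L [(1,2,100000),(2,5,100000)] [0,0] [0,0,0] 0 0 [] [])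
  (.N 4 0 [12,4] [10,10,3]
  (.N 3 1 [9,3] [7,7,2]
  (.N 4 3 [13,4] [11,11,3]
  (.L [(1,1,16963),(1,2,83038),(2,5,83038),(2,6,16963)] [0,0] [0,0,0] 0 0 [] [])
  (.N 4 3 [17,5] [14,14,4]
  (.L [(1,1,90001),(1,2,10000),(2,5,10000),(2,6,90001)] [0,0] [0,0,0] 0 0 [] [])
  (.L [(2,3,50000),(2,5,50000),(1,6,50000)] [50000,0] [0,0,0] 0 0 [] [])))
  (.L [(1,2,100000),(2,5,100000)] [0,0] [0,0,0] 0 0 [] []))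
  (.L [(2,3,50000),(2,5,50000),(1,6,50000)] [50000,0] [0,0,0] 0 0 [] [])))
  (.L [(2,3,50000),(2,5,50000),(1,6,50000)] [50000,0] [0,0,0] 0 0 [] []))
  (.L [(1,2,80057),(0,3,2031),(2,5,82088),(2,6,17913)] [19944,0] [15883,0,0] 0 0 [] []))
  (.L [(1,2,81601),(0,3,2070),(2,5,83670),(2,6,16331)] [18400,0] [14261,0,0] 0 0 [] []))))))
  (.N 1 0 [5,1] [3,3,2]
  (.N 3 1 [4,1] [3,3,1]
  (.N 4 2 [4,2] [4,3,1]
  (.L [(1,1,48913),(3,2,26768),(3,4,2447),(2,5,24321),(2,6,46466)] [21875,0] [0,0,0] 0 26768 [] [])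
  (.L [(1,2,35819),(3,2,21396),(2,5,57214),(2,6,21391)] [42787,0] [21391,0,0] 0 21396 [] []))
  (.N 4 2 [4,2] [4,3,1]
  (.N 4 3 [7,3] [6,6,2]
  (.L [(1,1,76383),(0,3,11809),(2,5,11809),(2,6,88192)] [23618,0] [0,0,0] 0 0 [] [])
  (.N 2 1 [7,3] [6,5,2]
  (.L [(1,1,60887),(3,2,14631),(0,3,4927),(2,5,19557),(2,6,65813)] [24483,0] [0,0,0] 0 14631 [] [])
  (.L [(1,1,68549),(2,3,10484),(2,5,10484),(2,6,79033)] [31452,0] [0,0,0] 0 10484 [] [])))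
  (.N 4 1 [7,3] [6,5,2]
  (.L [(1,2,38937),(3,2,17237),(0,3,2273),(2,5,58446),(2,6,24318)] [43827,0] [22046,0,0] 0 17237 [] [])
  (.L [(1,2,50848),(2,3,8793),(2,5,59640),(2,6,31568)] [49153,0] [22776,0,0] 0 8793 [] []))))
  (.N 4 2 [4,2] [4,3,1]
  (.L [(1,1,49359),(3,2,25321),(2,5,25321),(2,6,49359)] [25321,0] [0,0,0] 0 25321 [] [])
  (.L [(1,2,35819),(3,2,21396),(2,5,57214),(2,6,21391)] [42787,0] [21391,0,0] 0 21396 [] []))))))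
  (.N 1 0 [2,1] [1,1,0]
  (.N 2 1 [2,1] [2,1,0]
  (.L [(2,2,25000),(2,5,25000),(2,6,50000)] [100000,0] [50000,0,0] 0 25000 [] [])
  (.N 4 1 [3,1] [2,2,1]
  (.N 3 1 [4,1] [3,3,1]
  (.N 4 3 [3,0] [2,2,1]
  (.N 2 1 [6,2] [5,4,1]
  (.L [(0,3,20000),(2,5,32593),(2,6,67408)] [100000,0] [47408,12593,0] 0 0 [] [])
  (.L [(2,3,28437),(2,5,28437),(2,6,43128)] [100000,0] [14692,0,0] 0 28437 [] []))
  (.N 1 0 [6,2] [4,4,1]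
  (.N 2 1 [6,2] [5,4,1]
  (.L [(2,6,100000)] [100000,0] [100000,0,0] 0 0 [] [])
  (.N 3 0 [7,2] [5,5,1]
  (.N 4 3 [4,0] [3,3,1]
  (.L [(2,3,28437),(2,5,28437),(2,6,43128)] [100000,0] [14692,0,0] 0 28437 [] [])
  (.N 3 1 [5,1] [4,4,1]
  (.L [(2,6,100000)] [100000,0] [100000,0,0] 0 0 [] [])
  (.N 3 1 [9,2] [7,7,2]
  (.L [(2,6,100000)] [100000,0] [100000,0,0] 0 0 [] [])
  (.L [(2,3,31305),(2,5,31305),(2,6,37392)] [100000,0] [6087,0,0] 0 31305 [] []))))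
  (.L [(2,3,28437),(2,5,28437),(2,6,43128)] [100000,0] [14692,0,0] 0 28437 [] [])))
  (.L [(2,5,45988),(2,6,54013)] [100000,0] [54013,45988,0] 0 0 [] [])))
  (.N 3 2 [6,2] [5,4,1]
  (.L [(2,3,28437),(2,5,28437),(2,6,43128)] [100000,0] [14692,0,0] 0 28437 [] [])
  (.L [(0,3,39359),(2,5,39359),(2,6,60642)] [100000,0] [21283,0,0] 0 0 [] [])))
  (.N 3 1 [2,1] [2,2,0]
  (.N 4 3 [4,1] [3,3,1]
  (.N 3 0 [6,2] [4,4,1]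
  (.N 3 2 [6,2] [5,4,1]
  (.N 4 1 [5,2] [4,4,1]
  (.L [(2,3,50000),(2,5,50000),(1,6,50000)] [50000,0] [0,0,0] 0 0 [] [])
  (.N 3 1 [6,2] [5,5,1]
  (.N 3 1 [10,3] [8,8,2]
  (.L [(2,3,50000),(2,5,50000),(1,6,50000)] [50000,0] [0,0,0] 0 0 [] [])
  (.L [(1,1,72728),(1,2,19189),(2,5,19189),(2,6,80812)] [8085,0] [8085,0,0] 0 0 [] []))
  (.L [(1,1,74551),(2,6,100000)] [25450,0] [25450,0,0] 0 0 [] [])))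
  (.L [(1,1,46973),(1,2,41705),(2,5,41705),(2,6,58296)] [11323,0] [11323,0,0] 0 0 [] []))
  (.L [(1,2,80770),(2,5,80770),(2,6,19231)] [19231,0] [19231,0,0] 0 0 [] []))
  (.N 4 0 [6,2] [4,4,1]
  (.N 4 3 [5,1] [4,4,1]
  (.N 4 2 [6,2] [5,4,1]
  (.N 4 1 [6,2] [5,5,1]
  (.N 4 2 [10,3] [8,7,2]
  (.N 4 0 [10,3] [7,7,2]
  (.N 4 1 [10,3] [8,8,2]
  (.N 4 3 [9,2] [7,7,2]
  (.L [(2,3,50000),(2,5,50000),(1,6,50000)] [50000,0] [0,0,0] 0 0 [] [])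
  (.L [(1,1,40603),(2,6,100000)] [59398,0] [59398,0,0] 0 0 [] []))
  (.L [(1,1,48760),(2,6,100000)] [51241,0] [51241,0,0] 0 0 [] []))
  (.L [(1,1,42529),(2,6,100000)] [57472,0] [57472,0,0] 0 0 [] []))
  (.L [(1,1,42529),(2,6,100000)] [57472,0] [57472,0,0] 0 0 [] []))
  (.L [(1,1,42529),(2,6,100000)] [57472,0] [57472,0,0] 0 0 [] []))
  (.L [(1,1,30649),(2,6,100000)] [69352,0] [69352,0,0] 0 0 [] []))
  (.L [(1,1,30649),(2,6,100000)] [69352,0] [69352,0,0] 0 0 [] []))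
  (.L [(1,2,45554),(2,5,45554),(2,6,54447)] [54447,0] [54447,0,0] 0 0 [] [])))
  (.L [(1,2,80770),(2,5,80770),(2,6,19231)] [19231,0] [19231,0,0] 0 0 [] []))))
  (.L [(2,1,25000),(2,6,75000)] [100000,0] [50000,0,0] 0 25000 [] []))))
  (.N 4 3 [2,1] [2,2,1]
  (.N 4 0 [2,0] [1,1,1]
  (.N 3 1 [3,2] [2,2,1]
  (.N 4 1 [4,2] [3,3,2]
  (.N 2 1 [5,2] [4,3,2]
  (.N 3 2 [3,1] [3,2,1]
  (.L [(1,1,30508),(3,2,29491),(2,3,3504),(2,5,32995),(2,6,34012)] [40003,0] [0,0,0] 0 32995 [] [])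
  (.L [(3,2,28564),(2,3,14292),(2,5,42855),(2,6,14292)] [71437,0] [0,0,0] 0 42855 [] []))
  (.L [(1,1,47408),(3,2,27365),(3,4,2137),(2,5,25228),(2,6,45272)] [23092,0] [0,0,0] 0 27365 [] []))
  (.N 3 2 [3,1] [3,2,1]
  (.N 3 0 [4,1] [3,3,2]
  (.L [(1,1,81061),(2,3,6342),(3,4,85),(2,5,6257),(2,6,87318)] [18855,0] [0,0,0] 0 6342 [] [])
  (.L [(1,1,59866),(2,3,11654),(2,5,11654),(2,6,76694)] [40135,0] [5175,0,0] 0 11654 [] []))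
  (.N 4 2 [5,2] [4,3,2]
  (.L [(1,1,57830),(2,3,11558),(2,5,11558),(2,6,76886)] [42171,0] [7499,0,0] 0 11558 [] [])
  (.L [(1,2,48176),(2,3,11792),(2,5,59967),(2,6,28243)] [51825,0] [16452,0,0] 0 11792 [] []))))
  (.N 4 1 [2,1] [1,1,1]
  (.N 4 1 [3,1] [2,2,2]
  (.N 4 3 [4,2] [3,3,2]
  (.N 3 2 [5,2] [4,3,2]
  (.L [(1,1,47408),(3,2,27365),(3,4,2137),(2,5,25228),(2,6,45272)] [23092,0] [0,0,0] 0 27365 [] [])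
  (.L [(3,2,28564),(2,3,14292),(2,5,42855),(2,6,14292)] [71437,0] [0,0,0] 0 42855 [] []))
  (.L [(1,2,35681),(2,3,21440),(2,5,57121),(2,6,21440)] [64320,0] [0,0,0] 0 21440 [] []))
  (.L [(1,2,33334),(2,3,22223),(2,5,55556),(2,6,22223)] [66667,0] [0,0,0] 0 22223 [] []))
  (.L [(1,2,21740),(0,3,39131),(2,5,60870),(2,6,39131)] [78261,0] [0,0,0] 0 0 [] [])))
  (.N 3 0 [3,1] [2,2,1]
  (.N 3 1 [3,2] [2,2,1]
  (.N 3 2 [3,1] [3,2,1]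
  (.N 4 3 [4,1] [3,3,2]
  (.L [(1,1,59866),(2,3,11654),(2,5,11654),(2,6,76694)] [40135,0] [5175,0,0] 0 11654 [] [])
  (.L [(1,1,81061),(2,3,6342),(3,4,85),(2,5,6257),(2,6,87318)] [18855,0] [0,0,0] 0 6342 [] []))
  (.L [(1,2,48176),(2,3,11792),(2,5,59967),(2,6,28243)] [51825,0] [16452,0,0] 0 11792 [] []))
  (.L [(1,2,21740),(0,3,39131),(2,5,60870),(2,6,39131)] [78261,0] [0,0,0] 0 0 [] []))
  (.L [(0,3,34783),(2,3,10145),(2,5,44928),(2,6,44928)] [100000,0] [0,0,0] 0 10145 [] [])))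
  (.N 3 0 [2,1] [1,1,0]
  (.N 4 1 [3,2] [2,2,1]
  (.N 4 2 [3,1] [3,2,1]
  (.L [(1,1,89496),(0,3,2217),(2,5,2217),(2,6,97784)] [10505,0] [6073,0,0] 0 0 [] [])
  (.N 2 1 [4,2] [3,2,1]
  (.L [(2,1,60961),(0,3,935),(2,5,935),(1,6,71474),(2,6,38106)] [28527,0] [37171,0,0] 0 0 [] [(6,10513)])
  (.L [(1,1,75000),(0,3,1186),(2,5,1186),(2,6,98815)] [25000,0] [22630,0,0] 0 0 [] [])))
  (.L [(1,2,25000),(0,3,37500),(2,5,62500),(1,6,43750),(2,6,37500)] [31250,0] [0,0,0] 0 0 [] [(6,43750)]))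
  (.N 4 0 [3,1] [2,2,1]
  (.L [(1,2,23927),(2,3,38037),(2,5,61964),(1,6,38037)] [38037,0] [0,0,0] 0 0 [] [])
  (.L [(2,3,33334),(2,5,33334),(2,6,33334),(0,7,33334)] [100000,0] [0,0,0] 0 0 [] []))))))

def ini23 : List Vtx := [([1, 0], [0, 0, 0]), ([1, 1], [0, 0, 0]), ([0, 0], [1, 0, 0]), ([0, 0], [1, 1, 0]), ([0, 0], [1, 1, 1])]

theorem ok23 : check 2 3 tr23 ini23 = true := by decide +kernel

def tr24 : Tr :=
  .N 3 1 [1,1] [1,1,0,0]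
  (.N 5 0 [1,0] [1,1,1,1]
  (.L [(3,4,8000),(3,8,8000),(3,12,84000)] [0,0] [0,0,0,0] 0 100000 [] [(12,92000)])
  (.N 5 0 [2,0] [1,1,1,1]
  (.L [(3,12,100000)] [0,0] [0,0,0,0] 0 100000 [] [(12,100000)])
  (.N 2 0 [1,0] [1,0,0,0]
  (.L [(3,12,100000)] [0,0] [0,0,0,0] 0 100000 [] [(12,100000)])
  (.N 4 0 [1,0] [1,1,1,0]
  (.L [(3,12,100000)] [0,0] [0,0,0,0] 0 100000 [] [(12,100000)])
  (.N 5 0 [3,0] [1,1,1,1]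
  (.L [(3,4,25424),(3,8,25424),(2,13,24577),(2,14,24577)] [49153,0] [0,0,0,0] 0 75424 [] [(12,50000)])
  (.L [(2,12,78948),(2,13,10527),(2,14,10527)] [100000,0] [0,0,0,0] 0 89474 [] [(12,89473)]))))))
  (.N 4 1 [1,1] [1,1,1,0]
  (.N 5 0 [1,0] [1,1,1,1]
  (.L [(3,12,100000)] [0,0] [0,0,0,0] 0 100000 [] [(12,100000)])
  (.N 5 0 [2,0] [1,1,1,1]
  (.L [(3,12,100000)] [0,0] [0,0,0,0] 0 100000 [] [(12,100000)])
  (.N 2 0 [1,0] [1,0,0,0]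
  (.L [(3,12,100000)] [0,0] [0,0,0,0] 0 100000 [] [(12,100000)])
  (.N 4 0 [1,0] [1,1,1,0]
  (.L [(3,12,100000)] [0,0] [0,0,0,0] 0 100000 [] [(12,100000)])
  (.N 1 0 [2,1] [1,1,1,0]
  (.N 5 0 [4,1] [2,2,2,1]
  (.L [(3,12,78432),(2,13,10785),(2,14,10785)] [21569,0] [0,0,0,0] 0 89216 [] [(12,89215)])
  (.L [(1,10,100000),(2,13,50000),(2,14,50000)] [0,0] [0,0,0,0] 0 50000 [] [(10,100000),(12,50000)]))
  (.N 5 0 [3,0] [1,1,1,1]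
  (.L [(2,5,21539),(3,8,23077),(2,13,16154),(2,14,39231)] [76924,0] [0,0,0,0] 0 62308 [] [(10,1538),(12,39230)])
  (.L [(2,9,17392),(2,12,47827),(2,14,34783)] [100000,0] [0,0,0,0] 0 82609 [] [(10,17391),(12,65217)])))))))
  (.N 5 3 [1,1] [2,2,1,1]
  (.N 2 1 [1,1] [1,0,0,0]
  (.N 5 0 [1,0] [1,1,1,1]
  (.N 5 1 [1,1] [2,1,1,1]
  (.L [(3,10,85938),(3,12,14063)] [0,0] [0,0,0,0] 0 100000 [] [(10,85937),(12,14062)])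
  (.N 1 0 [2,1] [2,1,1,1]
  (.L [(1,12,42425),(2,12,95623),(1,14,57576),(2,14,4378)] [0,0] [0,0,0,0] 0 100000 [] [(6,30976),(10,30976),(12,169023)])
  (.L [(3,10,100000)] [0,0] [0,0,0,0] 0 100000 [] [(10,100000)])))
  (.N 5 2 [1,0] [2,1,1,1]
  (.N 5 0 [2,0] [1,1,1,1]
  (.N 2 1 [2,1] [3,1,1,1]
  (.L [(3,1,18519),(3,4,18519),(3,10,62963)] [0,0] [0,0,0,0] 0 81482 [] [(10,44444)])
  (.N 5 1 [2,1] [2,1,1,1]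
  (.L [(3,1,18519),(3,4,18519),(3,10,62963)] [0,0] [0,0,0,0] 0 81482 [] [(10,44444)])
  (.N 1 0 [3,1] [2,1,1,1]
  (.L [(2,5,13477),(2,9,28842),(1,12,100000),(2,14,57683)] [0,0] [0,0,0,0] 0 57683 [] [(10,15364),(12,128841)])
  (.N 2 0 [4,1] [4,2,2,2]
  (.L [(2,9,2598),(1,12,100000),(2,12,34864),(2,14,62540)] [0,0] [0,0,0,0] 0 97403 [] [(6,28672),(10,31269),(12,166132)])
  (.L [(3,2,27545),(2,3,9663),(3,4,6794),(1,5,30414),(1,9,21283),(2,9,15925),(2,14,40076)] [13967,0] [0,0,0,0] 0 22719 [] [])))))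
  (.N 4 0 [2,1] [1,1,1,0]
  (.N 5 1 [3,1] [2,1,1,1]
  (.N 5 2 [3,0] [3,2,2,2]
  (.N 2 0 [5,1] [4,3,3,2]
  (.L [(3,2,20956),(1,3,16922),(3,4,3870),(1,5,9762),(2,5,24247),(3,8,10760),(1,9,27118),(2,14,40169)] [10616,0] [0,0,0,0] 0 21955 [] [])
  (.L [(1,3,28315),(2,3,11326),(1,6,35843),(3,8,35843),(2,13,44338),(2,14,8495)] [0,0] [0,0,0,0] 0 16023 [] [(12,4697)]))
  (.L [(3,8,47462),(1,10,44702),(1,12,7837),(2,14,52539)] [0,0] [0,0,0,0] 0 100000 [] [(6,2538),(10,94701),(12,57836)]))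
  (.L [(2,10,57921),(1,12,100000),(2,12,13115),(2,14,28966)] [0,0] [0,0,0,0] 0 100000 [] [(6,14482),(10,72403),(12,127596)]))
  (.N 3 0 [2,1] [2,2,1,1]
  (.N 5 1 [3,1] [2,1,1,1]
  (.N 5 2 [3,0] [3,2,2,2]
  (.N 5 4 [4,1] [2,2,2,1]
  (.L [(3,2,20956),(2,3,16922),(1,5,30553),(2,5,7325),(3,8,14630),(1,9,23248),(2,14,40169)] [10616,0] [0,0,0,0] 0 21955 [] [])
  (.L [(1,5,50000),(3,8,42377),(1,9,7624),(2,14,57624)] [0,0] [0,0,0,0] 0 42377 [] [(12,50000)]))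
  (.L [(3,8,47462),(1,10,44702),(1,12,7837),(2,14,52539)] [0,0] [0,0,0,0] 0 100000 [] [(6,2538),(10,94701),(12,57836)]))
  (.L [(2,10,57921),(1,12,100000),(2,12,13115),(2,14,28966)] [0,0] [0,0,0,0] 0 100000 [] [(6,14482),(10,72403),(12,127596)]))
  (.N 4 2 [3,1] [3,2,2,1]
  (.N 3 0 [3,1] [2,2,1,1]
  (.N 5 1 [3,1] [2,1,1,1]
  (.L [(2,3,17625),(1,5,27969),(3,8,27969),(2,13,13219),(2,14,41188)] [44063,0] [0,0,0,0] 0 41188 [] [(12,23562)])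
  (.L [(1,9,28315),(1,12,71686),(2,13,14516),(2,14,85485)] [0,0] [0,0,0,0] 0 57171 [] [(6,7170),(10,35484),(12,121685)]))
  (.N 2 0 [4,1] [3,2,2,1]
  (.N 5 1 [3,1] [2,1,1,1]
  (.L [(2,3,15556),(1,6,42223),(3,8,30556),(2,11,26347),(2,13,27542)] [27223,0] [0,0,0,0] 0 30556 [] [(10,14680),(12,319)])
  (.L [(1,9,32074),(1,12,67927),(2,13,66),(2,14,99935)] [0,0] [0,0,0,0] 0 67861 [] [(6,17860),(10,49934),(12,117926)]))
  (.L [(2,3,14286),(2,13,42858),(2,14,42858)] [100000,0] [0,0,0,0] 0 42858 [] [(12,28571)])))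
  (.N 2 0 [2,0] [2,1,1,1]
  (.N 5 1 [3,1] [2,1,1,1]
  (.N 5 1 [5,1] [3,2,2,2]
  (.L [(3,10,100000)] [0,0] [0,0,0,0] 0 100000 [] [(10,100000)])
  (.L [(1,6,37487),(1,12,49815),(2,14,100000)] [12699,0] [0,0,0,0] 0 100000 [] [(6,87486),(10,50000),(12,99814)]))
  (.L [(1,10,8871),(2,10,60000),(1,12,91130),(2,14,40000)] [0,0] [0,0,0,0] 0 100000 [] [(6,20000),(10,88870),(12,111129)]))
  (.N 2 0 [3,0] [2,1,1,1]
  (.N 5 1 [3,1] [2,1,1,1]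
  (.N 5 1 [5,1] [3,2,2,2]
  (.L [(3,10,100000)] [0,0] [0,0,0,0] 0 100000 [] [(10,100000)])
  (.L [(1,12,60982),(2,14,100000)] [39019,0] [0,0,0,0] 0 100000 [] [(6,50000),(10,50000),(12,110981)]))
  (.L [(1,12,88492),(2,14,100000)] [11509,0] [0,0,0,0] 0 100000 [] [(6,50000),(10,50000),(12,138491)]))
  (.N 3 0 [3,1] [2,2,1,1]
  (.N 5 1 [3,1] [2,1,1,1]
  (.L [(3,2,36712),(1,6,13289),(1,10,13289),(1,12,4045),(2,13,63289)] [32668,0] [0,0,0,0] 0 36712 [] [(12,17332)])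
  (.L [(1,12,70655),(2,13,21417),(2,14,78584)] [29346,0] [0,0,0,0] 0 78584 [] [(6,28583),(10,28583),(12,120654)]))
  (.N 4 0 [4,1] [3,2,2,1]
  (.N 5 1 [3,1] [2,1,1,1]
  (.L [(3,2,33414),(3,4,3299),(1,6,13289),(1,10,17333),(2,11,16587),(2,13,46702)] [32668,0] [0,0,0,0] 0 36712 [] [(10,17332)])
  (.L [(1,10,4802),(1,12,71173),(2,14,100000)] [24026,0] [0,0,0,0] 0 100000 [] [(6,50000),(10,54801),(12,121172)]))
  (.L [(2,3,14286),(2,13,42858),(2,14,42858)] [100000,0] [0,0,0,0] 0 42858 [] [(12,28571)])))))))))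
  (.N 4 0 [2,1] [1,1,1,0]
  (.L [(1,12,100000),(2,12,100000)] [0,0] [0,0,0,0] 0 100000 [] [(12,200000)])
  (.N 3 0 [2,1] [2,2,1,1]
  (.L [(1,12,100000),(2,12,100000)] [0,0] [0,0,0,0] 0 100000 [] [(12,200000)])
  (.N 5 0 [2,0] [2,1,1,1]
  (.L [(1,12,100000),(2,12,60000),(2,14,40000)] [0,0] [0,0,0,0] 0 100000 [] [(6,20000),(10,20000),(12,180000)])
  (.N 3 0 [3,1] [2,2,1,1]
  (.L [(1,12,100000),(2,14,100000)] [0,0] [0,0,0,0] 0 100000 [] [(6,50000),(10,50000),(12,150000)])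
  (.N 2 0 [1,0] [1,0,0,0]
  (.L [(1,12,100000),(2,14,100000)] [0,0] [0,0,0,0] 0 100000 [] [(6,50000),(10,50000),(12,150000)])
  (.L [(2,5,2021),(2,9,32660),(2,14,65320)] [100000,0] [0,0,0,0] 0 65320 [] [(10,30638),(12,32659)]))))))))
  (.N 5 2 [1,1] [2,1,1,1]
  (.N 5 0 [1,0] [1,1,1,1]
  (.N 5 1 [1,1] [1,1,1,1]
  (.L [(1,3,22728),(2,3,22728),(3,10,31819),(3,12,45455)] [0,0] [0,0,0,0] 0 54546 [] [(10,31818)])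
  (.N 1 0 [2,1] [1,1,1,1]
  (.N 5 1 [2,2] [1,1,1,1]
  (.L [(3,1,11283),(2,3,21771),(1,5,41538),(2,6,15564),(2,9,9922),(1,10,47180),(2,12,41462)] [0,0] [0,0,0,0] 0 15487 [] [(12,14049)])
  (.L [(1,5,33929),(2,5,10715),(1,9,44643),(1,12,21429),(2,14,89286)] [0,0] [0,0,0,0] 0 10715 [] [(12,66071)]))
  (.N 4 0 [2,1] [2,2,2,1]
  (.L [(3,1,11283),(2,3,21771),(1,5,41538),(2,6,15564),(2,9,9922),(1,10,47180),(2,12,41462)] [0,0] [0,0,0,0] 0 15487 [] [(12,14049)])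
  (.L [(3,1,16846),(2,3,33155),(3,4,7795),(1,5,31521),(2,6,4526),(1,10,43841),(2,12,37681)] [0,0] [0,0,0,0] 0 18480 [] []))))
  (.N 5 1 [2,1] [1,1,1,1]
  (.N 2 0 [2,1] [2,1,1,1]
  (.N 5 4 [2,1] [2,2,2,1]
  (.L [(3,1,16846),(2,3,33155),(3,4,7795),(1,5,31521),(2,6,4526),(1,10,43841),(2,12,37681)] [0,0] [0,0,0,0] 0 18480 [] [])
  (.L [(3,1,40991),(1,3,9010),(1,5,25000),(1,9,9010),(1,10,15991),(2,14,59010)] [0,0] [0,0,0,0] 0 15991 [] []))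
  (.N 3 0 [2,1] [2,2,1,1]
  (.N 5 4 [2,1] [2,2,2,1]
  (.L [(3,2,12320),(1,5,6160),(2,5,75361),(3,8,12320),(1,10,69201)] [0,0] [0,0,0,0] 0 18480 [] [])
  (.L [(3,1,38442),(2,3,7706),(1,5,30780),(1,10,30780),(2,13,7706),(2,14,46148)] [0,0] [0,0,0,0] 0 15368 [] []))
  (.N 5 0 [2,0] [1,1,1,1]
  (.N 5 1 [3,1] [2,2,2,2]
  (.L [(3,1,18519),(3,2,18519),(3,12,62963)] [0,0] [0,0,0,0] 0 81482 [] [(12,44444)])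
  (.L [(3,1,8732),(3,2,41269),(1,5,24426),(1,10,24426),(2,13,41269),(2,14,8732)] [1150,0] [0,0,0,0] 0 25575 [] []))
  (.N 3 0 [3,1] [2,2,1,1]
  (.L [(3,1,8732),(3,2,41269),(1,5,24426),(1,10,24426),(2,13,41269),(2,14,8732)] [1150,0] [0,0,0,0] 0 25575 [] [])
  (.N 4 0 [2,1] [1,1,1,0]
  (.L [(1,5,48829),(1,6,1172),(2,11,50000),(2,13,1172),(2,14,48829)] [50000,0] [0,0,0,0] 0 0 [] [])
  (.N 2 0 [3,1] [2,1,1,1]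
  (.L [(2,3,20041),(1,5,39980),(1,6,4909),(3,8,24950),(2,11,19940),(2,14,35071)] [30163,0] [0,0,0,0] 0 20041 [] [])
  (.N 1 0 [3,1] [1,1,1,1]
  (.L [(2,3,3658),(1,6,20570),(2,6,15963),(2,11,36532),(2,13,40190),(2,14,3658)] [79431,0] [0,0,0,0] 0 19621 [] [])
  (.L [(2,3,29630),(2,13,35186),(2,14,35186)] [100000,0] [0,0,0,0] 0 35186 [] [(12,5555)]))))))))
  (.N 3 0 [2,1] [2,2,1,1]
  (.L [(1,5,44643),(1,9,44643),(1,12,10715),(2,12,10715),(2,14,89286)] [0,0] [0,0,0,0] 0 10715 [] [(12,66071)])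
  (.N 2 0 [2,1] [2,1,1,1]
  (.L [(1,5,30000),(1,9,50000),(1,10,20000),(2,14,100000)] [0,0] [0,0,0,0] 0 20000 [] [(10,40000),(12,50000)])
  (.N 4 0 [2,1] [1,1,1,0]
  (.L [(1,5,50000),(1,9,10860),(1,10,39141),(2,13,39141),(2,14,60860)] [0,0] [0,0,0,0] 0 0 [] [(12,50000)])
  (.N 2 0 [3,1] [2,1,1,1]
  (.L [(1,5,10860),(1,6,39141),(1,9,50000),(2,13,39141),(2,14,60860)] [0,0] [0,0,0,0] 0 0 [] [(12,50000)])
  (.N 3 0 [3,1] [2,2,1,1]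
  (.L [(1,6,50000),(1,9,50000),(2,13,50000),(2,14,50000)] [0,0] [0,0,0,0] 0 0 [] [(12,50000)])
  (.L [(0,7,30598),(2,11,30598),(2,13,34702),(2,14,34702)] [100000,0] [0,0,0,0] 0 4105 [] [(12,4104)]))))))))
  (.N 3 0 [2,1] [2,2,1,1]
  (.L [(1,5,44643),(1,9,44643),(1,12,10715),(2,12,10715),(2,14,89286)] [0,0] [0,0,0,0] 0 10715 [] [(12,66071)])
  (.N 5 0 [2,1] [2,1,1,1]
  (.L [(1,5,29592),(1,9,50000),(1,10,20409),(2,14,100000)] [0,0] [0,0,0,0] 0 20409 [] [(10,40816),(12,50000)])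
  (.N 4 0 [2,1] [1,1,1,0]
  (.L [(1,5,46874),(1,9,51823),(1,12,1304),(0,13,1304),(0,14,4949),(2,14,100000)] [0,0] [0,0,0,0] 0 0 [] [(10,4948),(12,54430)])
  (.N 3 0 [3,1] [2,2,1,1]
  (.L [(1,5,46874),(1,9,51823),(1,12,1304),(0,13,1304),(0,14,4949),(2,14,100000)] [0,0] [0,0,0,0] 0 0 [] [(10,4948),(12,54430)])
  (.N 5 0 [3,1] [2,1,1,1]
  (.L [(1,9,53556),(1,12,46445),(0,14,33872),(2,14,100000)] [0,0] [0,0,0,0] 0 46445 [] [(6,13380),(10,66935),(12,113380)])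
  (.L [(0,13,12963),(2,13,48149),(0,14,9260),(2,14,51852)] [100000,0] [0,0,0,0] 0 38889 [] [(12,61111)]))))))))
  (.N 2 0 [1,0] [1,0,0,0]
  (.N 2 1 [1,1] [1,0,0,0]
  (.L [(1,12,100000),(2,12,100000)] [0,0] [0,0,0,0] 0 100000 [] [(12,200000)])
  (.L [(1,12,75000),(2,13,62500),(1,14,25000),(2,14,37500)] [0,0] [0,0,0,0] 0 37500 [] [(12,137500)]))
  (.N 5 0 [2,1] [2,2,1,1]
  (.L [(1,12,100000),(0,13,19048),(2,13,40477),(2,14,59524)] [0,0] [0,0,0,0] 0 40477 [] [(12,159523)])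
  (.N 4 0 [2,1] [1,1,1,0]
  (.L [(1,12,100000),(0,13,40243),(2,13,29879),(2,14,70122)] [0,0] [0,0,0,0] 0 29879 [] [(12,170121)])
  (.N 5 0 [3,1] [2,2,1,1]
  (.L [(1,12,100000),(0,13,40243),(2,13,29879),(2,14,70122)] [0,0] [0,0,0,0] 0 29879 [] [(12,170121)])
  (.L [(2,13,61112),(0,14,22223),(2,14,38889)] [100000,0] [0,0,0,0] 0 38889 [] [(12,61111)])))))))

def ini24 : List Vtx := [([1, 0], [0, 0, 0, 0]), ([1, 1], [0, 0, 0, 0]), ([0, 0], [1, 0, 0, 0]), ([0, 0], [1, 1, 0, 0]), ([0, 0], [1, 1, 1, 0]), ([0, 0], [1, 1, 1, 1])]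

theorem ok24 : check 2 4 tr24 ini24 = true := by decide +kernel

def tr33 : Tr :=
  .N 3 0 [1,0,0] [1,0,0]
  (.N 5 1 [1,1,0] [1,1,1]
  (.N 5 2 [1,1,1] [1,1,1]
  (.N 3 2 [1,1,1] [2,1,1]
  (.N 3 1 [1,1,0] [2,1,1]
  (.L [(7,2,100000),(7,4,100000)] [0,0,0] [100000,0,0] 0 0 [(3,50000),(5,50000),(6,50000)] [])
  (.L [(6,1,100000),(7,2,100000),(7,4,100000)] [0,0,0] [0,0,0] 0 0 [(3,50000),(5,50000),(6,150000)] []))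
  (.N 5 2 [1,1,1] [2,2,2]
  (.L [(6,1,100000),(7,2,100000),(7,4,100000)] [0,0,0] [0,0,0] 0 0 [(3,50000),(5,50000),(6,150000)] [])
  (.N 5 2 [2,2,2] [3,3,3]
  (.L [(6,1,100000),(7,2,100000),(7,4,100000)] [0,0,0] [0,0,0] 0 0 [(3,50000),(5,50000),(6,150000)] [])
  (.L [(6,1,80702),(3,2,29825),(3,4,10527),(2,5,19299),(5,6,59650),(6,6,10527)] [0,0,0] [0,0,0] 0 0 [(6,50877)] []))))
  (.N 4 2 [1,1,1] [1,1,0]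
  (.N 3 2 [1,1,1] [2,1,0]
  (.N 5 3 [1,1,1] [2,1,1]
  (.L [(6,1,76503),(3,2,30055),(3,4,9837),(2,5,20219),(5,6,60110),(6,6,9837)] [0,0,0] [3279,0,0] 0 0 [(6,46448)] [])
  (.N 3 1 [1,1,0] [2,1,1]
  (.L [(6,2,700000),(7,4,700000),(3,6,4876667),(6,6,6935834)] [0,0,0] [100000,0,0] 0 0 [(3,5176666),(5,300000),(6,7935833)] [(6,12412500)])
  (.L [(6,1,100000),(3,2,33334),(7,4,33334),(5,6,177942),(6,6,21569)] [0,0,0] [0,0,0] 0 0 [(5,144607),(6,88235)] [(6,132843)])))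
  (.L [(6,1,17648),(3,2,47795),(2,5,15442),(4,5,11030),(6,5,21324),(5,6,52206)] [0,0,0] [34559,0,0] 0 0 [(6,2205)] []))
  (.N 3 2 [1,1,1] [1,0,0]
  (.N 5 3 [1,1,1] [2,1,1]
  (.N 2 1 [2,2,1] [2,1,1]
  (.L [(2,3,50000),(2,5,50000),(5,6,100000)] [0,0,0] [0,0,0] 0 0 [] [(6,50000)])
  (.L [(6,1,37852),(3,2,5499),(2,3,35039),(3,4,13428),(2,5,27110),(5,6,81075),(6,6,2814)] [0,0,0] [0,0,0] 0 0 [(6,21739)] [(6,24424)]))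
  (.N 3 1 [1,1,0] [2,1,1]
  (.L [(3,6,50000),(5,6,50000),(6,6,50000)] [0,0,0] [100000,0,0] 0 0 [] [(6,50000)])
  (.N 2 1 [2,2,1] [2,1,1]
  (.L [(2,1,60000),(4,3,3284),(4,5,3284),(1,6,46568),(5,6,53433),(6,6,40000)] [0,0,0] [33433,0,0] 0 0 [] [(6,43283)])
  (.N 4 3 [2,2,1] [3,2,1]
  (.L [(6,1,40000),(3,2,20000),(2,3,20000),(2,5,40000),(5,6,80000),(6,6,3847)] [0,0,0] [0,0,0] 0 0 [(6,23846)] [(6,23846)])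
  (.L [(6,1,100000),(3,2,25000),(3,4,25000),(5,6,50000),(6,6,167693)] [0,0,0] [0,0,0] 0 0 [(6,217692)] [(6,142692)])))))
  (.N 2 1 [2,2,1] [1,1,1]
  (.N 5 2 [2,2,2] [1,1,1]
  (.N 5 2 [3,3,3] [2,2,2]
  (.L [(2,3,50000),(2,5,50000),(5,6,100000)] [0,0,0] [0,0,0] 0 0 [] [(6,50000)])
  (.L [(1,6,100000),(4,6,20732),(2,7,100000),(4,7,79269)] [0,0,0] [0,0,0] 0 0 [] [(3,39634),(5,39634),(6,160365)]))
  (.L [(1,6,100000),(2,6,42737),(2,7,96895),(4,7,139632)] [0,0,0] [0,0,0] 0 0 [(6,39631)] [(3,68263),(5,68263),(6,211000)]))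
  (.N 3 1 [2,2,1] [2,1,1]
  (.L [(2,3,50000),(2,5,50000),(5,6,100000)] [0,0,0] [0,0,0] 0 0 [] [(6,50000)])
  (.L [(3,2,33334),(2,3,33334),(6,5,66667),(5,6,66667)] [0,0,0] [0,0,0] 0 0 [(6,33333)] [(6,33333)]))))))
  (.N 4 2 [1,1,1] [1,1,0]
  (.N 4 1 [1,1,0] [1,1,0]
  (.N 3 2 [1,1,1] [2,1,0]
  (.N 5 3 [1,1,0] [2,1,1]
  (.L [(6,1,100000),(6,2,100000),(7,4,100000),(6,6,297059)] [0,0,0] [0,0,0] 0 0 [(6,497058)] [(6,297058)])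
  (.L [(7,0,700000),(6,6,3500000)] [0,0,0] [100000,0,0] 0 0 [(3,300000),(5,300000),(6,3800000)] [(6,3400000)]))
  (.N 4 2 [1,1,1] [2,2,0]
  (.L [(6,2,200000),(7,4,100000),(6,5,100000),(6,6,274325)] [0,0,0] [0,0,0] 0 0 [(6,574324)] [(6,374324)])
  (.N 2 0 [2,1,1] [2,1,0]
  (.N 5 2 [2,2,1] [2,2,1]
  (.L [(6,1,32250),(6,2,83876),(3,4,16125),(1,5,67751),(5,6,16125),(6,6,31487)] [0,0,0] [0,0,0] 0 0 [(6,63735)] [(6,31486)])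
  (.N 4 1 [2,2,1] [3,3,0]
  (.L [(3,2,50000),(6,5,50000),(5,6,50000)] [0,0,0] [50000,0,0] 0 0 [] [])
  (.L [(5,2,2108),(6,2,68375),(0,3,14759),(1,5,100000),(6,6,31626)] [0,0,0] [0,0,0] 0 0 [(5,2107)] [(5,14758),(6,16866)])))
  (.L [(6,1,100000),(5,2,50000),(3,4,50000),(6,6,206419)] [0,0,0] [0,0,0] 0 0 [(6,256418)] [(6,156418)]))))
  (.N 3 1 [1,1,0] [1,0,0]
  (.N 5 3 [1,1,0] [2,1,1]
  (.N 5 0 [2,1,0] [2,1,1]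
  (.N 5 1 [2,2,0] [2,1,1]
  (.N 5 2 [2,2,1] [2,2,1]
  (.L [(5,1,9692),(6,1,90309),(5,2,13666),(3,4,13666),(1,6,72669),(5,6,13666)] [0,0,0] [0,0,0] 0 0 [(5,23357),(6,3974)] [])
  (.L [(5,1,93433),(4,3,3284),(4,5,3284),(1,6,6568),(2,6,100000)] [0,0,0] [0,0,0] 0 0 [] [(6,9850)]))
  (.L [(1,1,84379),(4,3,3284),(4,5,3284),(1,6,15622),(2,6,6568),(6,6,93433)] [0,0,0] [9055,0,0] 0 0 [] [(6,18905)]))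
  (.L [(2,1,60000),(4,3,3284),(4,5,3284),(1,6,46568),(5,6,53433),(6,6,40000)] [0,0,0] [33433,0,0] 0 0 [] [(6,43283)]))
  (.N 3 2 [1,1,1] [2,1,0]
  (.L [(1,6,100000),(5,6,1500000),(6,6,400000)] [0,0,0] [100000,0,0] 0 0 [(5,1500000),(6,300000)] [(6,1900000)])
  (.L [(2,1,60000),(0,3,3549),(4,5,3549),(1,6,3549),(2,6,40000),(5,6,96452)] [0,0,0] [32904,0,0] 0 0 [] [(6,43548)])))
  (.N 5 1 [2,2,0] [1,1,1]
  (.N 5 0 [2,1,0] [2,1,1]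
  (.N 5 3 [2,2,0] [2,1,1]
  (.N 5 2 [2,2,1] [2,2,1]
  (.N 4 1 [3,3,0] [2,2,1]
  (.L [(3,0,14759),(5,1,13103),(6,1,86898),(1,6,70483),(5,6,31626)] [0,0,0] [0,0,0] 0 0 [(5,29968),(6,1656)] [(6,2107)])
  (.L [(2,3,50000),(6,5,50000),(5,6,50000)] [50000,0,0] [0,0,0] 0 0 [] []))
  (.L [(5,1,20688),(5,2,49303),(4,3,15006),(2,5,64308),(1,6,30011),(2,6,20688),(6,6,32154)] [0,0,0] [0,0,0] 0 0 [(6,17148)] [(6,47158)]))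
  (.L [(4,3,50000),(2,5,150000),(5,6,100000),(6,6,106419)] [0,0,0] [0,0,0] 0 0 [(6,156418)] [(5,100000),(6,156418)]))
  (.L [(4,3,50000),(2,5,150000),(5,6,100000),(6,6,106419)] [0,0,0] [0,0,0] 0 0 [(6,156418)] [(5,100000),(6,156418)]))
  (.L [(2,5,200000),(5,6,100000),(6,6,274325),(4,7,100000)] [0,0,0] [0,0,0] 0 0 [(6,374324)] [(5,200000),(6,374324)]))))
  (.N 3 2 [1,1,1] [1,0,0]
  (.N 3 1 [1,1,0] [1,0,0]
  (.N 5 3 [1,1,0] [2,1,1]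
  (.N 5 2 [2,2,1] [2,1,1]
  (.N 5 0 [2,1,0] [2,1,1]
  (.N 5 1 [2,2,0] [2,1,1]
  (.N 4 3 [2,2,1] [3,2,1]
  (.L [(3,2,33334),(2,3,33334),(6,5,66667),(5,6,66667)] [0,0,0] [0,0,0] 0 0 [(6,33333)] [(6,33333)])
  (.L [(5,1,50000),(6,1,50000),(3,2,25000),(3,4,25000),(5,6,217693)] [0,0,0] [0,0,0] 0 0 [(5,217692)] [(6,142692)]))
  (.L [(1,1,84379),(4,3,3284),(4,5,3284),(1,6,15622),(2,6,6568),(6,6,93433)] [0,0,0] [9055,0,0] 0 0 [] [(6,18905)]))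
  (.L [(2,1,60000),(4,3,3284),(4,5,3284),(1,6,46568),(5,6,53433),(6,6,40000)] [0,0,0] [33433,0,0] 0 0 [] [(6,43283)]))
  (.L [(2,1,60000),(4,3,3284),(4,5,3284),(1,6,46568),(5,6,53433),(6,6,40000)] [0,0,0] [33433,0,0] 0 0 [] [(6,43283)]))
  (.N 4 3 [1,1,1] [2,1,0]
  (.L [(2,1,60000),(0,3,3549),(4,5,3549),(1,6,43549),(5,6,56452),(6,6,40000)] [0,0,0] [32904,0,0] 0 0 [] [(6,43548)])
  (.L [(1,6,700000),(2,6,400000),(4,6,1000000),(5,6,3400000)] [0,0,0] [100000,0,0] 0 0 [(5,4000000),(6,300000)] [(6,5400000)])))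
  (.N 5 2 [2,2,1] [2,1,1]
  (.L [(2,3,50000),(6,5,50000),(5,6,50000)] [50000,0,0] [0,0,0] 0 0 [] [])
  (.L [(1,6,20660),(2,6,179341),(5,6,79341),(4,7,100000)] [0,0,0] [0,0,0] 0 0 [(6,79340)] [(6,279340)])))
  (.N 5 2 [2,2,1] [1,1,1]
  (.N 5 3 [2,2,1] [2,1,1]
  (.L [(2,3,50000),(6,5,50000),(5,6,50000)] [50000,0,0] [0,0,0] 0 0 [] [])
  (.L [(2,5,19239),(1,6,100000),(2,6,80762),(4,7,100000)] [0,0,0] [0,0,0] 0 0 [] [(5,19238),(6,180761)]))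
  (.L [(1,6,100000),(2,6,42737),(2,7,96895),(4,7,139632)] [0,0,0] [0,0,0] 0 0 [(6,39631)] [(3,68263),(5,68263),(6,211000)])))))
  (.N 4 2 [1,1,1] [1,1,0]
  (.N 5 1 [1,1,0] [1,1,1]
  (.N 5 0 [1,0,0] [1,1,1]
  (.N 5 2 [1,1,1] [2,2,1]
  (.L [(6,1,100000),(6,2,42737),(7,2,96895),(7,4,139632)] [0,0,0] [0,0,0] 0 0 [(3,68263),(5,68263),(6,211000)] [(6,39631)])
  (.N 2 0 [2,1,1] [2,2,1]
  (.L [(3,2,50000),(6,5,50000),(5,6,50000)] [0,0,0] [50000,0,0] 0 0 [] [])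
  (.L [(6,1,100000),(6,2,100000),(7,4,100000)] [0,0,0] [0,0,0] 0 0 [(6,200000)] [])))
  (.N 4 0 [1,0,0] [1,1,0]
  (.N 5 2 [2,1,1] [2,2,1]
  (.L [(6,1,100000),(6,2,100000),(7,4,100000),(6,5,79341)] [0,0,0] [0,0,0] 0 0 [(6,279340)] [(5,79340)])
  (.L [(3,2,50000),(6,5,50000),(5,6,50000)] [0,0,0] [50000,0,0] 0 0 [] []))
  (.N 2 0 [2,1,1] [1,1,0]
  (.N 5 2 [2,1,1] [2,2,1]
  (.L [(6,1,6568),(1,2,60000),(6,2,40000),(3,4,3284),(5,4,3284),(6,5,93433)] [33433,0,0] [0,0,0] 0 0 [(6,43283)] [])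
  (.N 3 2 [2,1,1] [2,1,0]
  (.L [(6,1,46568),(1,2,60000),(3,4,3284),(5,4,3284),(6,5,53433),(6,6,40000)] [33433,0,0] [0,0,0] 0 0 [(6,43283)] [])
  (.N 4 2 [2,1,1] [2,2,0]
  (.L [(6,1,61095),(1,2,45473),(3,4,3284),(5,4,3284),(1,5,38906),(6,6,54528)] [9055,0,0] [0,0,0] 0 0 [(6,18905)] [])
  (.N 1 0 [3,2,1] [2,2,1]
  (.L [(3,2,33334),(2,3,33334),(6,5,66667),(5,6,66667)] [0,0,0] [0,0,0] 0 0 [(6,33333)] [(6,33333)])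
  (.L [(2,3,25000),(4,3,25000),(6,5,217693),(1,6,100000)] [0,0,0] [0,0,0] 0 0 [(6,142692)] [(5,167692),(6,50000)])))))
  (.N 1 0 [2,1,0] [1,1,1]
  (.L [(3,0,3549),(6,1,3549),(1,2,60000),(6,2,40000),(5,4,3549),(6,5,96452)] [32904,0,0] [0,0,0] 0 0 [(6,43548)] [])
  (.L [(6,1,700000),(6,2,400000),(6,4,1000000),(6,5,3400000)] [100000,0,0] [0,0,0] 0 0 [(6,5400000)] [(5,4000000),(6,300000)])))))
  (.N 4 1 [1,1,0] [1,1,0]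
  (.N 4 0 [1,0,0] [1,1,0]
  (.N 4 2 [1,1,1] [2,2,0]
  (.L [(6,2,200000),(7,4,100000),(6,5,100000),(6,6,274325)] [0,0,0] [0,0,0] 0 0 [(6,574324)] [(6,374324)])
  (.N 3 2 [2,1,1] [2,1,0]
  (.L [(6,1,100000),(5,2,50000),(3,4,50000),(6,6,206419)] [0,0,0] [0,0,0] 0 0 [(6,256418)] [(6,156418)])
  (.N 2 0 [2,1,1] [2,2,0]
  (.N 5 2 [2,2,1] [2,2,1]
  (.L [(6,1,30011),(5,2,32154),(6,2,52842),(3,4,15006),(1,5,20688),(2,5,49303),(5,6,32154)] [0,0,0] [0,0,0] 0 0 [(6,47158)] [(6,17148)])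
  (.N 4 1 [2,2,1] [3,3,0]
  (.L [(3,2,50000),(6,5,50000),(5,6,50000)] [0,0,0] [50000,0,0] 0 0 [] [])
  (.L [(5,2,2108),(6,2,68375),(0,3,14759),(1,5,100000),(6,6,31626)] [0,0,0] [0,0,0] 0 0 [(5,2107)] [(5,14758),(6,16866)])))
  (.L [(6,2,150000),(3,4,50000),(6,5,100000),(5,6,50000),(6,6,56419)] [0,0,0] [0,0,0] 0 0 [(6,256418)] [(6,156418)]))))
  (.N 2 0 [2,1,1] [1,1,0]
  (.N 3 2 [2,1,1] [2,1,0]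
  (.L [(6,1,46568),(1,2,60000),(3,4,3284),(5,4,3284),(6,5,53433),(6,6,40000)] [33433,0,0] [0,0,0] 0 0 [(6,43283)] [])
  (.N 4 2 [2,1,1] [2,2,0]
  (.L [(6,1,61095),(1,2,45473),(3,4,3284),(5,4,3284),(1,5,38906),(6,6,54528)] [9055,0,0] [0,0,0] 0 0 [(6,18905)] [])
  (.N 5 2 [2,2,1] [2,2,1]
  (.L [(6,1,6568),(6,2,100000),(3,4,3284),(5,4,3284),(1,5,93433)] [0,0,0] [0,0,0] 0 0 [(6,9850)] [])
  (.L [(6,1,72669),(4,3,13666),(1,5,21080),(6,5,13666),(1,6,78921),(2,6,13666)] [0,0,0] [0,0,0] 0 0 [] [(5,21079),(6,6251)]))))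
  (.N 5 0 [2,1,0] [1,1,1]
  (.L [(3,0,3549),(6,1,43549),(1,2,60000),(5,4,3549),(6,5,56452),(6,6,40000)] [32904,0,0] [0,0,0] 0 0 [(6,43548)] [])
  (.L [(6,2,100000),(6,5,1600000),(6,6,300000)] [100000,0,0] [0,0,0] 0 0 [(6,1900000)] [(5,1500000),(6,300000)]))))
  (.N 5 0 [2,1,0] [1,1,1]
  (.N 5 1 [2,2,0] [1,1,1]
  (.N 5 3 [2,1,0] [2,1,1]
  (.N 5 2 [2,2,1] [2,2,1]
  (.N 4 1 [3,3,0] [2,2,1]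
  (.L [(3,0,14759),(5,1,23307),(6,1,36521),(6,2,40174),(2,5,8548),(6,5,31626),(1,6,61935)] [0,0,0] [0,0,0] 0 0 [(6,31625)] [(6,2107)])
  (.L [(2,3,50000),(6,5,50000),(5,6,50000)] [50000,0,0] [0,0,0] 0 0 [] []))
  (.L [(5,2,67751),(4,3,16125),(2,5,94353),(1,6,21773),(5,6,10478),(6,6,37134)] [0,0,0] [0,0,0] 0 0 [(6,31486)] [(5,10477),(6,53258)]))
  (.L [(4,3,50000),(2,5,150000),(5,6,100000),(6,6,106419)] [0,0,0] [0,0,0] 0 0 [(6,156418)] [(5,100000),(6,156418)]))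
  (.L [(2,5,200000),(5,6,100000),(6,6,274325),(4,7,100000)] [0,0,0] [0,0,0] 0 0 [(6,374324)] [(5,200000),(6,374324)]))
  (.N 2 0 [2,1,1] [1,1,0]
  (.L [(2,5,45589),(6,5,297059),(1,6,100000),(2,6,54412),(4,7,100000)] [0,0,0] [0,0,0] 0 0 [(6,297058)] [(5,342647),(6,154411)])
  (.L [(2,5,700000),(6,5,2100000),(6,6,700000),(4,7,700000)] [100000,0,0] [0,0,0] 0 0 [(6,3400000)] [(3,300000),(5,3100000),(6,1000000)])))))
  (.N 5 2 [1,1,1] [1,1,1]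
  (.N 5 1 [1,1,0] [1,1,1]
  (.N 5 0 [1,0,0] [1,1,1]
  (.N 5 4 [1,1,1] [2,2,1]
  (.N 5 2 [1,1,1] [2,2,2]
  (.L [(6,1,100000),(6,2,42737),(7,2,96895),(7,4,139632)] [0,0,0] [0,0,0] 0 0 [(3,68263),(5,68263),(6,211000)] [(6,39631)])
  (.N 5 2 [2,2,2] [3,3,3]
  (.L [(6,1,100000),(6,2,20732),(7,2,79269),(7,4,100000)] [0,0,0] [0,0,0] 0 0 [(3,39634),(5,39634),(6,160365)] [])
  (.L [(3,2,50000),(5,2,50000),(6,5,100000)] [0,0,0] [0,0,0] 0 0 [(6,50000)] [])))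
  (.N 4 0 [2,1,1] [2,2,1]
  (.L [(3,2,33334),(2,3,33334),(6,5,66667),(5,6,66667)] [0,0,0] [0,0,0] 0 0 [(6,33333)] [(6,33333)])
  (.L [(3,2,50000),(5,2,50000),(6,5,100000)] [0,0,0] [0,0,0] 0 0 [(6,50000)] [])))
  (.N 2 0 [2,1,1] [1,1,1]
  (.N 5 4 [2,1,1] [2,2,1]
  (.L [(3,2,50000),(5,2,50000),(6,5,100000)] [0,0,0] [0,0,0] 0 0 [(6,50000)] [])
  (.L [(3,2,35039),(5,2,27110),(2,3,5499),(4,3,13428),(6,5,81075),(1,6,37852),(6,6,2814)] [0,0,0] [0,0,0] 0 0 [(6,24424)] [(6,21739)]))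
  (.N 4 0 [2,1,1] [1,1,0]
  (.N 5 4 [2,1,1] [2,2,1]
  (.L [(6,1,46568),(1,2,60000),(3,4,3284),(5,4,3284),(6,5,53433),(6,6,40000)] [33433,0,0] [0,0,0] 0 0 [(6,43283)] [])
  (.N 1 0 [3,2,1] [2,2,1]
  (.L [(3,2,20000),(5,2,40000),(2,3,20000),(6,5,80000),(1,6,40000),(6,6,3847)] [0,0,0] [0,0,0] 0 0 [(6,23846)] [(6,23846)])
  (.L [(2,3,25000),(4,3,25000),(6,5,196250),(1,6,100000),(6,6,21443)] [0,0,0] [0,0,0] 0 0 [(6,142692)] [(5,146250),(6,71442)])))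
  (.L [(6,3,50000),(6,5,50000),(6,6,50000)] [100000,0,0] [0,0,0] 0 0 [(6,50000)] []))))
  (.N 5 0 [2,1,0] [1,1,1]
  (.L [(6,1,26471),(2,3,36765),(2,5,28677),(6,5,8089),(5,6,65442)] [34559,0,0] [0,0,0] 0 0 [] [(6,2205)])
  (.N 2 0 [2,1,1] [1,1,1]
  (.L [(5,2,20219),(2,3,30055),(4,3,9837),(6,5,60110),(1,6,76503),(6,6,9837)] [3279,0,0] [0,0,0] 0 0 [] [(6,46448)])
  (.N 4 0 [2,1,1] [1,1,0]
  (.L [(2,3,33334),(6,5,177942),(1,6,100000),(6,6,21569),(4,7,33334)] [0,0,0] [0,0,0] 0 0 [(6,132843)] [(5,144607),(6,88235)])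
  (.L [(2,6,700000),(6,6,11812500),(4,7,700000)] [100000,0,0] [0,0,0] 0 0 [(6,12412500)] [(3,300000),(5,300000),(6,12812500)])))))
  (.N 5 0 [2,1,1] [1,1,1]
  (.N 5 2 [2,2,2] [1,1,1]
  (.N 5 2 [3,3,3] [2,2,2]
  (.L [(5,2,19299),(2,3,29825),(4,3,10527),(6,5,59650),(1,6,80702),(6,6,10527)] [0,0,0] [0,0,0] 0 0 [] [(6,50877)])
  (.L [(1,6,100000),(2,7,100000),(4,7,100000)] [0,0,0] [0,0,0] 0 0 [] [(3,50000),(5,50000),(6,150000)]))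
  (.L [(1,6,100000),(2,7,100000),(4,7,100000)] [0,0,0] [0,0,0] 0 0 [] [(3,50000),(5,50000),(6,150000)]))
  (.N 4 0 [2,1,1] [1,1,0]
  (.L [(1,6,100000),(2,7,100000),(4,7,100000)] [0,0,0] [0,0,0] 0 0 [] [(3,50000),(5,50000),(6,150000)])
  (.L [(2,7,100000),(4,7,100000)] [100000,0,0] [0,0,0] 0 0 [] [(3,50000),(5,50000),(6,50000)])))))

def ini33 : List Vtx := [([1, 0, 0], [0, 0, 0]), ([1, 1, 0], [0, 0, 0]), ([1, 1, 1], [0, 0, 0]), ([0, 0, 0], [1, 0, 0]), ([0, 0, 0], [1, 1, 0]), ([0, 0, 0], [1, 1, 1])]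

theorem ok33 : check 3 3 tr33 ini33 = true := by decide +kernel

def tr34 : Tr :=
  .N 6 2 [1,1,1] [1,1,1,1]
  (.N 3 1 [1,1,0] [1,0,0,0]
  (.L [(6,2,2574496),(6,10,17592386),(6,12,1716331)] [100000,0,0] [0,0,0,0] 0 100000 [(6,21783211)] [(6,1287247),(10,18879633),(12,429082)])
  (.N 5 1 [1,1,0] [1,1,1,0]
  (.L [(6,1,2400000),(6,9,9066667),(6,10,7333334),(6,12,1600000)] [100000,0,0] [0,0,0,0] 0 0 [(6,20300000)] [(6,1100000),(9,11366666),(10,6133333),(12,400000)])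
  (.N 6 1 [1,1,0] [1,1,1,1]
  (.L [(6,1,2400000),(6,5,9066667),(6,6,1200000),(6,12,7733334)] [100000,0,0] [0,0,0,0] 0 0 [(6,20300000)] [(3,1100000),(5,10266666),(12,7633333)])
  (.L [(6,9,9533334),(2,10,800000),(6,10,3166667),(6,12,800000),(4,14,800000)] [100000,0,0] [0,0,0,0] 0 0 [(6,14200000)] [(6,300000),(9,9433333),(10,4366666),(12,1200000)]))))
  (.N 2 0 [2,1,1] [0,0,0,0]
  (.N 5 1 [1,1,0] [1,1,1,0]
  (.N 5 2 [1,1,1] [1,1,1,0]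
  (.L [(4,10,958166),(6,10,18392050),(1,12,100000),(2,12,1287248),(4,12,329083)] [0,0,0] [0,0,0,0] 0 100000 [(6,19579297)] [(10,19350214),(12,1716330)])
  (.N 3 2 [1,1,1] [1,0,0,0]
  (.L [(6,6,3976338),(6,10,5818128),(6,12,379083),(1,14,100000),(2,14,284312),(4,14,284312)] [0,0,0] [0,0,0,0] 0 100000 [(6,10357859)] [(6,4310649),(10,6152439),(12,713394)])
  (.L [(1,13,50000),(2,13,100000),(1,14,50000),(4,14,100000)] [0,0,0] [0,0,0,0] 0 0 [] [(3,50000),(12,200000)])))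
  (.N 3 2 [1,1,1] [1,0,0,0]
  (.L [(6,6,8149750),(6,10,1842155),(6,12,379083),(1,14,100000),(2,14,379083),(4,14,379083)] [0,0,0] [0,0,0,0] 0 100000 [(6,10650069)] [(6,8578832),(10,2271236),(12,808165)])
  (.L [(1,13,50000),(4,13,100000),(1,14,50000),(2,14,100000)] [0,0,0] [0,0,0,0] 0 0 [] [(3,50000),(12,200000)])))
  (.N 5 1 [1,1,0] [1,1,1,0]
  (.L [(2,10,1287248),(4,10,1287248),(6,10,17592386),(6,12,1716331)] [100000,0,0] [0,0,0,0] 0 100000 [(6,20495963)] [(10,20166881),(12,1716330)])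
  (.L [(6,10,11191904),(6,12,429083),(2,14,429083),(4,14,429083)] [100000,0,0] [0,0,0,0] 0 100000 [(6,11950069)] [(6,429082),(10,11620986),(12,858165)])))

def ini34 : List Vtx := [([1, 0, 0], [0, 0, 0, 0]), ([1, 1, 0], [0, 0, 0, 0]), ([1, 1, 1], [0, 0, 0, 0]), ([0, 0, 0], [1, 0, 0, 0]), ([0, 0, 0], [1, 1, 0, 0]), ([0, 0, 0], [1, 1, 1, 0]), ([0, 0, 0], [1, 1, 1, 1])]

theorem ok34 : check 3 4 tr34 ini34 = true := by decide +kernel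

end Cert

namespace Cert

lemma shape22 (aG aH : List ℝ) (x0 x1 y0 y1 : ℝ)
    (hx0 : x1 ≤ x0) (hx : 0 ≤ x1) (hy0 : y1 ≤ y0) (hy : 0 ≤ y1)
    (hs : x0 + x1 + y0 + y1 ≤ 1)
    (hb : Bad 2 2 aG aH [x0, x1] [y0, y1]) : False := by
  obtain ⟨s, hs'⟩ : ∃ s, s = 1 - (x0 + x1 + y0 + y1) := ⟨_, rfl⟩
  have hs0 : 0 ≤ s := by linarith
  apply check_sound hb tr22 ini22 (fun n => [x0 - x1 + (1 - (x0 + x1 + y0 + y1)), x1, y0 - y1, y1].getD n 0) _ ok22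
  refine ⟨?_, ?_, ?_, ?_⟩
  · intro n
    rcases n with _ | _ | _ | _ | _ <;> simp <;> linarith
  · simp [ini22, ev, sig, sumN]
    ring
  · intro m
    have hb : (0 : ℝ) ≤ ((m % 2 : ℕ) : ℝ) := Nat.cast_nonneg _
    have hsb := mul_nonneg hs0 hb
    simp only [ini22, ev, sel, selN, List.getD_cons_zero, List.getD_cons_succ]
    rw [← hs']
    push_cast at hsb ⊢
    nlinarith [hsb]
  · intro m
    simp only [ini22, ev, sel, selN, List.getD_cons_zero, List.getD_cons_succ]
    push_cast
    apply le_of_eq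
    ring

lemma shape23 (aG aH : List ℝ) (x0 x1 y0 y1 y2 : ℝ)
    (hx0 : x1 ≤ x0) (hx : 0 ≤ x1) (hy0 : y1 ≤ y0) (hy1 : y2 ≤ y1) (hy : 0 ≤ y2)
    (hs : x0 + x1 + y0 + y1 + y2 ≤ 1)
    (hb : Bad 2 3 aG aH [x0, x1] [y0, y1, y2]) : False := by
  obtain ⟨s, hs'⟩ : ∃ s, s = 1 - (x0 + x1 + y0 + y1 + y2) := ⟨_, rfl⟩
  have hs0 : 0 ≤ s := by linarith
  apply check_sound hb tr23 ini23 (fun n => [x0 - x1 + (1 - (x0 + x1 + y0 + y1 + y2)), x1, y0 - y1, y1 - y2, y2].getD n 0) _ ok23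
  refine ⟨?_, ?_, ?_, ?_⟩
  · intro n
    rcases n with _ | _ | _ | _ | _ | _ <;> simp <;> linarith
  · simp [ini23, ev, sig, sumN]
    ring
  · intro m
    have hb : (0 : ℝ) ≤ ((m % 2 : ℕ) : ℝ) := Nat.cast_nonneg _
    have hsb := mul_nonneg hs0 hb
    simp only [ini23, ev, sel, selN, List.getD_cons_zero, List.getD_cons_succ]
    rw [← hs']
    push_cast at hsb ⊢
    nlinarith [hsb]
  · intro m
    simp only [ini23, ev, sel, selN, List.getD_cons_zero, List.getD_cons_succ]
    push_cast
    apply le_of_eq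
    ring

lemma shape24 (aG aH : List ℝ) (x0 x1 y0 y1 y2 y3 : ℝ)
    (hx0 : x1 ≤ x0) (hx : 0 ≤ x1) (hy0 : y1 ≤ y0) (hy1 : y2 ≤ y1) (hy2 : y3 ≤ y2) (hy : 0 ≤ y3)
    (hs : x0 + x1 + y0 + y1 + y2 + y3 ≤ 1)
    (hb : Bad 2 4 aG aH [x0, x1] [y0, y1, y2, y3]) : False := by
  obtain ⟨s, hs'⟩ : ∃ s, s = 1 - (x0 + x1 + y0 + y1 + y2 + y3) := ⟨_, rfl⟩
  have hs0 : 0 ≤ s := by linarith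
  apply check_sound hb tr24 ini24 (fun n => [x0 - x1 + (1 - (x0 + x1 + y0 + y1 + y2 + y3)), x1, y0 - y1, y1 - y2, y2 - y3, y3].getD n 0) _ ok24
  refine ⟨?_, ?_, ?_, ?_⟩
  · intro n
    rcases n with _ | _ | _ | _ | _ | _ | _ <;> simp <;> linarith
  · simp [ini24, ev, sig, sumN]
    ring
  · intro m
    have hb : (0 : ℝ) ≤ ((m % 2 : ℕ) : ℝ) := Nat.cast_nonneg _
    have hsb := mul_nonneg hs0 hb
    simp only [ini24, ev, sel, selN, List.getD_cons_zero, List.getD_cons_succ]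
    rw [← hs']
    push_cast at hsb ⊢
    nlinarith [hsb]
  · intro m
    simp only [ini24, ev, sel, selN, List.getD_cons_zero, List.getD_cons_succ]
    push_cast
    apply le_of_eq
    ring

lemma shape33 (aG aH : List ℝ) (x0 x1 x2 y0 y1 y2 : ℝ)
    (hx0 : x1 ≤ x0) (hx1 : x2 ≤ x1) (hx : 0 ≤ x2) (hy0 : y1 ≤ y0) (hy1 : y2 ≤ y1) (hy : 0 ≤ y2)
    (hs : x0 + x1 + x2 + y0 + y1 + y2 ≤ 1)
    (hb : Bad 3 3 aG aH [x0, x1, x2] [y0, y1, y2]) : False := by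
  obtain ⟨s, hs'⟩ : ∃ s, s = 1 - (x0 + x1 + x2 + y0 + y1 + y2) := ⟨_, rfl⟩
  have hs0 : 0 ≤ s := by linarith
  apply check_sound hb tr33 ini33 (fun n => [x0 - x1 + (1 - (x0 + x1 + x2 + y0 + y1 + y2)), x1 - x2, x2, y0 - y1, y1 - y2, y2].getD n 0) _ ok33
  refine ⟨?_, ?_, ?_, ?_⟩
  · intro n
    rcases n with _ | _ | _ | _ | _ | _ | _ <;> simp <;> linarith
  · simp [ini33, ev, sig, sumN]
    ring
  · intro m
    have hb : (0 : ℝ) ≤ ((m % 2 : ℕ) : ℝ) := Nat.cast_nonneg _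
    have hsb := mul_nonneg hs0 hb
    simp only [ini33, ev, sel, selN, List.getD_cons_zero, List.getD_cons_succ]
    rw [← hs']
    push_cast at hsb ⊢
    nlinarith [hsb]
  · intro m
    simp only [ini33, ev, sel, selN, List.getD_cons_zero, List.getD_cons_succ]
    push_cast
    apply le_of_eq
    ring

lemma shape34 (aG aH : List ℝ) (x0 x1 x2 y0 y1 y2 y3 : ℝ)
    (hx0 : x1 ≤ x0) (hx1 : x2 ≤ x1) (hx : 0 ≤ x2) (hy0 : y1 ≤ y0) (hy1 : y2 ≤ y1) (hy2 : y3 ≤ y2) (hy : 0 ≤ y3)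
    (hs : x0 + x1 + x2 + y0 + y1 + y2 + y3 ≤ 1)
    (hb : Bad 3 4 aG aH [x0, x1, x2] [y0, y1, y2, y3]) : False := by
  obtain ⟨s, hs'⟩ : ∃ s, s = 1 - (x0 + x1 + x2 + y0 + y1 + y2 + y3) := ⟨_, rfl⟩
  have hs0 : 0 ≤ s := by linarith
  apply check_sound hb tr34 ini34 (fun n => [x0 - x1 + (1 - (x0 + x1 + x2 + y0 + y1 + y2 + y3)), x1 - x2, x2, y0 - y1, y1 - y2, y2 - y3, y3].getD n 0) _ ok34
  refine ⟨?_, ?_, ?_, ?_⟩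
  · intro n
    rcases n with _ | _ | _ | _ | _ | _ | _ | _ <;> simp <;> linarith
  · simp [ini34, ev, sig, sumN]
    ring
  · intro m
    have hb : (0 : ℝ) ≤ ((m % 2 : ℕ) : ℝ) := Nat.cast_nonneg _
    have hsb := mul_nonneg hs0 hb
    simp only [ini34, ev, sel, selN, List.getD_cons_zero, List.getD_cons_succ]
    rw [← hs']
    push_cast at hsb ⊢
    nlinarith [hsb]
  · intro m
    simp only [ini34, ev, sel, selN, List.getD_cons_zero, List.getD_cons_succ]
    push_cast
    apply le_of_eq
    ring

end Cert

namespace Cert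

lemma pairs_of_pairwise (c : ℝ) (a : List ℝ) (hl : a.length ≤ 4)
    (h : a.Pairwise (fun x y => c ≤ x + y)) :
    ∀ m ∈ [3, 5, 6, 9, 10, 12], m < 2 ^ a.length → c ≤ sel a m := by
  match a, hl, h with
  | [], _, _ => simp
  | [x], _, _ => simp
  | [x, y], _, h => 
    simp at h
    simp [sel]; assumption
  | [x, y, z], _, h => 
    simp at h
    simp [sel]; tauto
  | [x, y, z, t], _, h => 
    simp at h
    simp [sel]; tauto

lemma len_le_four (a : List ℝ) (h0 : ∀ x ∈ a, 0 ≤ x)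
    (h : a.Pairwise (fun x y => 27501 / 100000 ≤ x + y)) (hs : a.sum ≤ 63 / 100) :
    a.length ≤ 4 := by
  match a, h0, h, hs with
  | [], _, _, _ => simp
  | [x], _, _, _ => simp
  | [x, y], _, _, _ => simp
  | [x, y, z], _, _, _ => simp
  | [x, y, z, t], _, _, _ => simp
  | x :: y :: z :: t :: u :: l, h0, h, hs =>
    exfalso
    have : 0 ≤ l.sum := List.sum_nonneg (fun x hx => h0 x (by simp [hx]))
    simp only [List.pairwise_cons, List.mem_cons, forall_eq_or_imp, List.sum_cons] at h hs
    obtain ⟨⟨h1, h2, h3, h4, _⟩, ⟨h5, h6, h7, _⟩, ⟨h8, h9, _⟩, ⟨h10, _⟩, _⟩ := h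
    linarith

lemma two_le_len (a : List ℝ) (h0 : ∀ x ∈ a, x < 27501 / 100000) (hs : 37 / 100 < a.sum) :
    2 ≤ a.length := by
  match a, h0, hs with
  | [], _, hs => simp at hs; linarith
  | [x], h0, hs => simp at h0 hs; linarith
  | x :: y :: l, _, _ => simp

lemma four_sum (a : List ℝ) (h : a.Pairwise (fun x y => 27501 / 100000 ≤ x + y))
    (hl : a.length = 4) : 55002 / 100000 ≤ a.sum := by
  match a, hl, h with
  | [x, y, z, t], _, h =>
    simp at h
    simp
    obtain ⟨⟨h1, h2, h3⟩, ⟨h4, h5⟩, h6⟩ := h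
    linarith

lemma Bad.symm {p q : ℕ} {aG aH tG tH : List ℝ} (h : Bad p q aG aH tG tH) :
    Bad q p aH aG tH tG where
  lg := h.lh
  lh := h.lg
  tot := by linarith [h.tot]
  cg := h.ch
  ch := h.cg
  ng := h.nh
  nh := h.ng
  pg := h.ph
  ph := h.pg
  bad := by
    intro g k
    have := h.bad k g
    rw [add_comm, mul_right_comm]
    exact this

lemma noBad_aux (p q : ℕ) (aG aH tG tH : List ℝ) (hb : Bad p q aG aH tG tH)
    (hG : tG.length = p) (hH : tH.length = q) (sG : tG.Pairwise (fun x y => y ≤ x))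
    (sH : tH.Pairwise (fun x y => y ≤ x)) (nG : ∀ x ∈ tG, 0 ≤ x) (nH : ∀ x ∈ tH, 0 ≤ x)
    (hs : tG.sum + tH.sum ≤ 1) (hp : 2 ≤ p) (hpq : p ≤ q) (hq : q ≤ 4) (h7 : p + q < 8) :
    False := by
  have hp' : p ≤ 3 := by omega
  interval_cases p <;> interval_cases q
  · match tG, hG, tH, hH with
    | [x0, x1], _, [y0, y1], _ =>
      simp at sG sH nG nH hs
      exact shape22 aG aH x0 x1 y0 y1 (by tauto) (by tauto) (by tauto) (by tauto) (by linarith) hb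
  · match tG, hG, tH, hH with
    | [x0, x1], _, [y0, y1, y2], _ =>
      simp at sG sH nG nH hs
      exact shape23 aG aH x0 x1 y0 y1 y2 (by tauto) (by tauto) (by tauto) (by tauto) (by tauto)
        (by linarith) hb
  · match tG, hG, tH, hH with
    | [x0, x1], _, [y0, y1, y2, y3], _ =>
      simp at sG sH nG nH hs
      exact shape24 aG aH x0 x1 y0 y1 y2 y3 (by tauto) (by tauto) (by tauto) (by tauto) (by tauto)
        (by tauto) (by linarith) hb
  · match tG, hG, tH, hH with
    | [x0, x1, x2], _, [y0, y1, y2], _ =>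
      simp at sG sH nG nH hs
      exact shape33 aG aH x0 x1 x2 y0 y1 y2 (by tauto) (by tauto) (by tauto) (by tauto) (by tauto)
        (by tauto) (by linarith) hb
  · match tG, hG, tH, hH with
    | [x0, x1, x2], _, [y0, y1, y2, y3], _ =>
      simp at sG sH nG nH hs
      exact shape34 aG aH x0 x1 x2 y0 y1 y2 y3 (by tauto) (by tauto) (by tauto) (by tauto)
        (by tauto) (by tauto) (by tauto) (by linarith) hb

/-- Block lemma. -/
lemma block (aG aH tG tH : List ℝ) (lG : tG.length = aG.length) (lH : tH.length = aH.length)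
    (tot : aG.sum + aH.sum = 1) (cG : aG.sum < 63 / 100) (cH : aH.sum < 63 / 100)
    (nG : ∀ x ∈ aG, 0 ≤ x ∧ x < 27501 / 100000) (nH : ∀ x ∈ aH, 0 ≤ x ∧ x < 27501 / 100000)
    (pG : aG.Pairwise (fun x y => 27501 / 100000 ≤ x + y))
    (pH : aH.Pairwise (fun x y => 27501 / 100000 ≤ x + y))
    (sG : tG.Pairwise (fun x y => y ≤ x))
    (sH : tH.Pairwise (fun x y => y ≤ x)) (tnG : ∀ x ∈ tG, 0 ≤ x) (tnH : ∀ x ∈ tH, 0 ≤ x)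
    (hs : tG.sum + tH.sum ≤ 1) :
    ∃ g h : ℕ, 27501 / 100000 <
      min (sel aG g + sel aH h) (63 / 100) * (1 - sel tG g) * (1 - sel tH h) := by
  by_contra hcon
  push Not at hcon
  have l4G := len_le_four aG (fun x hx => (nG x hx).1) pG cG.le
  have l4H := len_le_four aH (fun x hx => (nH x hx).1) pH cH.le
  have l2G := two_le_len aG (fun x hx => (nG x hx).2) (by linarith)
  have l2H := two_le_len aH (fun x hx => (nH x hx).2) (by linarith)
  have h8 : aG.length + aH.length < 8 := by
    by_contra h8
    have h1 := four_sum aG pG (by omega)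
    have h2 := four_sum aH pH (by omega)
    linarith
  have hb : Bad aG.length aH.length aG aH tG tH :=
    { lg := rfl
      lh := rfl
      tot := tot.ge
      cg := cG.le
      ch := cH.le
      ng := fun x hx => ⟨(nG x hx).1, (nG x hx).2.le⟩
      nh := fun x hx => ⟨(nH x hx).1, (nH x hx).2.le⟩
      pg := pairs_of_pairwise _ aG l4G pG
      ph := pairs_of_pairwise _ aH l4H pH
      bad := hcon }
  rcases le_total aG.length aH.length with h | h
  · exact noBad_aux _ _ aG aH tG tH hb lG lH sG sH tnG tnH hs l2G h l4H h8
  · exact noBad_aux _ _ aH aG tH tG hb.symm lH lG sH sG tnH tnG (by linarith) l2H h l4G (by omega)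

variable {ι : Type} [DecidableEq ι]

lemma part_sum (f : ι → ℝ) (L : List (Finset ι)) (hL : L.Pairwise Disjoint) (U : Finset ι)
    (hU : ∀ e, e ∈ U ↔ ∃ Y ∈ L, e ∈ Y) :
    (L.map (fun Y => ∑ e ∈ Y, f e)).sum = ∑ e ∈ U, f e := by
  induction L generalizing U with
  | nil =>
    have : U = ∅ := by ext e; simp [hU]
    simp [this]
  | cons X L ih =>
    rw [List.pairwise_cons] at hL
    have hX : X ⊆ U := fun e he => (hU e).2 ⟨X, by simp, he⟩
    rw [List.map_cons, List.sum_cons, ih hL.2 (U \ X), add_comm, Finset.sum_sdiff hX]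
    intro e
    rw [Finset.mem_sdiff, hU]
    constructor
    · rintro ⟨⟨Y, hY, he⟩, hn⟩
      rcases List.mem_cons.1 hY with rfl | hY
      · exact absurd he hn
      · exact ⟨Y, hY, he⟩
    · rintro ⟨Y, hY, he⟩
      exact ⟨⟨Y, by simp [hY], he⟩, fun hx =>
        (Finset.disjoint_left.1 (hL.1 Y hY)) hx he⟩

lemma merge (c : ℝ) (f : ι → ℝ) (n : ℕ) : ∀ L : List (Finset ι), L.length ≤ n →
    L.Pairwise Disjoint → (∀ Y ∈ L, ∑ e ∈ Y, f e < c) →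
    ∃ L' : List (Finset ι), L'.length ≤ L.length ∧ L'.Pairwise Disjoint ∧
      (∀ Y ∈ L', ∑ e ∈ Y, f e < c) ∧ (∀ e, (∃ Y ∈ L', e ∈ Y) ↔ ∃ Y ∈ L, e ∈ Y) ∧
      L'.Pairwise (fun X Y => c ≤ ∑ e ∈ X, f e + ∑ e ∈ Y, f e) := by
  induction n with
  | zero =>
    intro L hl h1 h2
    have : L = [] := List.length_eq_zero_iff.1 (by omega)
    subst this
    exact ⟨[], by simp⟩
  | succ n ih =>
    intro L hl h1 h2
    cases L with
    | nil => exact ⟨[], by simp⟩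
    | cons X L =>
      rw [List.pairwise_cons] at h1
      obtain ⟨L1, k1, k2, k3, k4, k5⟩ := ih L (by simpa using hl) h1.2
        (fun Y hY => h2 Y (by simp [hY]))
      have hdis : ∀ Y ∈ L1, Disjoint X Y := by
        intro Y hY
        rw [Finset.disjoint_left]
        intro e hx he
        obtain ⟨Z, hZ, hz⟩ := (k4 e).1 ⟨Y, hY, he⟩
        exact Finset.disjoint_left.1 (h1.1 Z hZ) hx hz
      by_cases hall : ∀ Y ∈ L1, c ≤ ∑ e ∈ X, f e + ∑ e ∈ Y, f e
      · refine ⟨X :: L1, by simpa using k1, List.pairwise_cons.2 ⟨hdis, k2⟩, ?_, ?_,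
          List.pairwise_cons.2 ⟨hall, k5⟩⟩
        · intro Y hY
          rcases List.mem_cons.1 hY with rfl | hY
          · exact h2 _ (by simp)
          · exact k3 Y hY
        · intro e
          simp only [List.mem_cons, exists_eq_or_imp, k4]
      · push Not at hall
        obtain ⟨Y, hY, hlt⟩ := hall
        have hperm : L1.Perm (Y :: L1.erase Y) := List.perm_cons_erase hY
        have k2' : (Y :: L1.erase Y).Pairwise Disjoint :=
          (hperm.pairwise_iff (fun h => h.symm)).1 k2
        rw [List.pairwise_cons] at k2'
        have hlen : (L1.erase Y).length + 1 = L1.length := by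
          rw [hperm.length_eq]; simp
        obtain ⟨L2, m1, m2, m3, m4, m5⟩ := ih ((X ∪ Y) :: L1.erase Y)
          (by simp only [List.length_cons] at hl ⊢; omega)
          (List.pairwise_cons.2 ⟨fun Z hZ => Finset.disjoint_union_left.2
            ⟨hdis Z (List.mem_of_mem_erase hZ), k2'.1 Z hZ⟩, k2'.2⟩)
          (by
            intro Z hZ
            rcases List.mem_cons.1 hZ with rfl | hZ
            · rw [Finset.sum_union (hdis Y hY)]; exact hlt
            · exact k3 Z (List.mem_of_mem_erase hZ))
        refine ⟨L2, ?_, m2, m3, ?_, m5⟩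
        · simp only [List.length_cons] at m1 ⊢; omega
        · intro e
          rw [m4]
          have : (∃ Z ∈ L1, e ∈ Z) ↔ ∃ Z ∈ (Y :: L1.erase Y), e ∈ Z := by
            simp only [hperm.mem_iff]
          simp only [List.mem_cons, exists_eq_or_imp, Finset.mem_union] at this ⊢
          rw [← k4, this]
          tauto

def selF : List (Finset ι) → ℕ → Finset ι
  | [], _ => ∅
  | X :: L, m => (if m % 2 = 1 then X else ∅) ∪ selF L (m / 2)

lemma mem_selF (L : List (Finset ι)) (m : ℕ) (e : ι) (h : e ∈ selF L m) : ∃ Y ∈ L, e ∈ Y := by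
  induction L generalizing m with
  | nil => simp [selF] at h
  | cons X L ih =>
    simp only [selF, Finset.mem_union] at h
    rcases h with h | h
    · split_ifs at h
      · exact ⟨X, by simp, h⟩
      · simp at h
    · obtain ⟨Y, hY, he⟩ := ih _ h
      exact ⟨Y, by simp [hY], he⟩

lemma sum_selF (f : ι → ℝ) (L : List (Finset ι)) (hL : L.Pairwise Disjoint) (m : ℕ) :
    ∑ e ∈ selF L m, f e = sel (L.map (fun Y => ∑ e ∈ Y, f e)) m := by
  induction L generalizing m with
  | nil => simp [selF, sel]
  | cons X L ih =>
    rw [List.pairwise_cons] at hL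
    simp only [selF, List.map_cons, sel]
    rw [Finset.sum_union, ih hL.2]
    · rcases Nat.mod_two_eq_zero_or_one m with h | h <;> simp [h]
    · rw [Finset.disjoint_left]
      intro e he h2
      obtain ⟨Y, hY, hy⟩ := mem_selF _ _ _ h2
      split_ifs at he
      · exact Finset.disjoint_left.1 (hL.1 Y hY) he hy
      · simp at he

/-- Merge items of a group into blocks sorted by loss. -/
lemma blocks (f t : ι → ℝ) (G : Finset ι) (hf : ∀ e ∈ G, f e < 27501 / 100000) :
    ∃ L : List (Finset ι), L.Pairwise Disjoint ∧ (∀ Y ∈ L, Y ⊆ G) ∧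
      (∀ Y ∈ L, ∑ e ∈ Y, f e < 27501 / 100000) ∧
      (L.map (fun Y => ∑ e ∈ Y, f e)).sum = ∑ e ∈ G, f e ∧
      (L.map (fun Y => ∑ e ∈ Y, t e)).sum = ∑ e ∈ G, t e ∧
      (L.map (fun Y => ∑ e ∈ Y, f e)).Pairwise (fun x y => 27501 / 100000 ≤ x + y) ∧
      (L.map (fun Y => ∑ e ∈ Y, t e)).Pairwise (fun x y => y ≤ x) := by
  obtain ⟨L, h1, h2, h3, h4, h5⟩ := merge (27501 / 100000) f _
    (G.toList.map (fun e => ({e} : Finset ι))) le_rfl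
    (by
      rw [List.pairwise_map]
      exact G.nodup_toList.imp (by simp))
    (by simpa using hf)
  have hp := List.perm_insertionSort (fun X Y : Finset ι => ∑ e ∈ Y, t e ≤ ∑ e ∈ X, t e) L
  have hsort : (L.insertionSort (fun X Y : Finset ι => ∑ e ∈ Y, t e ≤ ∑ e ∈ X, t e)).Pairwise
      (fun X Y : Finset ι => ∑ e ∈ Y, t e ≤ ∑ e ∈ X, t e) := by
    have : Std.Total (fun X Y : Finset ι => ∑ e ∈ Y, t e ≤ ∑ e ∈ X, t e) :=
      ⟨fun X Y => le_total _ _⟩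
    have : IsTrans (Finset ι) (fun X Y : Finset ι => ∑ e ∈ Y, t e ≤ ∑ e ∈ X, t e) :=
      ⟨fun X Y Z h1 h2 => le_trans h2 h1⟩
    exact List.pairwise_insertionSort _ _
  generalize L.insertionSort (fun X Y : Finset ι => ∑ e ∈ Y, t e ≤ ∑ e ∈ X, t e) = L' at hp hsort
  have hmem : ∀ e, e ∈ G ↔ ∃ Y ∈ L', e ∈ Y := by
    intro e
    simp only [hp.mem_iff]
    rw [h4]
    simp
  have hd : L'.Pairwise Disjoint := (hp.pairwise_iff (fun h => h.symm)).2 h2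
  refine ⟨L', hd, ?_, ?_, part_sum f L' hd G hmem, part_sum t L' hd G hmem, ?_, ?_⟩
  · intro Y hY e he
    exact (hmem e).2 ⟨Y, hY, he⟩
  · intro Y hY
    exact h3 Y (hp.mem_iff.1 hY)
  · rw [List.pairwise_map]
    refine (hp.pairwise_iff ?_).2 h5
    intro X Y h
    linarith
  · rw [List.pairwise_map]
    exact hsort

/-- Two-group lemma. -/
lemma two_group (f t : ι → ℝ) (G H : Finset ι)
    (f0 : ∀ e ∈ G ∪ H, 0 ≤ f e) (t0 : ∀ e ∈ G ∪ H, 0 ≤ t e)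
    (hf : ∀ e ∈ G ∪ H, f e < 27501 / 100000)
    (tot : ∑ e ∈ G, f e + ∑ e ∈ H, f e = 1)
    (cG : ∑ e ∈ G, f e < 63 / 100) (cH : ∑ e ∈ H, f e < 63 / 100)
    (ht : ∑ e ∈ G, t e + ∑ e ∈ H, t e ≤ 1) :
    ∃ R S, R ⊆ G ∧ S ⊆ H ∧ 27501 / 100000 <
      min (∑ e ∈ R, f e + ∑ e ∈ S, f e) (63 / 100) * (1 - ∑ e ∈ R, t e) * (1 - ∑ e ∈ S, t e) := by
  obtain ⟨L, a1, a2, a3, a4, a5, a6, a7⟩ := blocks f t G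
    (fun e he => hf e (Finset.mem_union_left _ he))
  obtain ⟨K, b1, b2, b3, b4, b5, b6, b7⟩ := blocks f t H
    (fun e he => hf e (Finset.mem_union_right _ he))
  obtain ⟨g, h, hgh⟩ := block (L.map (fun Y => ∑ e ∈ Y, f e)) (K.map (fun Y => ∑ e ∈ Y, f e))
    (L.map (fun Y => ∑ e ∈ Y, t e)) (K.map (fun Y => ∑ e ∈ Y, t e)) (by simp) (by simp)
    (by rw [a4, b4, tot]) (by rw [a4]; exact cG) (by rw [b4]; exact cH)
    (by
      intro x hx
      obtain ⟨Y, hY, rfl⟩ := List.mem_map.1 hx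
      exact ⟨Finset.sum_nonneg (fun e he => f0 e (Finset.mem_union_left _ (a2 Y hY he))), a3 Y hY⟩)
    (by
      intro x hx
      obtain ⟨Y, hY, rfl⟩ := List.mem_map.1 hx
      exact ⟨Finset.sum_nonneg (fun e he => f0 e (Finset.mem_union_right _ (b2 Y hY he))), b3 Y hY⟩)
    a6 b6 a7 b7
    (by
      intro x hx
      obtain ⟨Y, hY, rfl⟩ := List.mem_map.1 hx
      exact Finset.sum_nonneg (fun e he => t0 e (Finset.mem_union_left _ (a2 Y hY he))))
    (by
      intro x hx
      obtain ⟨Y, hY, rfl⟩ := List.mem_map.1 hx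
      exact Finset.sum_nonneg (fun e he => t0 e (Finset.mem_union_right _ (b2 Y hY he))))
    (by rw [a5, b5]; exact ht)
  refine ⟨selF L g, selF K h, ?_, ?_, ?_⟩
  · intro e he
    obtain ⟨Y, hY, h⟩ := mem_selF _ _ _ he
    exact a2 Y hY h
  · intro e he
    obtain ⟨Y, hY, h⟩ := mem_selF _ _ _ he
    exact b2 Y hY h
  · rw [sum_selF f L a1, sum_selF f K b1, sum_selF t L a1, sum_selF t K b1]
    exact hgh

end Cert

namespace Cert

variable {ι : Type} [DecidableEq ι] {κ : Type} [DecidableEq κ]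

lemma prod_ge_one_sub_sum (K : Finset κ) (x : κ → ℝ) (h0 : ∀ k ∈ K, 0 ≤ x k)
    (h1 : ∀ k ∈ K, x k ≤ 1) : 1 - ∑ k ∈ K, x k ≤ ∏ k ∈ K, (1 - x k) := by
  induction K using Finset.induction_on with
  | empty => simp
  | insert a K ha ih =>
    rw [Finset.sum_insert ha, Finset.prod_insert ha]
    have i := ih (fun k hk => h0 k (by simp [hk])) (fun k hk => h1 k (by simp [hk]))
    have a0 := h0 a (by simp)
    have a1 := h1 a (by simp)
    have p1 : ∏ k ∈ K, (1 - x k) ≤ 1 := Finset.prod_le_one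
      (fun k hk => by linarith [h1 k (by simp [hk])]) (fun k hk => by linarith [h0 k (by simp [hk])])
    nlinarith

lemma grp (t : ι → ℝ) (o : ι → κ) (K K1 K2 : Finset κ) (hK : K1 ∪ K2 = K) (hd : Disjoint K1 K2)
    (T : Finset ι) (t0 : ∀ e ∈ T, 0 ≤ t e) (t1 : ∑ e ∈ T, t e ≤ 1) :
    (1 - ∑ e ∈ T with o e ∈ K1, t e) * (1 - ∑ e ∈ T with o e ∈ K2, t e) ≤
      ∏ k ∈ K, (1 - ∑ e ∈ T with o e = k, t e) := by
  have sub1 : ∀ p : ι → Prop, ∀ _ : DecidablePred p, ∑ e ∈ T with p e, t e ≤ 1 := by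
    intro p _
    refine le_trans ?_ t1
    exact Finset.sum_le_sum_of_subset_of_nonneg (Finset.filter_subset _ _) (fun e he _ => t0 e he)
  have sub0 : ∀ p : ι → Prop, ∀ _ : DecidablePred p, 0 ≤ ∑ e ∈ T with p e, t e := by
    intro p _
    exact Finset.sum_nonneg (fun e he => t0 e (Finset.mem_filter.1 he).1)
  have key : ∀ J : Finset κ, 1 - ∑ e ∈ T with o e ∈ J, t e ≤
      ∏ k ∈ J, (1 - ∑ e ∈ T with o e = k, t e) := by
    intro J
    have h := prod_ge_one_sub_sum J (fun k => ∑ e ∈ T with o e = k, t e)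
      (fun k _ => sub0 _ _) (fun k _ => sub1 _ _)
    have e : ∑ k ∈ J, ∑ e ∈ T with o e = k, t e = ∑ e ∈ T with o e ∈ J, t e := by
      rw [← Finset.sum_fiberwise_of_maps_to (s := T.filter (fun e => o e ∈ J)) (t := J) (g := o)
        (fun e he => (Finset.mem_filter.1 he).2)]
      apply Finset.sum_congr rfl
      intro k hk
      apply Finset.sum_congr _ (fun _ _ => rfl)
      ext e
      simp only [Finset.mem_filter]
      constructor
      · rintro ⟨h1, rfl⟩; exact ⟨⟨h1, hk⟩, rfl⟩
      · rintro ⟨⟨h1, _⟩, h2⟩; exact ⟨h1, h2⟩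
    rw [e] at h
    exact h
  rw [← hK, Finset.prod_union hd]
  apply mul_le_mul (key K1) (key K2)
  · exact sub_nonneg.2 (sub1 _ _)
  · exact Finset.prod_nonneg (fun k _ => sub_nonneg.2 (sub1 _ _))

lemma local_norm (f t : ι → ℝ) (B : Finset ι) (o : ι → κ) (K : Finset κ)
    (ho : ∀ e ∈ B, o e ∈ K) (f0 : ∀ e ∈ B, 0 ≤ f e) (t0 : ∀ e ∈ B, 0 ≤ t e)
    (hf : ∀ e ∈ B, f e < 27501 / 100000) (tot : ∑ e ∈ B, f e = 1) (ht : ∑ e ∈ B, t e ≤ 1) :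
    ∃ T ⊆ B, (∃ k ∈ K, (∀ e ∈ T, o e = k) ∧ 63 / 100 ≤ ∑ e ∈ T, f e) ∨
      27501 / 100000 < min (∑ e ∈ T, f e) (63 / 100) *
        ∏ k ∈ K, (1 - ∑ e ∈ T with o e = k, t e) := by
  by_cases hbig : ∃ k ∈ K, 63 / 100 ≤ ∑ e ∈ B with o e = k, f e
  · obtain ⟨k, hk, h⟩ := hbig
    exact ⟨B.filter (fun e => o e = k), Finset.filter_subset _ _, Or.inl
      ⟨k, hk, fun e he => (Finset.mem_filter.1 he).2, h⟩⟩
  push Not at hbig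
  obtain ⟨w, hw⟩ : ∃ w : Finset κ → ℝ, ∀ S, w S = ∑ e ∈ B with o e ∈ S, f e := ⟨_, fun _ => rfl⟩
  have hwadd : ∀ S R : Finset κ, Disjoint S R → w (S ∪ R) = w S + w R := by
    intro S R hd
    rw [hw, hw, hw, ← Finset.sum_union]
    · congr 1
      ext e
      simp only [Finset.mem_filter, Finset.mem_union]
      tauto
    · rw [Finset.disjoint_left]
      intro e h1 h2
      exact Finset.disjoint_left.1 hd (Finset.mem_filter.1 h1).2 (Finset.mem_filter.1 h2).2
  have hw0 : ∀ S, 0 ≤ w S := by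
    intro S
    rw [hw]
    exact Finset.sum_nonneg (fun e he => f0 e (Finset.mem_filter.1 he).1)
  have hwK : w K = 1 := by
    rw [hw, Finset.filter_true_of_mem ho, tot]
  have hws : ∀ k ∈ K, w {k} < 63 / 100 := by
    intro k hk
    rw [hw]
    simpa using hbig k hk
  have hwe : w ∅ = 0 := by rw [hw]; simp
  have hwc : ∀ S ⊆ K, w (K \ S) = 1 - w S := by
    intro S hS
    have := hwadd S (K \ S) Finset.disjoint_sdiff
    rw [Finset.union_sdiff_of_subset hS, hwK] at this
    linarith
  obtain ⟨x, hx⟩ : ∃ x : Finset κ → ℝ, ∀ S, x S = ∑ e ∈ B with o e ∈ S, t e := ⟨_, fun _ => rfl⟩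
  have hxadd : ∀ S R : Finset κ, Disjoint S R → x (S ∪ R) = x S + x R := by
    intro S R hd
    rw [hx, hx, hx, ← Finset.sum_union]
    · congr 1
      ext e
      simp only [Finset.mem_filter, Finset.mem_union]
      tauto
    · rw [Finset.disjoint_left]
      intro e h1 h2
      exact Finset.disjoint_left.1 hd (Finset.mem_filter.1 h1).2 (Finset.mem_filter.1 h2).2
  have hx0 : ∀ S, 0 ≤ x S := by
    intro S
    rw [hx]
    exact Finset.sum_nonneg (fun e he => t0 e (Finset.mem_filter.1 he).1)
  have hxK : x K ≤ 1 := by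
    rw [hx, Finset.filter_true_of_mem ho]; exact ht
  -- generic finishing step for pairs of groups
  have pairfin : ∀ K1 K2 : Finset κ, K1 ⊆ K → K2 ⊆ K → Disjoint K1 K2 → 63 / 100 ≤ w K1 + w K2 →
      2 * x K1 + x K2 ≤ 1 → x K1 + 2 * x K2 ≤ 1 →
      ∃ T ⊆ B, (∃ k ∈ K, (∀ e ∈ T, o e = k) ∧ 63 / 100 ≤ ∑ e ∈ T, f e) ∨
      27501 / 100000 < min (∑ e ∈ T, f e) (63 / 100) *
        ∏ k ∈ K, (1 - ∑ e ∈ T with o e = k, t e) := by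
    intro K1 K2 h1 h2 hd hc hxa hxb
    have hTB : B.filter (fun e => o e ∈ K1 ∪ K2) ⊆ B := Finset.filter_subset _ _
    refine ⟨B.filter (fun e => o e ∈ K1 ∪ K2), hTB, Or.inr ?_⟩
    have hg := grp t o K K1 (K \ K1) (Finset.union_sdiff_of_subset h1) Finset.disjoint_sdiff
      (B.filter (fun e => o e ∈ K1 ∪ K2)) (fun e he => t0 e (hTB he))
      (le_trans (Finset.sum_le_sum_of_subset_of_nonneg hTB (fun e he _ => t0 e he)) ht)
    have e1 : (B.filter (fun e => o e ∈ K1 ∪ K2)).filter (fun e => o e ∈ K1) =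
        B.filter (fun e => o e ∈ K1) := by
      ext e; simp only [Finset.mem_filter, Finset.mem_union]; tauto
    have e2 : (B.filter (fun e => o e ∈ K1 ∪ K2)).filter (fun e => o e ∈ K \ K1) =
        B.filter (fun e => o e ∈ K2) := by
      ext e
      simp only [Finset.mem_filter, Finset.mem_union, Finset.mem_sdiff]
      constructor
      · tauto
      · rintro ⟨hb, h⟩
        exact ⟨⟨hb, Or.inr h⟩, h2 h, fun h' => Finset.disjoint_left.1 hd h' h⟩
    rw [e1, e2, ← hx, ← hx] at hg
    rw [← hw, hwadd _ _ hd, min_eq_right hc]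
    have a0 := hx0 K1
    have b0 := hx0 K2
    have : 4 / 9 ≤ (1 - x K1) * (1 - x K2) := by
      nlinarith [mul_nonneg (sub_nonneg.2 hxa) (sub_nonneg.2 hxb),
        mul_nonneg (sub_nonneg.2 hxa) a0, mul_nonneg (sub_nonneg.2 hxa) b0,
        mul_nonneg (sub_nonneg.2 hxb) a0, mul_nonneg (sub_nonneg.2 hxb) b0]
    linarith
  obtain ⟨S, hS, hmax⟩ := Finset.exists_max_image (K.powerset.filter (fun S => w S < 63 / 100)) w
    ⟨∅, by simp [hwe]⟩
  simp only [Finset.mem_filter, Finset.mem_powerset] at hS hmax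
  by_cases hcase : 37 / 100 < w S
  · -- two groups
    have hd : Disjoint S (K \ S) := Finset.disjoint_sdiff
    have hB : ∀ J : Finset κ, B.filter (fun e => o e ∈ J) ⊆ B := fun J => Finset.filter_subset _ _
    have hGH : ∀ e ∈ B.filter (fun e => o e ∈ S) ∪ B.filter (fun e => o e ∈ K \ S), e ∈ B := by
      intro e he
      rcases Finset.mem_union.1 he with h | h
      · exact hB _ h
      · exact hB _ h
    have hc := hwc S hS.1
    have hxx := hxadd S (K \ S) hd
    rw [Finset.union_sdiff_of_subset hS.1] at hxx
    obtain ⟨R, Q, hR, hQ, hlt⟩ := two_group f t (B.filter (fun e => o e ∈ S))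
      (B.filter (fun e => o e ∈ K \ S)) (fun e he => f0 e (hGH e he)) (fun e he => t0 e (hGH e he))
      (fun e he => hf e (hGH e he)) (by rw [← hw, ← hw]; linarith) (by rw [← hw]; exact hS.2)
      (by rw [← hw]; linarith) (by rw [← hx, ← hx]; linarith)
    have hRS : ∀ e ∈ R, o e ∈ S := fun e he => (Finset.mem_filter.1 (hR he)).2
    have hQS : ∀ e ∈ Q, o e ∈ K \ S := fun e he => (Finset.mem_filter.1 (hQ he)).2
    have hRQ : Disjoint R Q := by
      rw [Finset.disjoint_left]
      intro e h1 h2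
      exact Finset.disjoint_left.1 hd (hRS e h1) (hQS e h2)
    have hTB : R ∪ Q ⊆ B := Finset.union_subset (hR.trans (hB _)) (hQ.trans (hB _))
    refine ⟨R ∪ Q, hTB, Or.inr ?_⟩
    have hg := grp t o K S (K \ S) (Finset.union_sdiff_of_subset hS.1) hd (R ∪ Q)
      (fun e he => t0 e (hTB he))
      (le_trans (Finset.sum_le_sum_of_subset_of_nonneg hTB (fun e he _ => t0 e he)) ht)
    have e1 : (R ∪ Q).filter (fun e => o e ∈ S) = R := by
      ext e
      simp only [Finset.mem_filter, Finset.mem_union]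
      constructor
      · rintro ⟨h | h, h2⟩
        · exact h
        · exact absurd h2 (Finset.mem_sdiff.1 (hQS e h)).2
      · intro h
        exact ⟨Or.inl h, hRS e h⟩
    have e2 : (R ∪ Q).filter (fun e => o e ∈ K \ S) = Q := by
      ext e
      simp only [Finset.mem_filter, Finset.mem_union]
      constructor
      · rintro ⟨h | h, h2⟩
        · exact absurd (hRS e h) (Finset.mem_sdiff.1 h2).2
        · exact h
      · intro h
        exact ⟨Or.inr h, hQS e h⟩
    rw [e1, e2] at hg
    rw [Finset.sum_union hRQ]
    refine lt_of_lt_of_le hlt ?_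
    rw [mul_assoc]
    apply mul_le_mul_of_nonneg_left hg
    apply le_min _ (by norm_num)
    exact add_nonneg (Finset.sum_nonneg (fun e he => f0 e (hTB (Finset.mem_union_left _ he))))
      (Finset.sum_nonneg (fun e he => f0 e (hTB (Finset.mem_union_right _ he))))
  · push Not at hcase
    have hex : ∃ k ∈ K \ S, 0 < w {k} := by
      by_contra hno
      push Not at hno
      have : w (K \ S) ≤ 0 := by
        have gen : ∀ J : Finset κ, J ⊆ K \ S → w J ≤ 0 := by
          intro J
          induction J using Finset.induction_on with
          | empty => intro _; rw [hwe]
          | insert a J ha ih =>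
            intro hJ
            rw [Finset.insert_eq, hwadd _ _ (by simpa using ha)]
            have h1 := hno a (hJ (by simp))
            have h2 := ih (fun y hy => hJ (by simp [hy]))
            linarith
        exact gen _ subset_rfl
      rw [hwc S hS.1] at this
      linarith
    obtain ⟨k, hk, hk0⟩ := hex
    rw [Finset.mem_sdiff] at hk
    have hdk : Disjoint S {k} := by simpa using hk.2
    have hSk : S ∪ {k} ⊆ K := Finset.union_subset hS.1 (by simpa using hk.1)
    have h1 : 63 / 100 ≤ w (S ∪ {k}) := by
      by_contra hlt
      push Not at hlt
      have := hmax (S ∪ {k}) ⟨hSk, hlt⟩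
      rw [hwadd _ _ hdk] at this
      linarith
    have h2 : w {k} ≤ w S := hmax {k} ⟨by simpa using hk.1, hws k hk.1⟩
    have h3 := hwc (S ∪ {k}) hSk
    rw [hwadd _ _ hdk] at h1 h3
    have hd3 : Disjoint (S ∪ {k}) (K \ (S ∪ {k})) := Finset.disjoint_sdiff
    have hx3 := hxadd (S ∪ {k}) (K \ (S ∪ {k})) hd3
    rw [Finset.union_sdiff_of_subset hSk, hxadd _ _ hdk] at hx3
    rw [Finset.disjoint_union_left] at hd3
    have hkK : ({k} : Finset κ) ⊆ K := by simpa using hk.1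
    have hRK : K \ (S ∪ {k}) ⊆ K := Finset.sdiff_subset
    generalize K \ (S ∪ {k}) = R at *
    have xs := hx0 S
    have xk := hx0 {k}
    have xr := hx0 R
    rcases le_total (x S) (x R) with c1 | c1
    · rcases le_total (x {k}) (x R) with c2 | c2
      · exact pairfin S {k} hS.1 hkK hdk h1 (by linarith) (by linarith)
      · exact pairfin S R hS.1 hRK hd3.1 (by linarith) (by linarith) (by linarith)
    · rcases le_total (x {k}) (x S) with c2 | c2
      · exact pairfin {k} R hkK hRK hd3.2 (by linarith) (by linarith) (by linarith)
      · exact pairfin S R hS.1 hRK hd3.1 (by linarith) (by linarith) (by linarith)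

/-- Local lemma. -/
lemma local_main (f t : ι → ℝ) (B : Finset ι) (o : ι → κ) (K : Finset κ)
    (ho : ∀ e ∈ B, o e ∈ K) (f0 : ∀ e ∈ B, 0 ≤ f e) (t0 : ∀ e ∈ B, 0 ≤ t e)
    (hf : ∀ e ∈ B, f e < 27501 / 100000) (tot : 1 ≤ ∑ e ∈ B, f e) (ht : ∑ e ∈ B, t e ≤ 1) :
    ∃ T ⊆ B, (∃ k ∈ K, (∀ e ∈ T, o e = k) ∧ 63 / 100 ≤ ∑ e ∈ T, f e) ∨
      27501 / 100000 < min (∑ e ∈ T, f e) (63 / 100) *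
        ∏ k ∈ K, (1 - ∑ e ∈ T with o e = k, t e) := by
  obtain ⟨F, hF⟩ : ∃ F, F = ∑ e ∈ B, f e := ⟨_, rfl⟩
  rw [← hF] at tot
  have hF0 : 0 < F := by linarith
  have hle : ∀ e ∈ B, f e / F ≤ f e := fun e he => div_le_self (f0 e he) tot
  obtain ⟨T, hT, h⟩ := local_norm (fun e => f e / F) t B o K ho
    (fun e he => div_nonneg (f0 e he) hF0.le) t0 (fun e he => lt_of_le_of_lt (hle e he) (hf e he))
    (by rw [← Finset.sum_div, ← hF, div_self hF0.ne']) ht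
  have hsum : ∑ e ∈ T, f e / F ≤ ∑ e ∈ T, f e := Finset.sum_le_sum (fun e he => hle e (hT he))
  refine ⟨T, hT, ?_⟩
  rcases h with ⟨k, hk, h1, h2⟩ | h
  · exact Or.inl ⟨k, hk, h1, h2.trans hsum⟩
  · refine Or.inr (lt_of_lt_of_le h ?_)
    apply mul_le_mul_of_nonneg_right (min_le_min_right _ hsum)
    apply Finset.prod_nonneg
    intro k hk
    rw [sub_nonneg]
    refine le_trans ?_ ht
    exact Finset.sum_le_sum_of_subset_of_nonneg ((Finset.filter_subset _ _).trans hT)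
      (fun e he _ => t0 e he)

end Cert

namespace Cert

variable {ι : Type} [DecidableEq ι] {κ : Type} [DecidableEq κ] [Fintype κ]

/-- Supporting additive functions exist at every subset. -/
def Supp (M : Finset ι) (v : Finset ι → ℝ) : Prop :=
  ∀ S ⊆ M, ∃ p : ι → ℝ, (∀ e ∈ M, 0 ≤ p e) ∧ ∑ e ∈ S, p e = v S ∧ ∀ R ⊆ M, ∑ e ∈ R, p e ≤ v R

noncomputable def cl (y : ℝ) : ℝ := min (max y (27501 / 100000)) (63 / 100)

lemma cl_ge (y : ℝ) : 27501 / 100000 ≤ cl y := le_min (le_max_right _ _) (by norm_num)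

lemma cl_le (y : ℝ) : cl y ≤ 63 / 100 := min_le_right _ _

lemma cl_low {y : ℝ} (h : y ≤ 27501 / 100000) : cl y = 27501 / 100000 := by
  unfold cl
  rw [max_eq_right h, min_eq_left (by norm_num)]

lemma min_le_cl {x y : ℝ} (h : x ≤ y) : min x (63 / 100) ≤ cl y :=
  min_le_min_right _ (h.trans (le_max_left _ _))

lemma cl_scale (y z s : ℝ) (h0 : 0 ≤ s) (h1 : s ≤ 1) (hy : 27501 / 100000 < y)
    (hz : y * (1 - s) ≤ z) : cl y * (1 - s) ≤ cl z := by
  have e : cl y = min y (63 / 100) := by unfold cl; rw [max_eq_left hy.le]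
  rw [e]
  refine le_trans ?_ (min_le_cl hz)
  apply le_min
  · exact mul_le_mul_of_nonneg_right (min_le_left _ _) (by linarith)
  · have : min y (63 / 100) ≤ 63 / 100 := min_le_right _ _
    have h3 : 0 ≤ min y (63 / 100) := le_min (by linarith) (by norm_num)
    nlinarith

theorem thmB {γ : Type} (I : Finset κ) (M : Finset ι) (v : κ → Finset ι → ℝ)
    (hv : ∀ k ∈ I, Supp M (v k)) (J : κ → Finset γ) (hJ : ∀ k ∈ I, I.card ≤ (J k).card)
    (B : κ → γ → Finset ι) (hBM : ∀ k ∈ I, ∀ j ∈ J k, B k j ⊆ M)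
    (hBd : ∀ k ∈ I, ∀ j ∈ J k, ∀ j' ∈ J k, j ≠ j' → Disjoint (B k j) (B k j'))
    (hB1 : ∀ k ∈ I, ∀ j ∈ J k, 1 ≤ v k (B k j))
    (hsing : ∀ k ∈ I, ∀ e ∈ M, v k {e} < 27501 / 100000) :
    ∃ A : κ → Finset ι, (∀ k, A k ⊆ M) ∧ (∀ i j, i ≠ j → Disjoint (A i) (A j)) ∧
      ∀ k ∈ I, 27501 / 100000 ≤ v k (A k) := by
  classical
  -- the extremal allocation
  let Al : Finset (κ → Finset ι) := (Fintype.piFinset (fun _ => M.powerset)).filter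
    (fun A => ∀ i j, i ≠ j → Disjoint (A i) (A j))
  have memAl : ∀ A, A ∈ Al ↔ (∀ k, A k ⊆ M) ∧ ∀ i j, i ≠ j → Disjoint (A i) (A j) := by
    intro A
    simp [Al, Fintype.mem_piFinset]
  let Φ : (κ → Finset ι) → ℝ := fun A => ∏ k ∈ I, cl (v k (A k))
  obtain ⟨A0, hA0, hmax0⟩ := Finset.exists_max_image Al Φ
    ⟨fun _ => ∅, (memAl _).2 ⟨fun _ => by simp, fun _ _ _ => by simp⟩⟩
  obtain ⟨A, hA, hmin⟩ := Finset.exists_min_image (Al.filter (fun A => Φ A = Φ A0))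
    (fun A => ∑ k, (A k).card) ⟨A0, by simp [hA0]⟩
  rw [Finset.mem_filter] at hA
  have hmaxA : ∀ A' ∈ Al, Φ A' ≤ Φ A := fun A' h => by rw [hA.2]; exact hmax0 A' h
  have hminA : ∀ A' ∈ Al, Φ A' = Φ A → ∑ k, (A k).card ≤ ∑ k, (A' k).card := fun A' h h' =>
    hmin A' (Finset.mem_filter.2 ⟨h, h'.trans hA.2⟩)
  obtain ⟨hAM, hAd⟩ := (memAl A).1 hA.1
  refine ⟨A, hAM, hAd, ?_⟩
  by_contra hcon
  push Not at hcon
  obtain ⟨i, hi, hlow⟩ := hcon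
  -- supports
  have hsup : ∀ k, ∃ p : ι → ℝ, k ∈ I → (∀ e ∈ M, 0 ≤ p e) ∧ ∑ e ∈ A k, p e = v k (A k) ∧
      ∀ R ⊆ M, ∑ e ∈ R, p e ≤ v k R := by
    intro k
    by_cases hk : k ∈ I
    · obtain ⟨p, hp⟩ := hv k hk (A k) (hAM k)
      exact ⟨p, fun _ => hp⟩
    · exact ⟨0, fun h => absurd h hk⟩
  choose p hp using hsup
  -- owner
  have hown : ∀ e, ∃ k ∈ I, (∀ k' ∈ I, k' ≠ i → e ∈ A k' → k = k') ∧ (k ≠ i → e ∈ A k) := by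
    intro e
    by_cases h : ∃ k ∈ I, k ≠ i ∧ e ∈ A k
    · obtain ⟨k, hk, hki, he⟩ := h
      refine ⟨k, hk, ?_, fun _ => he⟩
      intro k' _ _ he'
      by_contra hne
      exact Finset.disjoint_left.1 (hAd k k' hne) he he'
    · push Not at h
      exact ⟨i, hi, fun k' hk' hne he => absurd he (h k' hk' hne), fun h => absurd rfl h⟩
  choose o hoI ho1 ho2 using hown
  obtain ⟨t, htdef⟩ : ∃ t : ι → ℝ, ∀ e, t e = if o e ≠ i ∧ 27501 / 100000 < v (o e) (A (o e)) then
    p (o e) e / v (o e) (A (o e)) else 0 := ⟨_, fun _ => rfl⟩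
  have ht0 : ∀ e ∈ M, 0 ≤ t e := by
    intro e he
    rw [htdef]
    split_ifs with h
    · exact div_nonneg ((hp _ (hoI e)).1 e he) (by linarith [h.2])
    · exact le_rfl
  -- class sums
  have hclass : ∀ T ⊆ M, ∀ k ∈ I, k ≠ i → 27501 / 100000 < v k (A k) →
      ∑ e ∈ T with o e = k, t e = (∑ e ∈ A k ∩ T, p k e) / v k (A k) := by
    intro T hT k hk hki hy
    have e1 : T.filter (fun e => o e = k) = A k ∩ T := by
      ext e
      simp only [Finset.mem_filter, Finset.mem_inter]
      constructor
      · rintro ⟨h1, h2⟩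
        refine ⟨?_, h1⟩
        have := ho2 e (by rw [h2]; exact hki)
        rwa [h2] at this
      · rintro ⟨h1, h2⟩
        exact ⟨h2, ho1 e k hk hki h1⟩
    rw [Finset.sum_div, ← e1]
    apply Finset.sum_congr rfl
    intro e he
    have := (Finset.mem_filter.1 he).2
    rw [htdef, this, if_pos ⟨hki, hy⟩]
  have hclass0 : ∀ (T : Finset ι) (k : κ), (k = i ∨ v k (A k) ≤ 27501 / 100000) →
      ∑ e ∈ T with o e = k, t e = 0 := by
    intro T k h
    apply Finset.sum_eq_zero
    intro e he
    have := (Finset.mem_filter.1 he).2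
    rw [htdef, this, if_neg]
    rintro ⟨h1, h2⟩
    rcases h with h | h
    · exact h1 h
    · linarith
  have hclassle : ∀ k ∈ I, ∑ e ∈ M with o e = k, t e ≤ if k = i then 0 else 1 := by
    intro k hk
    by_cases hki : k = i
    · rw [hclass0 M k (Or.inl hki), if_pos hki]
    · rw [if_neg hki]
      by_cases hy : 27501 / 100000 < v k (A k)
      · rw [hclass M subset_rfl k hk hki hy, Finset.inter_eq_left.2 (hAM k), (hp k hk).2.1,
          div_self (by linarith)]
      · rw [hclass0 M k (Or.inr (not_lt.1 hy))]
        norm_num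
  have htM : ∑ e ∈ M, t e ≤ (I.card : ℝ) - 1 := by
    rw [← Finset.sum_fiberwise_of_maps_to (s := M) (t := I) (g := o) (fun e _ => hoI e)]
    refine (Finset.sum_le_sum hclassle).trans ?_
    rw [← Finset.add_sum_erase _ _ hi, if_pos rfl, zero_add,
      Finset.sum_congr rfl (g := fun _ => (1 : ℝ)) (fun k hk => if_neg (Finset.ne_of_mem_erase hk))]
    rw [Finset.sum_const, Finset.card_erase_of_mem hi, nsmul_eq_mul, mul_one,
      Nat.cast_sub (Finset.card_pos.2 ⟨i, hi⟩)]
    simp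
  -- choose bundle
  obtain ⟨j, hj, hjt⟩ : ∃ j ∈ J i, ∑ e ∈ B i j, t e < 1 := by
    by_contra hno
    push Not at hno
    have h1 : ((J i).card : ℝ) ≤ ∑ j ∈ J i, ∑ e ∈ B i j, t e := by
      have := Finset.sum_le_sum hno
      simpa using this
    rw [← Finset.sum_biUnion (fun a ha b hb hab => hBd i hi a ha b hb hab)] at h1
    have h2 : ∑ e ∈ (J i).biUnion (B i), t e ≤ ∑ e ∈ M, t e :=
      Finset.sum_le_sum_of_subset_of_nonneg (Finset.biUnion_subset.2 (hBM i hi))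
        (fun e he _ => ht0 e he)
    have h3 : (I.card : ℝ) ≤ (J i).card := by exact_mod_cast hJ i hi
    linarith
  have hBjM := hBM i hi j hj
  obtain ⟨a, ha0, ha1, ha2⟩ := hv i hi (B i j) hBjM
  have haitem : ∀ e ∈ B i j, a e < 27501 / 100000 := by
    intro e he
    have := ha2 {e} (by simpa using hBjM he)
    rw [Finset.sum_singleton] at this
    exact this.trans_lt (hsing i hi e (hBjM he))
  obtain ⟨T, hTB, hT⟩ := local_main a t (B i j) o I (fun e _ => hoI e)
    (fun e he => ha0 e (hBjM he)) (fun e he => ht0 e (hBjM he)) haitem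
    (by rw [ha1]; exact hB1 i hi j hj) hjt.le
  have hTM : T ⊆ M := hTB.trans hBjM
  have htT : ∑ e ∈ T, t e < 1 := lt_of_le_of_lt
    (Finset.sum_le_sum_of_subset_of_nonneg hTB (fun e he _ => ht0 e (hBjM he))) hjt
  have hs0 : ∀ k, 0 ≤ ∑ e ∈ T with o e = k, t e := fun k =>
    Finset.sum_nonneg (fun e he => ht0 e (hTM (Finset.mem_filter.1 he).1))
  have hs1 : ∀ k, ∑ e ∈ T with o e = k, t e ≤ 1 := fun k =>
    (Finset.sum_le_sum_of_subset_of_nonneg (Finset.filter_subset _ _)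
      (fun e he _ => ht0 e (hTM he))).trans htT.le
  have hcl : ∀ k ∈ I, k ≠ i →
      cl (v k (A k)) * (1 - ∑ e ∈ T with o e = k, t e) ≤ cl (v k (A k \ T)) := by
    intro k hk hki
    by_cases hy : 27501 / 100000 < v k (A k)
    · apply cl_scale _ _ _ (hs0 k) (hs1 k) hy
      rw [hclass T hTM k hk hki hy]
      have h1 := (hp k hk).2.2 (A k \ T) (Finset.sdiff_subset.trans (hAM k))
      have h2 := Finset.sum_inter_add_sum_sdiff (A k) T (p k)
      rw [(hp k hk).2.1] at h2
      have hy0 : v k (A k) ≠ 0 := by linarith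
      rw [mul_sub, mul_one, mul_div_cancel₀ _ hy0]
      linarith
    · rw [hclass0 T k (Or.inr (not_lt.1 hy)), cl_low (not_lt.1 hy)]
      have := cl_ge (v k (A k \ T))
      linarith
  -- the main improvement step
  have hii : ¬ (27501 / 100000 < min (∑ e ∈ T, a e) (63 / 100) *
        ∏ k ∈ I, (1 - ∑ e ∈ T with o e = k, t e)) := by
    intro hlt
    let A' : κ → Finset ι := Function.update (fun k => A k \ T) i T
    have hA'i : A' i = T := by simp [A']
    have hA'k : ∀ k, k ≠ i → A' k = A k \ T := fun k hk => by simp [A', hk]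
    have hA' : A' ∈ Al := by
      rw [memAl]
      constructor
      · intro k
        by_cases hk : k = i
        · rw [hk, hA'i]; exact hTM
        · rw [hA'k k hk]; exact Finset.sdiff_subset.trans (hAM k)
      · intro k l hkl
        by_cases hk : k = i
        · subst hk
          rw [hA'i, hA'k l (Ne.symm hkl)]
          exact Finset.disjoint_sdiff
        · by_cases hl : l = i
          · subst hl
            rw [hA'i, hA'k k hkl]
            exact Finset.sdiff_disjoint
          · rw [hA'k k hk, hA'k l hl]
            exact (hAd k l hkl).mono Finset.sdiff_subset Finset.sdiff_subset
    have hle := hmaxA A' hA'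
    simp only [Φ] at hle
    rw [← Finset.mul_prod_erase _ _ hi, ← Finset.mul_prod_erase I (fun k => cl (v k (A k))) hi,
      hA'i, cl_low hlow.le] at hle
    rw [← Finset.mul_prod_erase _ _ hi, hclass0 T i (Or.inl rfl), sub_zero, one_mul] at hlt
    have hpos : 0 < ∏ k ∈ I.erase i, cl (v k (A k)) :=
      Finset.prod_pos (fun k _ => lt_of_lt_of_le (by norm_num) (cl_ge _))
    have h1 : (∏ k ∈ I.erase i, cl (v k (A k))) *
        (∏ k ∈ I.erase i, (1 - ∑ e ∈ T with o e = k, t e)) ≤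
        ∏ k ∈ I.erase i, cl (v k (A' k)) := by
      rw [← Finset.prod_mul_distrib]
      apply Finset.prod_le_prod
      · intro k hk
        exact mul_nonneg (le_trans (by norm_num) (cl_ge _)) (sub_nonneg.2 (hs1 k))
      · intro k hk
        rw [hA'k k (Finset.ne_of_mem_erase hk)]
        exact hcl k (Finset.mem_of_mem_erase hk) (Finset.ne_of_mem_erase hk)
    have h2 : min (∑ e ∈ T, a e) (63 / 100) ≤ cl (v i T) := min_le_cl (ha2 T hTM)
    have h3 : 0 ≤ ∏ k ∈ I.erase i, (1 - ∑ e ∈ T with o e = k, t e) :=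
      Finset.prod_nonneg (fun k _ => sub_nonneg.2 (hs1 k))
    have h4 : (0 : ℝ) ≤ cl (v i T) := le_trans (by norm_num) (cl_ge _)
    have h5 := mul_le_mul_of_nonneg_left h1 h4
    have h6 := mul_le_mul_of_nonneg_right h2 h3
    have h7 := mul_lt_mul_of_pos_right (hlt.trans_le h6) hpos
    nlinarith
  rcases hT with ⟨k, hk, hTk, hTc⟩ | hT
  swap
  · exact hii hT
  by_cases hcase : k = i ∨ v k (A k) ≤ 27501 / 100000
  · apply hii
    rw [min_eq_right hTc, Finset.prod_eq_one]
    · norm_num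
    · intro l hl
      by_cases hlk : l = k
      · rw [hlk, hclass0 T k hcase]; simp
      · have : T.filter (fun e => o e = l) = ∅ := by
          apply Finset.filter_false_of_mem
          intro e he h
          exact hlk (h.symm.trans (hTk e he))
        rw [this]; simp
  push Not at hcase
  obtain ⟨hki, hy⟩ := hcase
  have hTA : T ⊆ A k := by
    intro e he
    have := ho2 e (by rw [hTk e he]; exact hki)
    rwa [hTk e he] at this
  let A' : κ → Finset ι := Function.update (Function.update A i T) k ∅
  have hA'k : A' k = ∅ := by simp [A']
  have hA'i : A' i = T := by simp [A', Ne.symm hki]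
  have hA'o : ∀ l, l ≠ i → l ≠ k → A' l = A l := fun l h1 h2 => by simp [A', h1, h2]
  have hA' : A' ∈ Al := by
    rw [memAl]
    constructor
    · intro l
      by_cases hlk : l = k
      · rw [hlk, hA'k]; simp
      by_cases hli : l = i
      · rw [hli, hA'i]; exact hTM
      rw [hA'o l hli hlk]; exact hAM l
    · intro l m hlm
      by_cases hlk : l = k
      · rw [hlk, hA'k]; simp
      by_cases hmk : m = k
      · rw [hmk, hA'k]; simp
      by_cases hli : l = i
      · have hmi : m ≠ i := fun h => hlm (hli.trans h.symm)
        rw [hli, hA'i, hA'o m hmi hmk]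
        exact (hAd k m (Ne.symm hmk)).mono_left hTA
      by_cases hmi : m = i
      · rw [hmi, hA'i, hA'o l hli hlk]
        exact (hAd l k hlk).mono_right hTA
      rw [hA'o l hli hlk, hA'o m hmi hmk]
      exact hAd l m hlm
  have hk' : k ∈ I.erase i := Finset.mem_erase.2 ⟨hki, hk⟩
  have hΦ : Φ A ≤ Φ A' := by
    simp only [Φ]
    rw [← Finset.mul_prod_erase _ _ hi, ← Finset.mul_prod_erase I (fun k => cl (v k (A' k))) hi,
      ← Finset.mul_prod_erase _ _ hk', ← Finset.mul_prod_erase _ (fun k => cl (v k (A' k))) hk',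
      hA'i, cl_low hlow.le, Finset.prod_congr rfl (g := fun l => cl (v l (A l)))
        (s₁ := (I.erase i).erase k) (f := fun l => cl (v l (A' l)))]
    · have h1 : (63 / 100 : ℝ) ≤ cl (v i T) := by
        have := min_le_cl (hTc.trans (ha2 T hTM))
        rwa [min_self] at this
      have h2 := cl_ge (v k (A' k))
      have h3 := cl_le (v k (A k))
      have hpos : 0 ≤ ∏ l ∈ (I.erase i).erase k, cl (v l (A l)) :=
        Finset.prod_nonneg (fun k _ => le_trans (by norm_num) (cl_ge _))
      rw [← mul_assoc, ← mul_assoc]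
      apply mul_le_mul_of_nonneg_right _ hpos
      nlinarith
    · intro l hl
      rw [hA'o l (Finset.ne_of_mem_erase (Finset.mem_of_mem_erase hl)) (Finset.ne_of_mem_erase hl)]
  have hcard := hminA A' hA' (le_antisymm (hmaxA A' hA') hΦ)
  have hcardT : (A k).card ≤ T.card := by
    have hku : k ∈ (Finset.univ : Finset κ).erase i := Finset.mem_erase.2 ⟨hki, Finset.mem_univ _⟩
    rw [← Finset.add_sum_erase _ _ (Finset.mem_univ i),
      ← Finset.add_sum_erase _ (fun l => (A' l).card) (Finset.mem_univ i),
      ← Finset.add_sum_erase _ _ hku, ← Finset.add_sum_erase _ (fun l => (A' l).card) hku,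
      hA'i, hA'k, Finset.sum_congr rfl (g := fun l => (A l).card)
        (s₁ := ((Finset.univ : Finset κ).erase i).erase k) (f := fun l => (A' l).card)
        (fun l hl => by
          rw [hA'o l (Finset.ne_of_mem_erase (Finset.mem_of_mem_erase hl))
            (Finset.ne_of_mem_erase hl)])] at hcard
    simp only [Finset.card_empty] at hcard
    omega
  have hTeq : T = A k := Finset.eq_of_subset_of_card_le hTA hcardT
  have h1 := hclass T hTM k hk hki hy
  rw [Finset.filter_true_of_mem hTk, ← hTeq, Finset.inter_self, hTeq, (hp k hk).2.1,
    div_self (by linarith), ← hTeq] at h1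
  linarith

end Cert

namespace Cert

variable {ι : Type} [DecidableEq ι] {κ : Type} [DecidableEq κ] [Fintype κ]

lemma Supp.sub {M M' : Finset ι} {v : Finset ι → ℝ} (h : Supp M v) (hM : M' ⊆ M) : Supp M' v := by
  intro S hS
  obtain ⟨p, h1, h2, h3⟩ := h S (hS.trans hM)
  exact ⟨p, fun e he => h1 e (hM he), h2, fun R hR => h3 R (hR.trans hM)⟩

lemma Supp.nonneg {M : Finset ι} {v : Finset ι → ℝ} (h : Supp M v) {S : Finset ι} (hS : S ⊆ M) :
    0 ≤ v S := by
  obtain ⟨p, h1, h2, _⟩ := h S hS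
  rw [← h2]
  exact Finset.sum_nonneg (fun e he => h1 e (hS he))

lemma Supp.mono {M : Finset ι} {v : Finset ι → ℝ} (h : Supp M v) {S R : Finset ι} (hR : R ⊆ M)
    (hSR : S ⊆ R) : v S ≤ v R := by
  obtain ⟨p, h1, h2, h3⟩ := h S (hSR.trans hR)
  rw [← h2]
  exact (Finset.sum_le_sum_of_subset_of_nonneg hSR (fun e he _ => h1 e (hR he))).trans (h3 R hR)

lemma Supp.scale {M : Finset ι} {v : Finset ι → ℝ} (h : Supp M v) (c : ℝ) (hc : 0 < c) :
    Supp M (fun S => v S / c) := by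
  intro S hS
  obtain ⟨p, h1, h2, h3⟩ := h S hS
  refine ⟨fun e => p e / c, fun e he => div_nonneg (h1 e he) hc.le, ?_, fun R hR => ?_⟩
  · rw [← Finset.sum_div, h2]
  · rw [← Finset.sum_div]
    exact div_le_div_of_nonneg_right (h3 R hR) hc.le

lemma supp_of_xos {M : Finset ι} {v : Finset ι → ℝ} (h : IsXOS M v) : Supp M v := by
  obtain ⟨t, a, h0, h1⟩ := h
  intro S hS
  obtain ⟨j, _, hj⟩ := Finset.exists_mem_eq_sup' Finset.univ_nonempty (fun j => ∑ e ∈ S, a j e)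
  refine ⟨a j, h0 j, ?_, ?_⟩
  · rw [h1 S hS, hj]
  · intro R hR
    rw [h1 R hR]
    exact Finset.le_sup' (fun j => ∑ e ∈ R, a j e) (Finset.mem_univ j)

theorem thmA {γ : Type} [DecidableEq γ] (v : κ → Finset ι → ℝ) (B : κ → γ → Finset ι) (n : ℕ) :
    ∀ (I : Finset κ) (M : Finset ι) (J : κ → Finset γ), I.card = n →
    (∀ k ∈ I, Supp M (v k)) → (∀ k ∈ I, I.card ≤ (J k).card) →
    (∀ k ∈ I, ∀ j ∈ J k, B k j ⊆ M) →
    (∀ k ∈ I, ∀ j ∈ J k, ∀ j' ∈ J k, j ≠ j' → Disjoint (B k j) (B k j')) →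
    (∀ k ∈ I, ∀ j ∈ J k, 1 ≤ v k (B k j)) →
    ∃ A : κ → Finset ι, (∀ k, A k ⊆ M) ∧ (∀ i j, i ≠ j → Disjoint (A i) (A j)) ∧
      ∀ k ∈ I, 27501 / 100000 ≤ v k (A k) := by
  induction n with
  | zero =>
    intro I M J hI _ _ _ _ _
    have : I = ∅ := Finset.card_eq_zero.1 hI
    subst this
    exact ⟨fun _ => ∅, by simp, by simp, by simp⟩
  | succ n ih =>
    intro I M J hI hv hJ hBM hBd hB1
    by_cases hs : ∀ k ∈ I, ∀ e ∈ M, v k {e} < 27501 / 100000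
    · exact thmB I M v hv J hJ B hBM hBd hB1 hs
    push Not at hs
    obtain ⟨i, hi, e, he, hie⟩ := hs
    have hce : (I.erase i).card = n := by rw [Finset.card_erase_of_mem hi]; omega
    obtain ⟨A, h1, h2, h3⟩ := ih (I.erase i) (M.erase e)
      (fun k => (J k).filter (fun j => e ∉ B k j)) hce
      (fun k hk => (hv k (Finset.mem_of_mem_erase hk)).sub (Finset.erase_subset _ _))
      (by
        intro k hk
        have hk := Finset.mem_of_mem_erase hk
        have hone : ((J k).filter (fun j => ¬ e ∉ B k j)).card ≤ 1 := by
          rw [Finset.card_le_one]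
          intro a ha b hb
          simp only [Finset.mem_filter, not_not] at ha hb
          by_contra hab
          exact Finset.disjoint_left.1 (hBd k hk a ha.1 b hb.1 hab) ha.2 hb.2
        have := Finset.card_filter_add_card_filter_not (s := J k) (fun j => e ∉ B k j)
        have := hJ k hk
        omega)
      (by
        intro k hk j hj
        simp only [Finset.mem_filter] at hj
        exact Finset.subset_erase.2 ⟨hBM k (Finset.mem_of_mem_erase hk) j hj.1, hj.2⟩)
      (by
        intro k hk j hj j' hj'
        exact hBd k (Finset.mem_of_mem_erase hk) j (Finset.mem_filter.1 hj).1 j'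
          (Finset.mem_filter.1 hj').1)
      (by
        intro k hk j hj
        exact hB1 k (Finset.mem_of_mem_erase hk) j (Finset.mem_filter.1 hj).1)
    have hne : ∀ k, e ∉ A k := fun k hk => Finset.notMem_erase e M (h1 k hk)
    refine ⟨Function.update A i {e}, ?_, ?_, ?_⟩
    · intro k
      by_cases hk : k = i
      · subst hk; simpa using he
      · simpa [hk] using (h1 k).trans (Finset.erase_subset _ _)
    · intro k l hkl
      by_cases hk : k = i
      · have hl : l ≠ i := fun h => hkl (hk.trans h.symm)
        simp [hk, hl, hne]
      · by_cases hl : l = i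
        · simp [hk, hl, hne]
        · simpa [hk, hl] using h2 k l hkl
    · intro k hk
      by_cases hki : k = i
      · subst hki; simpa using hie
      · simpa [hki] using h3 k (Finset.mem_erase.2 ⟨hki, hk⟩)

lemma mms_attained (M : Finset ι) (v : Finset ι → ℝ) (n : ℕ) (h : 0 < MMS M v n) :
    ∃ P : Fin n → Finset ι, (∀ i j, i ≠ j → Disjoint (P i) (P j)) ∧ (∀ j, P j ⊆ M) ∧
      ∀ j, MMS M v n ≤ v (P j) := by
  set S : Set ℝ := { x | ∃ P : Fin n → Finset ι,
    (∀ i j, i ≠ j → Disjoint (P i) (P j)) ∧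
    Finset.univ.biUnion P = M ∧
    x = ⨅ i, v (P i) } with hS
  have hM : MMS M v n = sSup S := rfl
  have hfin : S.Finite := by
    apply Set.Finite.subset ((Fintype.piFinset (fun _ : Fin n => M.powerset)).finite_toSet.image
      (fun P => ⨅ i, v (P i)))
    rintro x ⟨P, _, h2, rfl⟩
    refine ⟨P, ?_, rfl⟩
    simp only [Finset.mem_coe, Fintype.mem_piFinset, Finset.mem_powerset]
    intro j
    rw [← h2]
    exact Finset.subset_biUnion_of_mem P (Finset.mem_univ j)
  have hne : S.Nonempty := by
    by_contra hne
    rw [Set.not_nonempty_iff_eq_empty] at hne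
    rw [hM, hne, Real.sSup_empty] at h
    exact lt_irrefl _ h
  obtain ⟨P, h1, h2, h3⟩ := hne.csSup_mem hfin
  refine ⟨P, h1, ?_, ?_⟩
  · intro j
    rw [← h2]
    exact Finset.subset_biUnion_of_mem P (Finset.mem_univ j)
  · intro j
    rw [hM, h3]
    exact ciInf_le (Set.finite_range _).bddBelow j

end Cert

/-- There exist `α > 11/40` and `n_α` such that for every `n ≥ n_α`, every finite set `M`
of items and every family of `n` XOS valuations on `M`, there is a partition of `M` into
`n` pairwise disjoint parts giving every agent at least `α` times her maximin share. -/
theorem exists_alpha_MMS_allocation :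
    ∃ α : ℝ, 11 / 40 < α ∧ ∃ nα : ℕ,
      ∀ n : ℕ, nα ≤ n →
      ∀ (ι : Type) [DecidableEq ι], ∀ (M : Finset ι) (v : Fin n → Finset ι → ℝ),
        (∀ i, IsXOS M (v i)) →
        ∃ P : Fin n → Finset ι,
          (∀ i j, i ≠ j → Disjoint (P i) (P j)) ∧
          Finset.univ.biUnion P = M ∧
          ∀ i, α * MMS M (v i) n ≤ v i (P i) := by
  refine ⟨27501 / 100000, by norm_num, 1, ?_⟩
  intro n hn ι _ M v hx
  have hs : ∀ i, Cert.Supp M (v i) := fun i => Cert.supp_of_xos (hx i)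
  have hB : ∀ i, ∃ P : Fin n → Finset ι, 0 < MMS M (v i) n →
      (∀ i j, i ≠ j → Disjoint (P i) (P j)) ∧ (∀ j, P j ⊆ M) ∧ ∀ j, MMS M (v i) n ≤ v i (P j) := by
    intro i
    by_cases h : 0 < MMS M (v i) n
    · obtain ⟨P, hP⟩ := Cert.mms_attained M (v i) n h
      exact ⟨P, fun _ => hP⟩
    · exact ⟨fun _ => ∅, fun h' => absurd h' h⟩
  choose B hB using hB
  classical
  obtain ⟨A, h1, h2, h3⟩ := Cert.thmA (fun i S => v i S / MMS M (v i) n) B _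
    (Finset.univ.filter (fun i => 0 < MMS M (v i) n)) M (fun _ => Finset.univ) rfl
    (fun k hk => (hs k).scale _ (Finset.mem_filter.1 hk).2)
    (fun k _ => Finset.card_le_univ _ |>.trans (by simp))
    (fun k hk j _ => (hB k (Finset.mem_filter.1 hk).2).2.1 j)
    (fun k hk j _ j' _ hne => (hB k (Finset.mem_filter.1 hk).2).1 j j' hne)
    (fun k hk j _ => by
      have h := (Finset.mem_filter.1 hk).2
      rw [le_div_iff₀ h, one_mul]
      exact (hB k h).2.2 j)
  let i0 : Fin n := ⟨0, hn⟩
  let R : Finset ι := M \ Finset.univ.biUnion A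
  have hR : ∀ k, Disjoint (A k) R := fun k =>
    Finset.disjoint_sdiff.mono_left (Finset.subset_biUnion_of_mem A (Finset.mem_univ k))
  let P : Fin n → Finset ι := fun k => if k = i0 then A k ∪ R else A k
  have hAP : ∀ k, A k ⊆ P k := by
    intro k
    simp only [P]
    split_ifs
    · exact Finset.subset_union_left
    · exact subset_rfl
  have hPM : ∀ k, P k ⊆ M := by
    intro k
    simp only [P]
    split_ifs
    · exact Finset.union_subset (h1 k) Finset.sdiff_subset
    · exact h1 k
  refine ⟨P, ?_, ?_, ?_⟩
  · intro i j hij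
    simp only [P]
    split_ifs with hi hj hj
    · exact absurd (hi.trans hj.symm) hij
    · exact Finset.disjoint_union_left.2 ⟨h2 i j hij, (hR j).symm⟩
    · exact Finset.disjoint_union_right.2 ⟨h2 i j hij, hR i⟩
    · exact h2 i j hij
  · apply Finset.Subset.antisymm (Finset.biUnion_subset.2 (fun k _ => hPM k))
    intro e he
    rw [Finset.mem_biUnion]
    by_cases hA : e ∈ Finset.univ.biUnion A
    · obtain ⟨k, hk, hek⟩ := Finset.mem_biUnion.1 hA
      exact ⟨k, hk, hAP k hek⟩
    · refine ⟨i0, Finset.mem_univ _, ?_⟩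
      simp only [P, if_pos]
      exact Finset.mem_union_right _ (Finset.mem_sdiff.2 ⟨he, hA⟩)
  · intro i
    by_cases h : 0 < MMS M (v i) n
    · have h4 := h3 i (Finset.mem_filter.2 ⟨Finset.mem_univ i, h⟩)
      rw [le_div_iff₀ h] at h4
      exact h4.trans ((hs i).mono (hPM i) (hAP i))
    · have h4 := (hs i).nonneg (hPM i)
      push Not at h
      linarith
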